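/- (Theorem 1.1, stability for the right half-line) Let c > 0 and let Q̃_c(s) = (3c/2) · sech²(√c·s/2). There exist constants α₀, C₀, L₀ > 0 such that for all 0 < α < α₀ and all L > L₀ the following holds. Let u be a smooth decaying solution of KdV on the right half-line over [0,∞) satisfying the homogeneous boundary condition u(0,t) = 0 for all t ≥ 0 and the initial closeness ( ∫₀^∞ ( (u(x,0) − Q̃_c(x−L))² + (∂_x u(x,0) − Q̃_c'(x−L))² ) dx )^{1/2} < α. Then there exists a continuously differentiable function ρ : [0,∞) → ℝ such that sup_{t ≥ 0} ( ∫₀^∞ ( (u(x,t) − Q̃_c(x−ρ(t)−L))² + (∂_x u(x,t) − Q̃_c'(x−ρ(t)−L))² ) dx )^{1/2} < C₀·(α + e^{−√c·L}), and there exists a constant C > 0, depending only on c, such that sup_{t ≥ 0} |ρ'(t) − c| < C·C₀·(α + e^{−√c·L}). -/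

import Mathlib

open MeasureTheory Set Filter

/-- A smooth decaying solution of KdV `∂_t u + ∂_x(∂_x² u + u²) = 0` on the right
half-line `[0,∞)`, over a time interval `I`: smooth, satisfying the equation for
`x ≥ 0`, `t ∈ I`, with `u(·,t)` and its `x`-derivatives up to order three
integrable and square integrable on `(0,∞)` and tending to `0` as `x → +∞`,
these bounds being locally uniform in `t`. -/
structure RightKdVSolution (u : ℝ → ℝ → ℝ) (I : Set ℝ) : Prop where
  smooth : ContDiff ℝ (⊤ : ℕ∞) (Function.uncurry u)
  eqn : ∀ x ∈ Ici (0 : ℝ), ∀ t ∈ I,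
    deriv (fun s => u x s) t
      + deriv (fun y => iteratedDeriv 2 (fun z => u z t) y + (u y t) ^ 2) x = 0
  decay : ∀ t ∈ I, ∀ n ≤ 3,
    Tendsto (fun x => iteratedDeriv n (fun z => u z t) x) atTop (nhds 0)
  int1 : ∀ t ∈ I, ∀ n ≤ 3,
    IntegrableOn (fun x => iteratedDeriv n (fun z => u z t) x) (Ioi 0)
  int2 : ∀ t ∈ I, ∀ n ≤ 3,
    IntegrableOn (fun x => (iteratedDeriv n (fun z => u z t) x) ^ 2) (Ioi 0)
  locUnif : ∀ t ∈ I, ∃ ε > 0, ∃ g : ℝ → ℝ, IntegrableOn g (Ioi 0) ∧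
    ∀ s ∈ I, |s - t| < ε → ∀ x ∈ Ioi (0 : ℝ), ∀ n ≤ 3,
      |iteratedDeriv n (fun z => u z s) x| + (iteratedDeriv n (fun z => u z s) x) ^ 2 ≤ g x

/-- The KdV soliton profile `Q̃_c(s) = (3c/2) sech²(√c s / 2)`. -/
noncomputable def Qsol (c s : ℝ) : ℝ :=
  (3 * c / 2) * (1 / Real.cosh (Real.sqrt c * s / 2)) ^ 2

/-! ### The soliton profile in terms of `tanh` -/

/-- `T k y = tanh (k y)`. -/
noncomputable def kT (k y : ℝ) : ℝ := Real.tanh (k * y)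
/-- `sech²(k y)`. -/
noncomputable def kS (k y : ℝ) : ℝ := 1 - kT k y ^ 2
/-- profile -/
noncomputable def kQ (k y : ℝ) : ℝ := 6 * k ^ 2 * kS k y
/-- derivative of the profile -/
noncomputable def kD (k y : ℝ) : ℝ := -(12 * k ^ 3) * (kT k y * kS k y)
/-- second derivative of the profile -/
noncomputable def kE (k y : ℝ) : ℝ := 4 * k ^ 2 * kQ k y - kQ k y ^ 2
/-- scaling direction -/
noncomputable def kP (k y : ℝ) : ℝ := kQ k y + 1 / 2 * (y * kD k y)
/-- its derivative -/
noncomputable def kP1 (k y : ℝ) : ℝ := 3 / 2 * kD k y + 1 / 2 * (y * kE k y)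
/-- its second derivative -/
noncomputable def kP2 (k y : ℝ) : ℝ :=
  2 * kE k y + 1 / 2 * (y * ((4 * k ^ 2 - 2 * kQ k y) * kD k y))

theorem kS_eq (k y : ℝ) : kS k y = 1 / Real.cosh (k * y) ^ 2 := by
  have h := Real.cosh_sq (k * y)
  have h0 := Real.cosh_pos (k * y)
  unfold kS kT
  rw [Real.tanh_eq_sinh_div_cosh]
  field_simp
  linarith

theorem Qsol_eq (c : ℝ) (hc : 0 < c) : Qsol c = kQ (Real.sqrt c / 2) := by
  funext s
  have h : Real.sqrt c * s / 2 = Real.sqrt c / 2 * s := by ring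
  have h2 : Real.sqrt c ^ 2 = c := Real.sq_sqrt hc.le
  unfold Qsol kQ
  rw [kS_eq, h, div_pow (Real.sqrt c), h2, div_pow, one_pow]
  ring

theorem kT_deriv (k y : ℝ) : HasDerivAt (kT k) (k * kS k y) y := by
  have h0 : Real.cosh (k * y) ≠ 0 := (Real.cosh_pos _).ne'
  have h1 : HasDerivAt (fun y => k * y) k y := by simpa using (hasDerivAt_id y).const_mul k
  have h2 := ((Real.hasDerivAt_sinh (k * y)).comp y h1).div
    ((Real.hasDerivAt_cosh (k * y)).comp y h1) h0
  have h3 : kT k = (fun y => (Real.sinh ∘ fun y => k * y) y / (Real.cosh ∘ fun y => k * y) y) := by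
    funext y; simp [kT, Real.tanh_eq_sinh_div_cosh]
  rw [h3]
  refine HasDerivAt.congr_deriv h2 ?_
  rw [kS_eq]
  simp only [Function.comp]
  have h := Real.cosh_sq (k * y)
  field_simp
  rw [h]; ring

theorem kT_abs (k y : ℝ) : |kT k y| < 1 := Real.abs_tanh_lt_one _
theorem kT_lt (k y : ℝ) : kT k y < 1 := Real.tanh_lt_one _
theorem kT_gt (k y : ℝ) : -1 < kT k y := Real.neg_one_lt_tanh _
theorem kS_pos (k y : ℝ) : 0 < kS k y := by
  have := Real.tanh_sq_lt_one (k * y); unfold kS kT; linarith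
theorem kS_le (k y : ℝ) : kS k y ≤ 1 := by
  unfold kS; nlinarith [sq_nonneg (kT k y)]

theorem kS_deriv (k y : ℝ) : HasDerivAt (kS k) (-(2 * k) * (kT k y * kS k y)) y := by
  have := ((kT_deriv k y).pow 2).const_sub 1
  refine this.congr_deriv ?_
  simp; ring

theorem kQ_deriv (k y : ℝ) : HasDerivAt (kQ k) (kD k y) y := by
  have := (kS_deriv k y).const_mul (6 * k ^ 2)
  refine this.congr_deriv ?_
  unfold kD; ring

theorem kD_deriv (k y : ℝ) : HasDerivAt (kD k) (kE k y) y := by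
  have := ((kT_deriv k y).mul (kS_deriv k y)).const_mul (-(12 * k ^ 3))
  refine this.congr_deriv ?_
  unfold kE kQ kS; ring

theorem kE_deriv (k y : ℝ) : HasDerivAt (kE k) ((4 * k ^ 2 - 2 * kQ k y) * kD k y) y := by
  have := ((kQ_deriv k y).const_mul (4 * k ^ 2)).sub ((kQ_deriv k y).pow 2)
  refine this.congr_deriv ?_
  simp; ring

theorem kP_deriv (k y : ℝ) : HasDerivAt (kP k) (kP1 k y) y := by
  have := (kQ_deriv k y).add (((hasDerivAt_id y).mul (kD_deriv k y)).const_mul (1 / 2))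
  refine this.congr_deriv ?_
  simp [kP1]; ring

theorem kP1_deriv (k y : ℝ) : HasDerivAt (kP1 k) (kP2 k y) y := by
  have := ((kD_deriv k y).const_mul (3 / 2)).add
    (((hasDerivAt_id y).mul (kE_deriv k y)).const_mul (1 / 2))
  refine this.congr_deriv ?_
  simp [kP2]; ring

theorem kT_cont (k : ℝ) : Continuous (kT k) :=
  continuous_iff_continuousAt.2 fun y => (kT_deriv k y).continuousAt
theorem kS_cont (k : ℝ) : Continuous (kS k) :=
  continuous_iff_continuousAt.2 fun y => (kS_deriv k y).continuousAt
theorem kQ_cont (k : ℝ) : Continuous (kQ k) :=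
  continuous_iff_continuousAt.2 fun y => (kQ_deriv k y).continuousAt
theorem kD_cont (k : ℝ) : Continuous (kD k) :=
  continuous_iff_continuousAt.2 fun y => (kD_deriv k y).continuousAt
theorem kE_cont (k : ℝ) : Continuous (kE k) :=
  continuous_iff_continuousAt.2 fun y => (kE_deriv k y).continuousAt
theorem kP_cont (k : ℝ) : Continuous (kP k) :=
  continuous_iff_continuousAt.2 fun y => (kP_deriv k y).continuousAt
theorem kP1_cont (k : ℝ) : Continuous (kP1 k) :=
  continuous_iff_continuousAt.2 fun y => (kP1_deriv k y).continuousAt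
theorem kP2_cont (k : ℝ) : Continuous (kP2 k) := by
  have := kQ_cont k; have := kD_cont k; have := kE_cont k
  unfold kP2; fun_prop

theorem kS_bound (k y : ℝ) : (1 + (k * y) ^ 2) * kS k y ≤ 1 := by
  rw [kS_eq]
  have h := Real.cosh_sq (k * y)
  have h0 := Real.cosh_pos (k * y)
  have h1 : (k * y) ^ 2 ≤ Real.sinh (k * y) ^ 2 := by
    rcases le_total 0 (k * y) with h | h
    · have := Real.self_le_sinh_iff.2 h
      nlinarith
    · have := Real.sinh_le_self_iff.2 h
      nlinarith
  rw [mul_one_div, div_le_one (by positivity)]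
  linarith

theorem kS_integrable (k : ℝ) (hk : 0 < k) : Integrable (kS k) := by
  have h1 : Integrable (fun y : ℝ => (1 + (k * y) ^ 2)⁻¹) :=
    integrable_inv_one_add_sq.comp_mul_left' hk.ne'
  refine h1.mono' (kS_cont k).aestronglyMeasurable (Eventually.of_forall fun y => ?_)
  rw [Real.norm_eq_abs, abs_of_pos (kS_pos k y)]
  have := kS_bound k y
  have h0 : 0 < 1 + (k * y) ^ 2 := by positivity
  rw [← one_div, le_div_iff₀ h0]; linarith

theorem kS_tendsto (k : ℝ) (hk : 0 < k) (l : Filter ℝ) (hl : Tendsto (fun y => |y|) l atTop) :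
    Tendsto (kS k) l (nhds 0) := by
  have h2 : Tendsto (fun y : ℝ => (1 + (k * |y|) ^ 2)⁻¹) l (nhds 0) := by
    apply tendsto_inv_atTop_zero.comp
    apply tendsto_atTop_add_const_left
    exact (tendsto_pow_atTop (by norm_num)).comp (hl.const_mul_atTop hk)
  refine squeeze_zero (fun y => (kS_pos k y).le) (fun y => ?_) h2
  have := kS_bound k y
  have h0 : 0 < 1 + (k * |y|) ^ 2 := by positivity
  rw [← one_div, le_div_iff₀ h0, mul_pow, sq_abs, ← mul_pow]; linarith

/-- functions dominated by `(1+|ky|) sech²` are in `L²` -/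
theorem kdom_memLp (k : ℝ) (hk : 0 < k) (f : ℝ → ℝ) (hf : Continuous f) (K : ℝ)
    (hK : ∀ y, |f y| ≤ K * ((1 + |k * y|) * kS k y)) : MemLp f 2 := by
  rw [memLp_two_iff_integrable_sq hf.aestronglyMeasurable]
  refine ((kS_integrable k hk).const_mul (2 * K ^ 2)).mono' (by fun_prop)
    (Eventually.of_forall fun y => ?_)
  rw [Real.norm_eq_abs, abs_pow, ]
  have h1 := kS_bound k y
  have h2 := kS_pos k y
  calc |f y| ^ 2 ≤ (K * ((1 + |k * y|) * kS k y)) ^ 2 := pow_le_pow_left₀ (abs_nonneg _) (hK y) 2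
    _ = K ^ 2 * ((1 + |k * y|) ^ 2 * kS k y) * kS k y := by ring
    _ ≤ K ^ 2 * 2 * kS k y := by
      gcongr
      have : (1 + |k * y|) ^ 2 ≤ 2 * (1 + (k * y) ^ 2) := by
        rw [← sq_abs (k * y)]; nlinarith [sq_nonneg (1 - |k * y|)]
      nlinarith
    _ = _ := by ring

theorem kdom_tendsto (k : ℝ) (hk : 0 < k) (f : ℝ → ℝ) (K : ℝ)
    (hK : ∀ y, |f y| ≤ K * ((1 + |k * y|) * kS k y)) (l : Filter ℝ)
    (hl : Tendsto (fun y => |y|) l atTop) : Tendsto f l (nhds 0) := by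
  have h3 : Tendsto (fun y => Real.sqrt (2 * K ^ 2 * kS k y)) l (nhds 0) := by
    have := (kS_tendsto k hk l hl).const_mul (2 * K ^ 2)
    rw [mul_zero] at this
    have := (Real.continuous_sqrt.tendsto 0).comp this
    simpa [Function.comp_def] using this
  refine squeeze_zero_norm (fun y => ?_) h3
  rw [Real.norm_eq_abs]
  apply Real.le_sqrt_of_sq_le
  have h1 := kS_bound k y
  have h2 := kS_pos k y
  calc |f y| ^ 2 ≤ (K * ((1 + |k * y|) * kS k y)) ^ 2 := pow_le_pow_left₀ (abs_nonneg _) (hK y) 2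
    _ = K ^ 2 * ((1 + |k * y|) ^ 2 * kS k y) * kS k y := by ring
    _ ≤ K ^ 2 * 2 * kS k y := by
      gcongr
      have : (1 + |k * y|) ^ 2 ≤ 2 * (1 + (k * y) ^ 2) := by
        rw [← sq_abs (k * y)]; nlinarith [sq_nonneg (1 - |k * y|)]
      nlinarith
    _ = _ := by ring

theorem kQ_pos (k : ℝ) (hk : 0 < k) (y : ℝ) : 0 < kQ k y := by
  have := kS_pos k y; unfold kQ; positivity
theorem kQ_le (k : ℝ) (y : ℝ) : kQ k y ≤ 6 * k ^ 2 := by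
  have := kS_le k y; unfold kQ; nlinarith [sq_nonneg k]
theorem kD_abs (k : ℝ) (hk : 0 < k) (y : ℝ) : |kD k y| ≤ 2 * k * kQ k y := by
  have h1 := kT_abs k y
  have h2 := kS_pos k y
  unfold kD kQ
  rw [abs_mul, abs_neg, abs_of_pos (by positivity : 0 < 12 * k ^ 3), abs_mul, abs_of_pos h2]
  have : 0 < 12 * k ^ 3 := by positivity
  have : |kT k y| * kS k y ≤ kS k y := by nlinarith
  nlinarith
theorem kE_abs (k : ℝ) (hk : 0 < k) (y : ℝ) : |kE k y| ≤ 4 * k ^ 2 * kQ k y := by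
  have h1 := kQ_pos k hk y
  have h2 := kQ_le k y
  unfold kE
  rw [abs_le]; constructor <;> nlinarith [sq_nonneg k]

/-- generic domination: anything bounded by `A Q + B |y| Q`. -/
theorem kdom_of_Q (k : ℝ) (hk : 0 < k) (f : ℝ → ℝ) (A B : ℝ) (hB : 0 ≤ B) (hA : 0 ≤ A)
    (h : ∀ y, |f y| ≤ A * kQ k y + B * (|y| * kQ k y)) :
    ∀ y, |f y| ≤ ((A + B / k) * (6 * k ^ 2)) * ((1 + |k * y|) * kS k y) := by
  intro y
  refine (h y).trans ?_
  have h2 := kS_pos k y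
  have h3 : |k * y| = k * |y| := by rw [abs_mul, abs_of_pos hk]
  have h4 : 0 ≤ |y| := abs_nonneg y
  rw [h3]; unfold kQ
  have e : (A + B / k) * (6 * k ^ 2) * ((1 + k * |y|) * kS k y) -
    (A * (6 * k ^ 2 * kS k y) + B * (|y| * (6 * k ^ 2 * kS k y)))
     = (6 * k ^ 2 * kS k y) * (B / k + A * (k * |y|)) := by field_simp; ring
  have : 0 ≤ (6 * k ^ 2 * kS k y) * (B / k + A * (k * |y|)) := by positivity
  linarith

theorem kQ_dom (k : ℝ) (hk : 0 < k) (y : ℝ) : |kQ k y| ≤ 1 * kQ k y + 0 * (|y| * kQ k y) := by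
  rw [abs_of_pos (kQ_pos k hk y)]; linarith
theorem kD_dom (k : ℝ) (hk : 0 < k) (y : ℝ) :
    |kD k y| ≤ (2 * k) * kQ k y + 0 * (|y| * kQ k y) := by
  have := kD_abs k hk y; linarith
theorem kE_dom (k : ℝ) (hk : 0 < k) (y : ℝ) :
    |kE k y| ≤ (4 * k ^ 2) * kQ k y + 0 * (|y| * kQ k y) := by
  have := kE_abs k hk y; linarith
theorem kF_abs (k : ℝ) (hk : 0 < k) (y : ℝ) :
    |(4 * k ^ 2 - 2 * kQ k y) * kD k y| ≤ 8 * k ^ 2 * (2 * k * kQ k y) := by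
  have h1 := kQ_pos k hk y
  have h2 := kQ_le k y
  rw [abs_mul]
  have : |4 * k ^ 2 - 2 * kQ k y| ≤ 8 * k ^ 2 := by rw [abs_le]; constructor <;> nlinarith [sq_nonneg k]
  exact mul_le_mul this (kD_abs k hk y) (abs_nonneg _) (by positivity)
theorem kF_dom (k : ℝ) (hk : 0 < k) (y : ℝ) :
    |(4 * k ^ 2 - 2 * kQ k y) * kD k y| ≤ (16 * k ^ 3) * kQ k y + 0 * (|y| * kQ k y) := by
  have := kF_abs k hk y; linarith
theorem kP_dom (k : ℝ) (hk : 0 < k) (y : ℝ) :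
    |kP k y| ≤ 1 * kQ k y + k * (|y| * kQ k y) := by
  unfold kP
  refine (abs_add_le _ _).trans ?_
  rw [abs_of_pos (kQ_pos k hk y), abs_mul, abs_mul, abs_of_pos (by norm_num : (0:ℝ) < 1 / 2)]
  have := mul_le_mul_of_nonneg_left (kD_abs k hk y) (abs_nonneg y)
  linarith
theorem kP1_dom (k : ℝ) (hk : 0 < k) (y : ℝ) :
    |kP1 k y| ≤ (3 * k) * kQ k y + (2 * k ^ 2) * (|y| * kQ k y) := by
  unfold kP1
  refine (abs_add_le _ _).trans ?_
  rw [abs_mul, abs_mul, abs_mul, abs_of_pos (by norm_num : (0:ℝ) < 1 / 2),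
    abs_of_pos (by norm_num : (0:ℝ) < 3 / 2)]
  have := mul_le_mul_of_nonneg_left (kE_abs k hk y) (abs_nonneg y)
  have := kD_abs k hk y
  linarith
theorem kP2_dom (k : ℝ) (hk : 0 < k) (y : ℝ) :
    |kP2 k y| ≤ (8 * k ^ 2) * kQ k y + (8 * k ^ 3) * (|y| * kQ k y) := by
  unfold kP2
  refine (abs_add_le _ _).trans ?_
  rw [abs_mul, abs_mul, abs_mul y, abs_of_pos (by norm_num : (0:ℝ) < 1 / 2),
    abs_of_pos (by norm_num : (0:ℝ) < 2)]
  have := mul_le_mul_of_nonneg_left (kF_abs k hk y) (abs_nonneg y)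
  have := kE_abs k hk y
  linarith

/-! ### A class of `H¹` functions on the line, smooth off one point -/

/-- `f` is a continuous `H¹` function with derivative `g` off the point `e`. -/
structure H1f (e : ℝ) (f g : ℝ → ℝ) : Prop where
  cont : Continuous f
  der : ∀ x, x ≠ e → HasDerivAt f (g x) x
  f2 : MemLp f 2
  g2 : MemLp g 2
  top : Tendsto f atTop (nhds 0)
  bot : Tendsto f atBot (nhds 0)

theorem H1f.add {e : ℝ} {f g f' g' : ℝ → ℝ} (h : H1f e f g) (h' : H1f e f' g') :
    H1f e (fun x => f x + f' x) (fun x => g x + g' x) where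
  cont := h.cont.add h'.cont
  der := fun x hx => (h.der x hx).add (h'.der x hx)
  f2 := h.f2.add h'.f2
  g2 := h.g2.add h'.g2
  top := by simpa using h.top.add h'.top
  bot := by simpa using h.bot.add h'.bot

theorem H1f.smul {e : ℝ} {f g : ℝ → ℝ} (a : ℝ) (h : H1f e f g) :
    H1f e (fun x => a * f x) (fun x => a * g x) where
  cont := h.cont.const_mul a
  der := fun x hx => (h.der x hx).const_mul a
  f2 := h.f2.const_mul a
  g2 := h.g2.const_mul a
  top := by simpa using h.top.const_mul a
  bot := by simpa using h.bot.const_mul a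

theorem H1f.sub {e : ℝ} {f g f' g' : ℝ → ℝ} (h : H1f e f g) (h' : H1f e f' g') :
    H1f e (fun x => f x - f' x) (fun x => g x - g' x) where
  cont := h.cont.sub h'.cont
  der := fun x hx => (h.der x hx).sub (h'.der x hx)
  f2 := h.f2.sub h'.f2
  g2 := h.g2.sub h'.g2
  top := by simpa using h.top.sub h'.top
  bot := by simpa using h.bot.sub h'.bot

theorem H1f.shift {e : ℝ} {f g : ℝ → ℝ} (h : H1f e f g) (z : ℝ) :
    H1f (e - z) (fun x => f (x + z)) (fun x => g (x + z)) where
  cont := h.cont.comp (continuous_id.add continuous_const)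
  der := fun x hx => by
    have := h.der (x + z) (fun h => hx (by linarith))
    exact this.comp_add_const x z
  f2 := h.f2.comp_measurePreserving (measurePreserving_add_right volume z)
  g2 := h.g2.comp_measurePreserving (measurePreserving_add_right volume z)
  top := h.top.comp (tendsto_atTop_add_const_right _ _ tendsto_id)
  bot := h.bot.comp (tendsto_atBot_add_const_right _ _ tendsto_id)

theorem H1f_of_dom (k : ℝ) (hk : 0 < k) (e : ℝ) (f g : ℝ → ℝ) (A B A' B' : ℝ)
    (hf : ∀ x, HasDerivAt f (g x) x) (hg : Continuous g) (hA : 0 ≤ A) (hB : 0 ≤ B)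
    (hA' : 0 ≤ A') (hB' : 0 ≤ B')
    (h : ∀ y, |f y| ≤ A * kQ k y + B * (|y| * kQ k y))
    (h' : ∀ y, |g y| ≤ A' * kQ k y + B' * (|y| * kQ k y)) : H1f e f g := by
  have hfc : Continuous f := continuous_iff_continuousAt.2 fun y => (hf y).continuousAt
  exact ⟨hfc, fun x _ => hf x, kdom_memLp k hk f hfc _ (kdom_of_Q k hk f A B hB hA h),
   kdom_memLp k hk g hg _ (kdom_of_Q k hk g A' B' hB' hA' h'),
   kdom_tendsto k hk f _ (kdom_of_Q k hk f A B hB hA h) _ tendsto_abs_atTop_atTop,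
   kdom_tendsto k hk f _ (kdom_of_Q k hk f A B hB hA h) _ tendsto_abs_atBot_atTop⟩

theorem kQ_H1 (k : ℝ) (hk : 0 < k) (e : ℝ) : H1f e (kQ k) (kD k) :=
  H1f_of_dom k hk e _ _ _ _ _ _ (kQ_deriv k) (kD_cont k) (by positivity) (by positivity)
    (by positivity) (by positivity) (kQ_dom k hk) (kD_dom k hk)
theorem kD_H1 (k : ℝ) (hk : 0 < k) (e : ℝ) : H1f e (kD k) (kE k) :=
  H1f_of_dom k hk e _ _ _ _ _ _ (kD_deriv k) (kE_cont k) (by positivity) (by positivity)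
    (by positivity) (by positivity) (kD_dom k hk) (kE_dom k hk)
theorem kE_H1 (k : ℝ) (hk : 0 < k) (e : ℝ) :
    H1f e (kE k) (fun y => (4 * k ^ 2 - 2 * kQ k y) * kD k y) :=
  H1f_of_dom k hk e _ _ _ _ _ _ (kE_deriv k)
    (by have := kQ_cont k; have := kD_cont k; fun_prop) (by positivity) (by positivity)
    (by positivity) (by positivity) (kE_dom k hk) (kF_dom k hk)
theorem kP_H1 (k : ℝ) (hk : 0 < k) (e : ℝ) : H1f e (kP k) (kP1 k) :=
  H1f_of_dom k hk e _ _ _ _ _ _ (kP_deriv k) (kP1_cont k) (by positivity) (by positivity)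
    (by positivity) (by positivity) (kP_dom k hk) (kP1_dom k hk)
theorem kP1_H1 (k : ℝ) (hk : 0 < k) (e : ℝ) : H1f e (kP1 k) (kP2 k) :=
  H1f_of_dom k hk e _ _ _ _ _ _ (kP1_deriv k) (kP2_cont k) (by positivity) (by positivity)
    (by positivity) (by positivity) (kP1_dom k hk) (kP2_dom k hk)

theorem memLp_mul_int {f g : ℝ → ℝ} (hf : MemLp f 2) (hg : MemLp g 2) :
    Integrable (fun x => f x * g x) := MemLp.integrable_mul hf hg

/-- bounded continuous times integrable -/
theorem int_bdd_mul {f h : ℝ → ℝ} (hf : Integrable f) (hh : Continuous h) (K : ℝ)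
    (hK : ∀ x, |h x| ≤ K) : Integrable (fun x => h x * f x) :=
  hf.bdd_mul hh.aestronglyMeasurable (Eventually.of_forall hK)

theorem lin2 {a b : ℝ → ℝ} (r s : ℝ) (ha : Integrable a) (hb : Integrable b) :
    ∫ x, (r * a x + s * b x) = r * (∫ x, a x) + s * ∫ x, b x := by
  rw [integral_add (ha.const_mul r) (hb.const_mul s), integral_const_mul, integral_const_mul]

theorem lin3 {a b c : ℝ → ℝ} (r s t : ℝ) (ha : Integrable a) (hb : Integrable b)
    (hc : Integrable c) :
    ∫ x, (r * a x + s * b x + t * c x) = r * (∫ x, a x) + s * (∫ x, b x) + t * ∫ x, c x := by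
  rw [← lin2 r s ha hb, ← integral_const_mul]
  exact integral_add ((ha.const_mul r).add (hb.const_mul s)) (hc.const_mul t)

theorem lin4 {a b c d : ℝ → ℝ} (r s t u : ℝ) (ha : Integrable a) (hb : Integrable b)
    (hc : Integrable c) (hd : Integrable d) :
    ∫ x, (r * a x + s * b x + t * c x + u * d x)
      = r * (∫ x, a x) + s * (∫ x, b x) + t * (∫ x, c x) + u * ∫ x, d x := by
  rw [← lin3 r s t ha hb hc, ← integral_const_mul]
  exact integral_add (((ha.const_mul r).add (hb.const_mul s)).add (hc.const_mul t))
    (hd.const_mul u)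

theorem lin5 {a b c d f : ℝ → ℝ} (r s t u v : ℝ) (ha : Integrable a) (hb : Integrable b)
    (hc : Integrable c) (hd : Integrable d) (hf : Integrable f) :
    ∫ x, (r * a x + s * b x + t * c x + u * d x + v * f x)
      = r * (∫ x, a x) + s * (∫ x, b x) + t * (∫ x, c x) + u * (∫ x, d x) + v * ∫ x, f x := by
  rw [← lin4 r s t u ha hb hc hd, ← integral_const_mul]
  exact integral_add ((((ha.const_mul r).add (hb.const_mul s)).add (hc.const_mul t)).add
    (hd.const_mul u)) (hf.const_mul v)

theorem cs_int {f g : ℝ → ℝ} (hf : MemLp f 2) (hg : MemLp g 2) :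
    (∫ x, f x * g x) ^ 2 ≤ (∫ x, f x ^ 2) * ∫ x, g x ^ 2 := by
  have h : ∀ r : ℝ, 0 ≤ (∫ x, g x ^ 2) * (r * r) + (2 * ∫ x, f x * g x) * r + ∫ x, f x ^ 2 := by
    intro r
    have h1 : 0 ≤ ∫ x, (f x + r * g x) ^ 2 := integral_nonneg fun x => sq_nonneg _
    have h2 : ∫ x, (f x + r * g x) ^ 2 =
        ∫ x, (1 * f x ^ 2 + (2 * r) * (f x * g x) + (r * r) * g x ^ 2) := by
      congr 1; funext x; ring
    rw [h2, lin3 _ _ _ hf.integrable_sq (memLp_mul_int hf hg) hg.integrable_sq] at h1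
    linarith
  have := discrim_le_zero h
  unfold discrim at this
  linarith

theorem ftc_line (e : ℝ) (F F' : ℝ → ℝ) (hc : Continuous F)
    (hd : ∀ x, x ≠ e → HasDerivAt F (F' x) x) (hi : Integrable F')
    (ht : Tendsto F atTop (nhds 0)) (hb : Tendsto F atBot (nhds 0)) : ∫ x, F' x = 0 := by
  have h1 := intervalIntegral_tendsto_integral (μ := volume) hi tendsto_neg_atTop_atBot tendsto_id
  have h2 : ∀ r : ℝ, ∫ x in (-r)..(id r), F' x = F r - F (-r) := by
    intro r
    refine integral_eq_of_hasDerivAt_off_countable F F' (s := {e}) (countable_singleton e)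
      hc.continuousOn (fun x hx => hd x hx.2) hi.intervalIntegrable
  simp_rw [h2] at h1
  have h3 : Tendsto (fun r => F r - F (-r)) atTop (nhds 0) := by
    simpa using ht.sub (hb.comp tendsto_neg_atTop_atBot)
  exact tendsto_nhds_unique h1 h3

/-- integration by parts -/
theorem ibp {e : ℝ} {f g f' g' : ℝ → ℝ} (h : H1f e f g) (h' : H1f e f' g') :
    ∫ x, g x * f' x = - ∫ x, f x * g' x := by
  have h0 := ftc_line e (fun x => f x * f' x) (fun x => g x * f' x + f x * g' x)
    (h.cont.mul h'.cont) (fun x hx => (h.der x hx).mul (h'.der x hx))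
    ((memLp_mul_int h.g2 h'.f2).add (memLp_mul_int h.f2 h'.g2))
    (by simpa using h.top.mul h'.top) (by simpa using h.bot.mul h'.bot)
  rw [integral_add (memLp_mul_int h.g2 h'.f2) (memLp_mul_int h.f2 h'.g2)] at h0
  linarith

/-- sup bound -/
theorem H1f.sup {e : ℝ} {f g : ℝ → ℝ} (h : H1f e f g) (x : ℝ) :
    f x ^ 2 ≤ (∫ x, f x ^ 2) + ∫ x, g x ^ 2 := by
  have hi : Integrable (fun x => f x ^ 2 + g x ^ 2) := h.f2.integrable_sq.add h.g2.integrable_sq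
  have hi2 : Integrable (fun x => 2 * (f x * g x)) := (memLp_mul_int h.f2 h.g2).const_mul 2
  have h1 := intervalIntegral_tendsto_integral_Iic x (hi.integrableOn) tendsto_id
  have h2 : ∀ r : ℝ, r ≤ x → f x ^ 2 - f r ^ 2 ≤ ∫ y in (id r)..x, (f y ^ 2 + g y ^ 2) := by
    intro r hr
    have := integral_eq_of_hasDerivAt_off_countable (a := r) (b := x)
      (fun y => f y ^ 2) (fun y => 2 * (f y * g y)) (s := {e})
      (countable_singleton e)
      (h.cont.pow 2).continuousOn (fun x hx => by
        have := (h.der x hx.2).pow 2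
        refine this.congr_deriv ?_
        simp; ring) hi2.intervalIntegrable
    rw [← this]
    refine intervalIntegral.integral_mono_on hr hi2.intervalIntegrable hi.intervalIntegrable ?_
    intro y _
    nlinarith [sq_nonneg (f y - g y)]
  have h3 : Tendsto (fun r => f x ^ 2 - f r ^ 2) atBot (nhds (f x ^ 2)) := by
    simpa using (h.bot.pow 2).const_sub (f x ^ 2)
  have h4 := le_of_tendsto_of_tendsto h3 h1
    ((eventually_le_atBot x).mono fun r hr => h2 r hr)
  rw [← integral_add h.f2.integrable_sq h.g2.integrable_sq]
  refine h4.trans (setIntegral_le_integral hi (Eventually.of_forall fun x => by positivity))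

theorem riccati_interval {e : ℝ} {f g : ℝ → ℝ} (h : H1f e f g) (W W' V : ℝ → ℝ) {a b : ℝ}
    (hab : a ≤ b) (hW : ∀ x ∈ Icc a b, HasDerivAt W (W' x) x) (hWc : ContinuousOn W' (Icc a b))
    (hV : Continuous V) (hle : ∀ x ∈ Icc a b, W' x + W x ^ 2 ≤ V x) :
    W b * f b ^ 2 - W a * f a ^ 2 ≤ ∫ x in a..b, (g x ^ 2 + V x * f x ^ 2) := by
  have hWc0 : ContinuousOn W (Icc a b) := fun x hx => (hW x hx).continuousAt.continuousWithinAt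
  have hu : uIcc a b = Icc a b := uIcc_of_le hab
  have hfg : Integrable (fun x => f x * g x) := memLp_mul_int h.f2 h.g2
  have i1 : IntervalIntegrable (fun x => W' x * f x ^ 2 + 2 * (W x * (f x * g x))) volume a b := by
    refine IntervalIntegrable.add ?_ ?_
    · apply ContinuousOn.intervalIntegrable
      rw [hu]; exact hWc.mul (h.cont.pow 2).continuousOn
    · apply IntervalIntegrable.const_mul
      exact hfg.intervalIntegrable.continuousOn_mul (by rw [hu]; exact hWc0)
  have i2 : IntervalIntegrable (fun x => g x ^ 2 + V x * f x ^ 2) volume a b :=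
    h.g2.integrable_sq.intervalIntegrable.add
      ((hV.mul (h.cont.pow 2)).intervalIntegrable _ _)
  have := integral_eq_of_hasDerivAt_off_countable (a := a) (b := b)
      (fun y => W y * f y ^ 2) (fun x => W' x * f x ^ 2 + 2 * (W x * (f x * g x))) (s := {e})
      (countable_singleton e) (by rw [hu]; exact hWc0.mul (h.cont.pow 2).continuousOn)
      (fun x hx => by
        rw [min_eq_left hab, max_eq_right hab] at hx
        have := (hW x (Ioo_subset_Icc_self hx.1)).mul ((h.der x hx.2).pow 2)
        refine this.congr_deriv ?_
        simp; ring) i1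
  rw [← this]
  refine intervalIntegral.integral_mono_on hab i1 i2 ?_
  intro y hy
  have h1 := hle y hy
  nlinarith [sq_nonneg (g y - W y * f y), mul_le_mul_of_nonneg_right h1 (sq_nonneg (f y))]

/-! ### Spectral gap and coercivity -/

theorem kT_mono (k : ℝ) (hk : 0 < k) : StrictMono (kT k) := by
  apply strictMono_of_deriv_pos
  intro x
  rw [(kT_deriv k x).deriv]
  exact mul_pos hk (kS_pos k x)

theorem kT_neg (k y : ℝ) : kT k (-y) = -kT k y := by
  unfold kT; rw [mul_neg, Real.tanh_neg]

theorem poly_outer (T : ℝ) (h1 : 1 / 8 ≤ T) (h2 : T ≤ 1) :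
    (T - 1 / 10) * (-(9 / 5) * (1 - T ^ 2) + 81 / 25 * T ^ 2 - 12 * T ^ 2 + 33 / 4)
      ≤ 28 / 5 * (T * (1 - T ^ 2)) := by
  nlinarith [mul_nonneg (sub_nonneg.2 h1) (sub_nonneg.2 h2), sq_nonneg (T - 7 / 10),
    mul_nonneg (sub_nonneg.2 h1) (sq_nonneg (T - 7 / 10)),
    mul_nonneg (sub_nonneg.2 h2) (sq_nonneg (T - 7 / 10))]

/-- potential -/
noncomputable def kV (k y : ℝ) : ℝ := 4 * k ^ 2 - 2 * kQ k y - k ^ 2 / 4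

theorem kV_eq (k y : ℝ) : kV k y = k ^ 2 * (12 * kT k y ^ 2 - 33 / 4) := by
  unfold kV kQ kS; ring

theorem outer_deriv (k s y : ℝ) (h : kT k y - s / 10 ≠ 0) :
    HasDerivAt (fun y => k * (-(9 / 5) * kT k y + kS k y / (kT k y - s / 10)))
      (k * (-(9 / 5) * (k * kS k y) + ((-(2 * k) * (kT k y * kS k y)) * (kT k y - s / 10)
        - kS k y * (k * kS k y)) / (kT k y - s / 10) ^ 2)) y :=
  (((kT_deriv k y).const_mul _).add ((kS_deriv k y).div ((kT_deriv k y).sub_const _) h)).const_mul k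

theorem outer_ident (k T S D : ℝ) (hD : D ≠ 0) :
    k * (-(9 / 5) * (k * S) + ((-(2 * k) * (T * S)) * D - S * (k * S)) / D ^ 2) +
      (k * (-(9 / 5) * T + S / D)) ^ 2 =
      k ^ 2 * (-(9 / 5) * S - 28 / 5 * (T * S) / D + 81 / 25 * T ^ 2) := by
  field_simp
  ring

theorem gap_lemma (k : ℝ) (hk : 0 < k) (e : ℝ) (f g : ℝ → ℝ) (h : H1f e f g) (x0 : ℝ)
    (hx0 : 0 < x0) (hT : kT k x0 = 1 / 8) (h1 : f x0 = 0) (h2 : f (-x0) = 0) :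
    0 ≤ ∫ x, (g x ^ 2 + kV k x * f x ^ 2) := by
  have hVc : Continuous (kV k) := by have := kQ_cont k; unfold kV; fun_prop
  have hVi : Integrable (fun x => g x ^ 2 + kV k x * f x ^ 2) := by
    refine h.g2.integrable_sq.add (int_bdd_mul h.f2.integrable_sq hVc (k ^ 2 * 21) ?_)
    intro x
    rw [kV_eq, abs_mul, abs_of_nonneg (sq_nonneg k)]
    have := sq_nonneg (kT k x)
    have h3 := (sq_lt_one_iff_abs_lt_one _).2 (kT_abs k x)
    gcongr
    rw [abs_le]; constructor <;> linarith
  have hTc := kT_cont k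
  have hSc := kS_cont k
  have hR := intervalIntegral_tendsto_integral (μ := volume) hVi tendsto_neg_atTop_atBot tendsto_id
  have hmono := (kT_mono k hk).monotone
  have key : ∀ R, x0 ≤ R → -(42 * k) * (f R ^ 2 + f (-R) ^ 2) ≤
      ∫ x in (-R)..(id R), (g x ^ 2 + kV k x * f x ^ 2) := by
    intro R hRx
    have hneg : ∀ x ∈ Icc (-R) (-x0), kT k x ≤ -(1 / 8) := by
      intro x hx
      have := hmono hx.2
      rw [kT_neg, hT] at this; exact this
    have hpos : ∀ x ∈ Icc x0 R, 1 / 8 ≤ kT k x := by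
      intro x hx
      have := hmono hx.1
      rw [hT] at this; exact this
    have a3 := riccati_interval h (a := x0) (b := R) _ _ (kV k) hRx
      (fun x hx => outer_deriv k 1 x (by have := hpos x hx; intro h; linarith))
      (by
        have : ∀ x ∈ Icc x0 R, (kT k x - 1 / 10) ^ 2 ≠ 0 := fun x hx => by
          have := hpos x hx
          have : 0 < kT k x - 1 / 10 := by linarith
          positivity
        fun_prop (disch := assumption)) hVc
      (by
        intro x hx
        have hp := hpos x hx
        have hl := kT_lt k x
        rw [kV_eq]
        have hD : 0 < kT k x - 1 / 10 := by linarith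
        have hpoly := poly_outer (kT k x) hp hl.le
        rw [← le_div_iff₀' hD] at hpoly
        have e1 : k * (-(9 / 5) * (k * kS k x) + ((-(2 * k) * (kT k x * kS k x)) * (kT k x - 1 / 10)
            - kS k x * (k * kS k x)) / (kT k x - 1 / 10) ^ 2) +
            (k * (-(9 / 5) * kT k x + kS k x / (kT k x - 1 / 10))) ^ 2 =
            k ^ 2 * (-(9 / 5) * (1 - kT k x ^ 2) -
              28 / 5 * (kT k x * (1 - kT k x ^ 2)) / (kT k x - 1 / 10) + 81 / 25 * kT k x ^ 2) := by
          have : kS k x = 1 - kT k x ^ 2 := rfl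
          rw [← this]
          exact outer_ident k _ _ _ hD.ne'
        rw [e1]
        have := mul_le_mul_of_nonneg_left hpoly (sq_nonneg k)
        nlinarith)
    have a1 := riccati_interval h (a := -R) (b := -x0) _ _ (kV k) (by linarith)
      (fun x hx => outer_deriv k (-1) x (by have := hneg x hx; intro h; linarith))
      (by
        have : ∀ x ∈ Icc (-R) (-x0), (kT k x - (-1) / 10) ^ 2 ≠ 0 := fun x hx => by
          have := hneg x hx
          have : kT k x - (-1) / 10 < 0 := by linarith
          exact pow_ne_zero 2 this.ne
        fun_prop (disch := assumption)) hVc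
      (by
        intro x hx
        have hp := hneg x hx
        have hl := kT_gt k x
        rw [kV_eq]
        have hD : 0 < -kT k x - 1 / 10 := by linarith
        have hpoly := poly_outer (-kT k x) (by linarith) (by linarith)
        rw [← le_div_iff₀' hD] at hpoly
        have hD' : kT k x - (-1) / 10 ≠ 0 := by intro h; linarith
        have e1 : k * (-(9 / 5) * (k * kS k x) + ((-(2 * k) * (kT k x * kS k x)) * (kT k x - (-1) / 10)
            - kS k x * (k * kS k x)) / (kT k x - (-1) / 10) ^ 2) +
            (k * (-(9 / 5) * kT k x + kS k x / (kT k x - (-1) / 10))) ^ 2 =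
            k ^ 2 * (-(9 / 5) * (1 - (-kT k x) ^ 2) -
              28 / 5 * ((-kT k x) * (1 - (-kT k x) ^ 2)) / (-kT k x - 1 / 10)
              + 81 / 25 * (-kT k x) ^ 2) := by
          have h3 : kS k x = 1 - (-kT k x) ^ 2 := by unfold kS; ring
          have h4 : -kT k x - 1 / 10 = -(kT k x - (-1) / 10) := by ring
          rw [← h3, h4, outer_ident k _ _ _ hD', div_neg]
          ring
        rw [e1]
        have := mul_le_mul_of_nonneg_left hpoly (sq_nonneg k)
        nlinarith)
    have a2 := riccati_interval h (a := -x0) (b := x0) (fun y => -(12 * k) * kT k y)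
      (fun y => -(12 * k) * (k * kS k y)) (kV k) (by linarith)
      (fun x hx => (kT_deriv k x).const_mul _) (by fun_prop) hVc
      (by
        intro x hx
        have b1 := hmono hx.1
        have b2 := hmono hx.2
        rw [kT_neg, hT] at b1
        rw [hT] at b2
        rw [kV_eq]
        unfold kS
        have : kT k x ^ 2 ≤ 1 / 64 := by nlinarith
        nlinarith [sq_nonneg k, mul_le_mul_of_nonneg_left this (sq_nonneg k)])
    have ii : ∀ a b, IntervalIntegrable (fun x => g x ^ 2 + kV k x * f x ^ 2) volume a b :=
      fun a b => hVi.intervalIntegrable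
    have hs : ∫ x in (-R)..(id R), (g x ^ 2 + kV k x * f x ^ 2) =
       (∫ x in (-R)..(-x0), (g x ^ 2 + kV k x * f x ^ 2)) +
       (∫ x in (-x0)..x0, (g x ^ 2 + kV k x * f x ^ 2)) +
       ∫ x in x0..R, (g x ^ 2 + kV k x * f x ^ 2) := by
      rw [intervalIntegral.integral_add_adjacent_intervals (ii _ _) (ii _ _),
        intervalIntegral.integral_add_adjacent_intervals (ii _ _) (ii _ _)]
      rfl
    rw [hs]
    simp only [h1, h2] at a1 a2 a3
    have hTR := hpos R ⟨hRx, le_rfl⟩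
    have hTR1 := kT_lt k R
    have b3 : -42 ≤ -(9 / 5) * kT k R + kS k R / (kT k R - 1 / 10) := by
      have : 0 ≤ kS k R / (kT k R - 1 / 10) := div_nonneg (kS_pos k R).le (by linarith)
      linarith
    have b1 : -(9 / 5) * kT k (-R) + kS k (-R) / (kT k (-R) - (-1) / 10) ≤ 42 := by
      have h5 : kT k (-R) = -kT k R := kT_neg k R
      have : kS k (-R) / (kT k (-R) - (-1) / 10) ≤ 0 :=
        div_nonpos_of_nonneg_of_nonpos (kS_pos k _).le (by rw [h5]; linarith)
      rw [h5] at *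
      linarith
    have c3 := mul_le_mul_of_nonneg_right b3 (mul_nonneg hk.le (sq_nonneg (f R)))
    have c1 := mul_le_mul_of_nonneg_right b1 (mul_nonneg hk.le (sq_nonneg (f (-R))))
    nlinarith
  have ht : Tendsto (fun R => -(42 * k) * (f R ^ 2 + f (-R) ^ 2)) atTop (nhds 0) := by
    have := ((h.top.pow 2).add ((h.bot.comp tendsto_neg_atTop_atBot).pow 2)).const_mul (-(42 * k))
    simpa using this
  exact le_of_tendsto_of_tendsto ht hR ((eventually_ge_atTop x0).mono key)

/-- the linearized potential -/
noncomputable def kW (k y : ℝ) : ℝ := 4 * k ^ 2 - 2 * kQ k y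

theorem kW_cont (k : ℝ) : Continuous (kW k) := by have := kQ_cont k; unfold kW; fun_prop

theorem kW_abs (k : ℝ) (hk : 0 < k) (y : ℝ) : |kW k y| ≤ 8 * k ^ 2 := by
  have h1 := kQ_pos k hk y
  have h2 := kQ_le k y
  unfold kW
  rw [abs_le]; constructor <;> nlinarith

theorem memLp_bdd_mul {f h : ℝ → ℝ} (hf : MemLp f 2) (hh : Continuous h) (K : ℝ)
    (hK : ∀ x, |h x| ≤ K) : MemLp (fun x => h x * f x) 2 := by
  have hm : AEStronglyMeasurable (fun x => h x * f x) volume :=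
    hh.aestronglyMeasurable.mul hf.1
  rw [memLp_two_iff_integrable_sq hm]
  have := int_bdd_mul hf.integrable_sq (h := fun x => h x ^ 2) (by fun_prop) (K ^ 2) (fun x => by
    rw [abs_pow]; exact pow_le_pow_left₀ (abs_nonneg _) (hK x) 2)
  refine this.congr (Eventually.of_forall fun x => ?_)
  simp only [mul_pow]

theorem kW_mul {k : ℝ} (hk : 0 < k) {f : ℝ → ℝ} (hf : MemLp f 2) :
    MemLp (fun x => kW k x * f x) 2 :=
  memLp_bdd_mul hf (kW_cont k) _ (kW_abs k hk)

/-- the quadratic form -/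
noncomputable def kA (k : ℝ) (f g : ℝ → ℝ) : ℝ := ∫ x, (g x ^ 2 + kW k x * f x ^ 2)

theorem kA_int {k : ℝ} (hk : 0 < k) {e : ℝ} {f g : ℝ → ℝ} (h : H1f e f g) :
    Integrable (fun x => g x ^ 2 + kW k x * f x ^ 2) :=
  h.g2.integrable_sq.add (int_bdd_mul h.f2.integrable_sq (kW_cont k) _ (kW_abs k hk))

theorem kA_pair {k : ℝ} (hk : 0 < k) {e : ℝ} {f g w w1 w2 : ℝ → ℝ} (h : H1f e f g)
    (hw : H1f e w w1) (hw1 : H1f e w1 w2) :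
    ∫ x, (g x * w1 x + f x * (kW k x * w x)) = ∫ x, f x * (kW k x * w x - w2 x) := by
  have h1 := ibp h hw1
  rw [integral_add (memLp_mul_int h.g2 hw.g2) (memLp_mul_int h.f2 (kW_mul hk hw.f2)), h1]
  have : ∀ x, f x * (kW k x * w x - w2 x) = f x * (kW k x * w x) - f x * w2 x := fun x => by ring
  simp_rw [this]
  rw [integral_sub (memLp_mul_int h.f2 (kW_mul hk hw.f2)) (memLp_mul_int h.f2 hw1.g2)]
  ring

theorem kA_sub {k : ℝ} (hk : 0 < k) {e : ℝ} {f g w w1 w2 : ℝ → ℝ} (h : H1f e f g)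
    (hw : H1f e w w1) (hw1 : H1f e w1 w2) :
    kA k (fun x => f x - w x) (fun x => g x - w1 x) = kA k f g
      - 2 * (∫ x, f x * (kW k x * w x - w2 x)) + ∫ x, w x * (kW k x * w x - w2 x) := by
  rw [← kA_pair hk h hw hw1, ← kA_pair hk hw hw hw1]
  unfold kA
  have i1 := kA_int hk h
  have i2 : Integrable (fun x => g x * w1 x + f x * (kW k x * w x)) :=
    (memLp_mul_int h.g2 hw.g2).add (memLp_mul_int h.f2 (kW_mul hk hw.f2))
  have i3 : Integrable (fun x => w1 x * w1 x + w x * (kW k x * w x)) :=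
    (memLp_mul_int hw.g2 hw.g2).add (memLp_mul_int hw.f2 (kW_mul hk hw.f2))
  have := lin3 1 (-2) 1 i1 i2 i3
  rw [one_mul, one_mul] at this
  have h3 : ∀ a b c : ℝ, a - 2 * b + c = a + -2 * b + c := by intros; ring
  rw [h3, ← this]
  congr 1; funext x; ring

theorem QD_zero (k : ℝ) (hk : 0 < k) : ∫ x, kQ k x * kD k x = 0 := by
  have := ibp (kQ_H1 k hk 0) (kQ_H1 k hk 0)
  simp_rw [mul_comm (kD k _)] at this
  linarith

theorem yQ_H1 (k : ℝ) (hk : 0 < k) (e : ℝ) :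
    H1f e (fun y => y * kQ k y) (fun y => kQ k y + y * kD k y) := by
  refine H1f_of_dom k hk e _ _ 0 1 1 (2 * k) (fun x => ?_) ?_ le_rfl zero_le_one zero_le_one
    (by positivity) ?_ ?_
  · refine ((hasDerivAt_id x).mul (kQ_deriv k x)).congr_deriv ?_
    simp
  · have := kQ_cont k; have := kD_cont k; fun_prop
  · intro y; rw [abs_mul, abs_of_pos (kQ_pos k hk y)]; linarith
  · intro y
    refine (abs_add_le _ _).trans ?_
    rw [abs_mul, abs_of_pos (kQ_pos k hk y)]
    have := mul_le_mul_of_nonneg_left (kD_abs k hk y) (abs_nonneg y)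
    linarith

theorem Qsq_pos (k : ℝ) (hk : 0 < k) : 0 < ∫ x, kQ k x ^ 2 := by
  rw [integral_pos_iff_support_of_nonneg (fun x => sq_nonneg _) (kQ_H1 k hk 0).f2.integrable_sq]
  have : Function.support (fun x => kQ k x ^ 2) = univ := by
    ext x; simp [(kQ_pos k hk x).ne']
  rw [this]; simp

theorem Dsq_pos (k : ℝ) (hk : 0 < k) : 0 < ∫ x, kD k x ^ 2 := by
  have h0 := Real.tanh_zero
  obtain ⟨x0, hx0, hT⟩ : ∃ x0 : ℝ, x0 = 1 ∧ kT k x0 ≠ 0 := by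
    refine ⟨1, rfl, ?_⟩
    have := kT_mono k hk one_pos
    have h1 : kT k 0 = 0 := by unfold kT; simp
    rw [h1] at this; exact this.ne'
  refine integral_pos_of_integrable_nonneg_nonzero (x := x0) ((kD_cont k).pow 2)
    (kD_H1 k hk 0).f2.integrable_sq (fun x => sq_nonneg _) ?_
  have := (kS_pos k x0).ne'
  apply pow_ne_zero
  unfold kD
  have := hk.ne'
  exact mul_ne_zero (neg_ne_zero.2 (by positivity)) (mul_ne_zero hT (kS_pos k x0).ne')

theorem QP_pos (k : ℝ) (hk : 0 < k) : 0 < ∫ x, kQ k x * kP k x := by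
  have h := ibp (yQ_H1 k hk 0) (kQ_H1 k hk 0)
  have hq := (kQ_H1 k hk 0).f2
  have i1 : Integrable (fun x => x * kQ k x * kD k x) :=
    memLp_mul_int (yQ_H1 k hk 0).f2 (kQ_H1 k hk 0).g2
  have h1 : ∫ x, (kQ k x + x * kD k x) * kQ k x
      = 1 * (∫ x, kQ k x ^ 2) + 1 * ∫ x, x * kQ k x * kD k x := by
    rw [← lin2 1 1 hq.integrable_sq i1]
    congr 1; funext x; ring
  have h2 : ∫ x, kQ k x * kP k x = 1 * (∫ x, kQ k x ^ 2) + (1 / 2) * ∫ x, x * kQ k x * kD k x := by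
    rw [← lin2 1 (1 / 2) hq.integrable_sq i1]
    congr 1; funext x; unfold kP; ring
  have := Qsq_pos k hk
  linarith

theorem exists_x0 (k : ℝ) (hk : 0 < k) : ∃ x0, 0 < x0 ∧ kT k x0 = 1 / 8 ∧ k * x0 < 8 := by
  refine ⟨Real.artanh (1 / 8) / k, ?_, ?_, ?_⟩
  · exact div_pos (Real.artanh_pos (by norm_num)) hk
  · unfold kT
    rw [mul_div_cancel₀ _ hk.ne']
    exact Real.tanh_artanh (by norm_num)
  · rw [mul_div_cancel₀ _ hk.ne', Real.artanh_eq_half_log (by norm_num)]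
    have := Real.log_le_sub_one_of_pos (x := (1 + 1 / 8) / (1 - 1 / 8)) (by norm_num)
    norm_num at this ⊢
    linarith

set_option maxHeartbeats 1000000 in
theorem coercive (k : ℝ) (hk : 0 < k) : ∃ κ K : ℝ, 0 < κ ∧ 0 < K ∧ ∀ e f g, H1f e f g →
    (∫ x, f x * kD k x = 0) →
    (∫ x, f x ^ 2) + (∫ x, g x ^ 2) ≤ κ * (kA k f g + K * (∫ x, f x * kQ k x) ^ 2) := by
  obtain ⟨x0, hx0, hT, hx8⟩ := exists_x0 k hk
  set P := ∫ x, kQ k x * kP k x with hP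
  have hPpos : 0 < P := QP_pos k hk
  set d := ∫ x, kD k x ^ 2 with hd
  have hdpos : 0 < d := Dsq_pos k hk
  set p := ∫ x, kP k x ^ 2 with hp
  have hp0 : 0 ≤ p := integral_nonneg fun x => sq_nonneg _
  set m := 36 / k ^ 2 + 9 * p / (2 * k ^ 2 * P) with hm
  have hm0 : 0 < m := by positivity
  refine ⟨1 + (1 + 8 * k ^ 2) * m, 8 * k ^ 2 / P, by positivity, by positivity, ?_⟩
  intro e f g h hort
  set s := ∫ x, f x * kQ k x with hs
  have hS : kS k x0 = 63 / 64 := by unfold kS; rw [hT]; norm_num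
  have hQ0 : kQ k x0 = 6 * k ^ 2 * (63 / 64) := by unfold kQ; rw [hS]
  have hD0 : kD k x0 = -(12 * k ^ 3) * (1 / 8 * (63 / 64)) := by unfold kD; rw [hS, hT]
  have hQn : kQ k (-x0) = kQ k x0 := by unfold kQ kS; rw [kT_neg]; ring
  have hDn : kD k (-x0) = -kD k x0 := by unfold kD kS; rw [kT_neg]; ring
  have hPn : kP k (-x0) = kP k x0 := by unfold kP; rw [hQn, hDn]; ring
  have hDne : kD k x0 ≠ 0 := by rw [hD0]; have := pow_pos hk 3; intro h; linarith
  have hPne : kP k x0 ≠ 0 := by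
    have : kP k x0 = 6 * k ^ 2 * (63 / 64) * (1 - k * x0 / 8) := by
      unfold kP; rw [hQ0, hD0]; ring
    rw [this]
    have : 0 < 1 - k * x0 / 8 := by linarith
    positivity
  obtain ⟨a, ha⟩ : ∃ a, a = (f x0 + f (-x0)) / (2 * kP k x0) := ⟨_, rfl⟩
  obtain ⟨b, hb⟩ : ∃ b, b = (f x0 - f (-x0)) / (2 * kD k x0) := ⟨_, rfl⟩
  have hfd := h
  have hPH := kP_H1 k hk e
  have hDH := kD_H1 k hk e
  have hw := (hPH.smul a).add (hDH.smul b)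
  have hw1 := ((kP1_H1 k hk e).smul a).add ((kE_H1 k hk e).smul b)
  have hxi := h.sub hw
  have z1 : f x0 - (a * kP k x0 + b * kD k x0) = 0 := by rw [ha, hb]; field_simp; ring
  have z2 : f (-x0) - (a * kP k (-x0) + b * kD k (-x0)) = 0 := by
    rw [hPn, hDn, ha, hb]; field_simp; ring
  have gap := gap_lemma k hk e _ _ hxi x0 hx0 hT z1 z2
  set X := ∫ x, (f x - (a * kP k x + b * kD k x)) ^ 2 with hX
  have hX0 : 0 ≤ X := integral_nonneg fun x => sq_nonneg _
  clear_value P d p m s X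
  have eA := kA_sub hk h hw hw1
  have hL : ∀ x, kW k x * (a * kP k x + b * kD k x) -
      (a * kP2 k x + b * ((4 * k ^ 2 - 2 * kQ k x) * kD k x)) = -(4 * k ^ 2) * a * kQ k x := by
    intro x; unfold kW kP kP2 kE; ring
  simp_rw [hL] at eA
  have e1 : ∫ x, f x * (-(4 * k ^ 2) * a * kQ k x) = -(4 * k ^ 2) * a * s := by
    rw [hs, ← integral_const_mul]; congr 1; funext x; ring
  have iQP := memLp_mul_int (kQ_H1 k hk e).f2 hPH.f2
  have iQD := memLp_mul_int (kQ_H1 k hk e).f2 hDH.f2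
  have e2 : ∫ x, (a * kP k x + b * kD k x) * (-(4 * k ^ 2) * a * kQ k x)
      = -(4 * k ^ 2) * a ^ 2 * P := by
    have := lin2 (-(4 * k ^ 2) * a ^ 2) (-(4 * k ^ 2) * a * b) iQP iQD
    rw [QD_zero k hk, ← hP] at this
    rw [mul_zero, add_zero] at this
    rw [← this]; congr 1; funext x; ring
  rw [e1, e2] at eA
  have e3 : kA k (fun x => f x - (a * kP k x + b * kD k x))
      (fun x => g x - (a * kP1 k x + b * kE k x)) - k ^ 2 / 4 * X =
      ∫ x, ((g x - (a * kP1 k x + b * kE k x)) ^ 2 + kV k x *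
        (f x - (a * kP k x + b * kD k x)) ^ 2) := by
    rw [hX, ← integral_const_mul, kA, ← integral_sub (kA_int hk hxi)
      (hxi.f2.integrable_sq.const_mul _)]
    congr 1; funext x; unfold kV kW; ring
  rw [← e3] at gap
  have hY : 8 * k ^ 2 * (a * s) ≤ 2 * k ^ 2 * P * a ^ 2 + 8 * k ^ 2 / P * s ^ 2 := by
    have : 0 ≤ 2 * k ^ 2 / P * (P * a - 2 * s) ^ 2 := by positivity
    have h2 : 2 * k ^ 2 / P * (P * a - 2 * s) ^ 2 =
      2 * k ^ 2 * P * a ^ 2 + 8 * k ^ 2 / P * s ^ 2 - 8 * k ^ 2 * (a * s) := by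
      field_simp; ring
    linarith
  have main : k ^ 2 / 4 * X + 2 * k ^ 2 * P * a ^ 2 ≤ kA k f g + 8 * k ^ 2 / P * s ^ 2 := by
    linarith
  have hb2 : b ^ 2 * d ≤ 2 * X + 2 * (a ^ 2 * p) := by
    have c1 := cs_int hxi.f2 hDH.f2
    have c2 := cs_int hPH.f2 hDH.f2
    have i1 := memLp_mul_int hxi.f2 hDH.f2
    have i2 := memLp_mul_int hPH.f2 hDH.f2
    have i3 := hDH.f2.integrable_sq
    have := lin3 1 a b i1 i2 i3
    have h4 : ∫ x, (1 * ((f x - (a * kP k x + b * kD k x)) * kD k x) + a * (kP k x * kD k x)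
        + b * kD k x ^ 2) = 0 := by
      rw [← hort]; congr 1; funext x; ring
    rw [h4] at this
    rw [← hX, ← hd] at c1
    rw [← hp, ← hd] at c2
    rw [← hd] at this
    set u1 := ∫ x, (f x - (a * kP k x + b * kD k x)) * kD k x
    set u2 := ∫ x, kP k x * kD k x
    clear_value u1 u2
    have h5 : b * d = -u1 - a * u2 := by linarith
    have h6 : (b * d) ^ 2 ≤ 2 * (X * d) + 2 * (a ^ 2 * (p * d)) := by
      rw [h5]
      have := mul_le_mul_of_nonneg_left c2 (sq_nonneg a)
      nlinarith [sq_nonneg (u1 - a * u2)]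
    have h7 : d * (b ^ 2 * d) ≤ d * (2 * X + 2 * (a ^ 2 * p)) := by linarith
    exact le_of_mul_le_mul_left h7 hdpos
  have hf2 : ∫ x, f x ^ 2 ≤ 9 * X + 9 * (a ^ 2 * p) := by
    have i : Integrable (fun x => 3 * (f x - (a * kP k x + b * kD k x)) ^ 2 +
        (3 * a ^ 2) * kP k x ^ 2 + (3 * b ^ 2) * kD k x ^ 2) :=
      ((hxi.f2.integrable_sq.const_mul _).add (hPH.f2.integrable_sq.const_mul _)).add
        (hDH.f2.integrable_sq.const_mul _)
    have := integral_mono h.f2.integrable_sq i (fun x => by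
      show f x ^ 2 ≤ _
      set ξ := f x - (a * kP k x + b * kD k x) with hξ
      have : f x = ξ + a * kP k x + b * kD k x := by rw [hξ]; ring
      rw [this]
      nlinarith [sq_nonneg (ξ - a * kP k x), sq_nonneg (ξ - b * kD k x),
        sq_nonneg (a * kP k x - b * kD k x)])
    rw [lin3 _ _ _ hxi.f2.integrable_sq hPH.f2.integrable_sq hDH.f2.integrable_sq,
      ← hX, ← hp, ← hd] at this
    linarith
  have hf3 : ∫ x, f x ^ 2 ≤ m * (kA k f g + 8 * k ^ 2 / P * s ^ 2) := by
    refine hf2.trans ((le_trans ?_ (mul_le_mul_of_nonneg_left main hm0.le)))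
    have h8 : m * (k ^ 2 / 4 * X + 2 * k ^ 2 * P * a ^ 2) =
      9 * X + 9 * (a ^ 2 * p) + (36 / k ^ 2 * (2 * k ^ 2 * P * a ^ 2)
        + 9 * p / (2 * k ^ 2 * P) * (k ^ 2 / 4 * X)) := by
      rw [hm]; field_simp; ring
    rw [h8]
    have : 0 ≤ 36 / k ^ 2 * (2 * k ^ 2 * P * a ^ 2)
        + 9 * p / (2 * k ^ 2 * P) * (k ^ 2 / 4 * X) := by positivity
    linarith
  have hg2 : ∫ x, g x ^ 2 ≤ kA k f g + 8 * k ^ 2 * ∫ x, f x ^ 2 := by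
    rw [← integral_const_mul, kA, ← integral_add (kA_int hk h) (h.f2.integrable_sq.const_mul _)]
    refine integral_mono h.g2.integrable_sq
      ((kA_int hk h).add (h.f2.integrable_sq.const_mul _)) fun x => ?_
    show g x ^ 2 ≤ g x ^ 2 + kW k x * f x ^ 2 + 8 * k ^ 2 * f x ^ 2
    have := neg_abs_le (kW k x)
    have h9 := kW_abs k hk x
    nlinarith [sq_nonneg (f x)]
  have : 0 ≤ 8 * k ^ 2 / P * s ^ 2 := by positivity
  linarith [mul_le_mul_of_nonneg_left hf3 (by positivity : 0 ≤ 1 + 8 * k ^ 2)]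

theorem H1f.cube {e : ℝ} {f g : ℝ → ℝ} (h : H1f e f g) : Integrable (fun x => f x ^ 3) := by
  have := int_bdd_mul h.f2.integrable_sq h.cont (Real.sqrt ((∫ x, f x ^ 2) + ∫ x, g x ^ 2))
    (fun x => Real.abs_le_sqrt (h.sup x))
  refine this.congr (Eventually.of_forall fun x => ?_)
  show f x * f x ^ 2 = f x ^ 3
  ring

theorem H1f.cube_le {e : ℝ} {f g : ℝ → ℝ} (h : H1f e f g) (ε : ℝ) (hε : 0 ≤ ε)
    (hm : ∫ x, f x ^ 2 ≤ ε ^ 2) :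
    |∫ x, f x ^ 3| ≤ ε * ((∫ x, f x ^ 2) + ∫ x, g x ^ 2) := by
  have hsup := fun x => h.sup x
  have ig : 0 ≤ ∫ x, g x ^ 2 := integral_nonneg fun x => sq_nonneg _
  have im : 0 ≤ ∫ x, f x ^ 2 := integral_nonneg fun x => sq_nonneg _
  have h1 : |∫ x, f x ^ 3| ≤ Real.sqrt ((∫ x, f x ^ 2) + ∫ x, g x ^ 2) * ∫ x, f x ^ 2 := by
    rw [← integral_const_mul]
    refine (abs_integral_le_integral_abs).trans (integral_mono h.cube.abs
      (h.f2.integrable_sq.const_mul _) fun x => ?_)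
    have : |f x ^ 3| = |f x| * f x ^ 2 := by
      rw [abs_pow, ← sq_abs]; ring
    show |f x ^ 3| ≤ _
    rw [this]
    exact mul_le_mul_of_nonneg_right (Real.abs_le_sqrt (h.sup x)) (sq_nonneg _)
  generalize (∫ x, f x ^ 2) = m at *
  generalize (∫ x, g x ^ 2) = G at *
  refine h1.trans ?_
  have hN : 0 ≤ m + G := by linarith
  have h2 : Real.sqrt m ≤ ε := (Real.sqrt_le_left hε).2 hm
  have h3 : Real.sqrt m ≤ Real.sqrt (m + G) := Real.sqrt_le_sqrt (by linarith)
  have h4 := Real.sq_sqrt hN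
  have h5 := Real.sq_sqrt im
  have h6 := Real.sqrt_nonneg m
  have h7 := Real.sqrt_nonneg (m + G)
  calc Real.sqrt (m + G) * m = Real.sqrt (m + G) * (Real.sqrt m * Real.sqrt m) := by
        rw [← sq, h5]
    _ ≤ Real.sqrt (m + G) * (ε * Real.sqrt (m + G)) := by gcongr
    _ = ε * Real.sqrt (m + G) ^ 2 := by ring
    _ = ε * (m + G) := by rw [h4]

/-- mass -/
noncomputable def fM (f : ℝ → ℝ) : ℝ := ∫ x, f x ^ 2
/-- energy -/
noncomputable def fE (f g : ℝ → ℝ) : ℝ := ∫ x, (1 / 2 * g x ^ 2 - 1 / 3 * f x ^ 3)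

theorem expM {e : ℝ} {f g : ℝ → ℝ} (k : ℝ) (hk : 0 < k) (h : H1f e f g) :
    fM f = fM (kQ k) + 2 * (∫ x, (f x - kQ k x) * kQ k x) + ∫ x, (f x - kQ k x) ^ 2 := by
  have hQ := kQ_H1 k hk e
  have hη := h.sub hQ
  have := lin3 1 2 1 hQ.f2.integrable_sq (memLp_mul_int hη.f2 hQ.f2) hη.f2.integrable_sq
  unfold fM
  rw [one_mul, one_mul] at this
  rw [← this]; congr 1; funext x; ring

theorem Qsq_mul {f : ℝ → ℝ} (k : ℝ) (hk : 0 < k) (h : Integrable f) :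
    Integrable (fun x => kQ k x * f x) :=
  int_bdd_mul h (kQ_cont k) (6 * k ^ 2) fun x => by
    rw [abs_of_pos (kQ_pos k hk x)]; exact kQ_le k x

theorem expE {e : ℝ} {f g : ℝ → ℝ} (k : ℝ) (hk : 0 < k) (h : H1f e f g) :
    fE f g = fE (kQ k) (kD k) - 4 * k ^ 2 * (∫ x, (f x - kQ k x) * kQ k x)
      + 1 / 2 * (∫ x, (g x - kD k x) ^ 2) - (∫ x, kQ k x * (f x - kQ k x) ^ 2)
      - 1 / 3 * ∫ x, (f x - kQ k x) ^ 3 := by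
  have hQ := kQ_H1 k hk e
  have hD := kD_H1 k hk e
  have hη := h.sub hQ
  have i0 : Integrable (fun x => 1 / 2 * kD k x ^ 2 - 1 / 3 * kQ k x ^ 3) :=
    (hQ.g2.integrable_sq.const_mul _).sub (hQ.cube.const_mul _)
  have i1 := memLp_mul_int hη.g2 hQ.g2
  have i2 := hη.g2.integrable_sq
  have i3 := Qsq_mul k hk hη.f2.integrable_sq
  have i4 := hη.cube
  have i5 := memLp_mul_int hη.f2 hQ.f2
  have i6 : Integrable (fun x => (f x - kQ k x) * kE k x) := memLp_mul_int hη.f2 hD.g2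
  have hp := ibp hη hD
  have l1 := lin5 1 1 (1 / 2) (-1) (-1 / 3) i0 i1 i2 i3 i4
  have l2 : ∫ x, (4 * k ^ 2 * ((f x - kQ k x) * kQ k x) + -1 * ((f x - kQ k x) * kE k x)) =
    4 * k ^ 2 * (∫ x, (f x - kQ k x) * kQ k x) + -1 * ∫ x, (f x - kQ k x) * kE k x :=
    lin2 _ _ i5 i6
  have i7 : Integrable (fun x => 4 * k ^ 2 * ((f x - kQ k x) * kQ k x)
      + -1 * ((f x - kQ k x) * kE k x)) := (i5.const_mul _).add (i6.const_mul _)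
  have i8 : Integrable (fun x => 1 * (1 / 2 * kD k x ^ 2 - 1 / 3 * kQ k x ^ 3) +
      1 * ((g x - kD k x) * kD k x) + 1 / 2 * (g x - kD k x) ^ 2
      + -1 * (kQ k x * (f x - kQ k x) ^ 2) + -1 / 3 * (f x - kQ k x) ^ 3) :=
    ((((i0.const_mul _).add (i1.const_mul _)).add (i2.const_mul _)).add (i3.const_mul _)).add
      (i4.const_mul _)
  have e1 : fE f g = (∫ x, (1 * (1 / 2 * kD k x ^ 2 - 1 / 3 * kQ k x ^ 3) +
      1 * ((g x - kD k x) * kD k x) + 1 / 2 * (g x - kD k x) ^ 2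
      + -1 * (kQ k x * (f x - kQ k x) ^ 2) + -1 / 3 * (f x - kQ k x) ^ 3)) -
      ∫ x, (4 * k ^ 2 * ((f x - kQ k x) * kQ k x) + -1 * ((f x - kQ k x) * kE k x)) := by
    rw [← integral_sub i8 i7]
    unfold fE
    congr 1; funext x; unfold kE; ring
  rw [e1, l1, l2, hp]
  unfold fE
  ring

theorem kA_split {e : ℝ} {f g : ℝ → ℝ} (k : ℝ) (hk : 0 < k) (h : H1f e f g) :
    kA k f g = (∫ x, g x ^ 2) + 4 * k ^ 2 * (∫ x, f x ^ 2) - 2 * ∫ x, kQ k x * f x ^ 2 := by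
  have := lin3 1 (4 * k ^ 2) (-2) h.g2.integrable_sq h.f2.integrable_sq
    (Qsq_mul k hk h.f2.integrable_sq)
  have e1 : kA k f g = ∫ x, (1 * g x ^ 2 + 4 * k ^ 2 * f x ^ 2 + -2 * (kQ k x * f x ^ 2)) := by
    unfold kA; congr 1; funext x; unfold kW; ring
  rw [e1, this]; ring

theorem core_algebra (k κ K q K1 : ℝ) (hk : 0 < k) (hκ : 0 < κ) (hK : 0 < K) (hq : 0 < q)
    (hK1 : 0 < K1) : ∃ ε K2 δ0 : ℝ, 0 < ε ∧ ε ^ 2 < q ∧ 0 < K2 ∧ 0 < δ0 ∧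
    ∀ N m s A T G B δ : ℝ, 0 < δ → δ ≤ δ0 → 0 ≤ m → m ≤ N → m ≤ ε ^ 2 → |T| ≤ ε * N → 0 ≤ G →
    N ≤ κ * (A + K * s ^ 2) → s ^ 2 ≤ q * m → 2 * s + m ≤ K1 * δ → B ≤ 6 * k ^ 2 * m →
    -(4 * k ^ 2) * s + 1 / 2 * G - B - 1 / 3 * T ≤ K1 * δ → 1 / 2 * A - 1 / 3 * T ≤ K1 * δ ^ 2 →
    N ≤ K2 * δ ^ 2 := by
  obtain ⟨B0, hB0⟩ : ∃ B0, B0 = K1 + (K1 + 6 * k ^ 2 + 1) / (4 * k ^ 2) := ⟨_, rfl⟩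
  have hB0p : 0 < B0 := by rw [hB0]; positivity
  obtain ⟨Big, hBig⟩ : ∃ Big, Big = 4 * κ + 4 * κ * K * q + 24 * κ * K * B0 ^ 2 + 1 + 1 / q :=
    ⟨_, rfl⟩
  have hBp : 0 < Big := by rw [hBig]; positivity
  have p1 : 0 < 4 * κ * K * q := by positivity
  have p2 : 0 < 24 * κ * K * B0 ^ 2 := by positivity
  have p3 : 0 < 1 / q := by positivity
  have hε1 : 1 / Big ≤ 1 := by rw [div_le_one hBp]; linarith
  have hεp : 0 < 1 / Big := by positivity
  have hεB : 1 / Big * Big = 1 := by field_simp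
  generalize 1 / Big = ε at *
  have hε2 : ε ^ 2 ≤ ε := pow_le_of_le_one hεp.le hε1 two_ne_zero
  have f1 : 4 * κ * ε ≤ 1 := by rw [← hεB, mul_comm ε]; gcongr; linarith
  have f2 : 4 * κ * K * q * ε ≤ 1 := by rw [← hεB, mul_comm ε]; gcongr; linarith
  have f3 : 24 * κ * K * B0 ^ 2 * ε ≤ 1 := by rw [← hεB, mul_comm ε]; gcongr; linarith
  have f4 : 1 / q * ε < 1 := by
    calc 1 / q * ε < Big * ε := mul_lt_mul_of_pos_right (by linarith) hεp
      _ = 1 := by rw [mul_comm]; exact hεB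
  refine ⟨ε, 2 * κ * (2 * K1 + 3 * K * B0 ^ 2), 1 / (8 * κ * K1 + 1), hεp, ?_, by positivity,
    by positivity, ?_⟩
  · rw [one_div, inv_mul_eq_div, div_lt_one hq] at f4; linarith
  intro N m s A T G B δ hδ hδ0 hm hmN hmε hT hG hN hs hM hB hE hF
  have hδκ : 8 * κ * K1 * δ ^ 2 ≤ 1 := by
    have h1 : δ * (8 * κ * K1 + 1) ≤ 1 := by rwa [le_div_iff₀ (by positivity)] at hδ0
    have : 0 < 8 * κ * K1 := by positivity
    have h3 := mul_pos this hδ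
    have h2 : δ ≤ 1 := by linarith
    have h4 : 8 * κ * K1 * δ * δ ≤ 8 * κ * K1 * δ * 1 := by gcongr
    linarith
  have hN0 : 0 ≤ N := hm.trans hmN
  have hT1 := neg_abs_le T
  have hT2 := le_abs_self T
  have hA : A ≤ 2 * K1 * δ ^ 2 + 2 / 3 * (ε * N) := by linarith
  have hN1 : N ≤ κ * (2 * K1 * δ ^ 2 + 2 / 3 * (ε * N) + K * s ^ 2) :=
    hN.trans (by gcongr)
  have hεN : κ * (ε * N) ≤ 1 / 4 * N := by
    have := mul_le_mul_of_nonneg_right f1 hN0; linarith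
  have hNle : N ≤ 1 := by
    have h1 : κ * (K * s ^ 2) ≤ 1 / 4 := by
      calc κ * (K * s ^ 2) ≤ κ * (K * (q * ε)) := by
            gcongr; exact hs.trans (by gcongr; linarith)
        _ ≤ 1 / 4 := by linarith
    linarith
  have hs1 : |s| ≤ B0 * (δ + m + ε * N) := by
    have hx : 0 ≤ δ + m + ε * N := by positivity
    have hx2 : 0 ≤ ε * N := by positivity
    rw [abs_le]
    constructor
    · have h1 : -s ≤ (K1 + 6 * k ^ 2 + 1) / (4 * k ^ 2) * (δ + m + ε * N) := by
        rw [div_mul_eq_mul_div, le_div_iff₀ (by positivity)]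
        have h3 : 0 ≤ K1 * m := mul_nonneg hK1.le hm
        have h4 : 0 ≤ K1 * (ε * N) := mul_nonneg hK1.le hx2
        have h5 : 0 ≤ k ^ 2 * δ := mul_nonneg (sq_nonneg k) hδ.le
        have h6 : 0 ≤ k ^ 2 * (ε * N) := mul_nonneg (sq_nonneg k) hx2
        linarith only [h3, h4, h5, h6, hE, hB, hT, hT1, hT2, hG, hm, hx2, hδ]
      have h2 : 0 ≤ K1 * (δ + m + ε * N) := by positivity
      rw [hB0, add_mul]; linarith only [h1, h2]
    · have h2 : 0 ≤ (K1 + 6 * k ^ 2 + 1) / (4 * k ^ 2) * (δ + m + ε * N) := by positivity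
      rw [hB0, add_mul]
      have h3 : 0 ≤ K1 * m := by positivity
      have h4 : 0 ≤ K1 * (ε * N) := by positivity
      have h5 : 0 < K1 * δ := by positivity
      linarith only [h2, h3, h4, h5, hM, hm]
  have hs2 : s ^ 2 ≤ 3 * B0 ^ 2 * (δ ^ 2 + 2 * (ε * N)) := by
    have h1 : s ^ 2 ≤ (B0 * (δ + m + ε * N)) ^ 2 := sq_le_sq' (by linarith only [hs1, neg_abs_le s])
      (by linarith only [hs1, le_abs_self s])
    have h2 : (δ + m + ε * N) ^ 2 ≤ 3 * (δ ^ 2 + m ^ 2 + (ε * N) ^ 2) := by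
      nlinarith [sq_nonneg (δ - m), sq_nonneg (δ - ε * N), sq_nonneg (m - ε * N)]
    have h3 : m ^ 2 ≤ ε * N := by
      calc m ^ 2 = m * m := sq m
        _ ≤ ε * N := by gcongr; linarith only [hmε, hε2]
    have h4 : (ε * N) ^ 2 ≤ ε * N := by
      have h1 : ε * N ≤ 1 := mul_le_one₀ hε1 hN0 hNle
      exact pow_le_of_le_one (by positivity) h1 two_ne_zero
    calc s ^ 2 ≤ _ := h1
      _ = B0 ^ 2 * (δ + m + ε * N) ^ 2 := by ring
      _ ≤ B0 ^ 2 * (3 * (δ ^ 2 + 2 * (ε * N))) := by gcongr; linarith only [h2, h3, h4]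
      _ = _ := by ring
  have h5 : κ * (K * s ^ 2) ≤ κ * (K * (3 * B0 ^ 2 * (δ ^ 2 + 2 * (ε * N)))) := by gcongr
  have h6 : 24 * κ * K * B0 ^ 2 * ε * N ≤ 1 * N := by gcongr
  linarith only [h5, h6, hN1, hεN, hN0]

/-- squared L2 distance to the soliton centered at z -/
noncomputable def dM (k : ℝ) (f : ℝ → ℝ) (z : ℝ) : ℝ := ∫ x, (f (x + z) - kQ k x) ^ 2
/-- squared H1 distance -/
noncomputable def dH (k : ℝ) (f g : ℝ → ℝ) (z : ℝ) : ℝ :=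
  (∫ x, (f (x + z) - kQ k x) ^ 2) + ∫ x, (g (x + z) - kD k x) ^ 2

theorem core_static (k : ℝ) (hk : 0 < k) (K1 : ℝ) (hK1 : 0 < K1) :
    ∃ ε K2 δ0 : ℝ, 0 < ε ∧ ε ^ 2 < fM (kQ k) ∧ 0 < K2 ∧ 0 < δ0 ∧ ∀ e f g, H1f e f g →
      (∫ x, (f x - kQ k x) * kD k x = 0) → (∫ x, (f x - kQ k x) ^ 2) ≤ ε ^ 2 →
      ∀ δ, 0 < δ → δ ≤ δ0 → fM f ≤ fM (kQ k) + K1 * δ → fE f g ≤ fE (kQ k) (kD k) + K1 * δ →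
      fE f g + 2 * k ^ 2 * fM f ≤ fE (kQ k) (kD k) + 2 * k ^ 2 * fM (kQ k) + K1 * δ ^ 2 →
      (∫ x, (f x - kQ k x) ^ 2) + (∫ x, (g x - kD k x) ^ 2) ≤ K2 * δ ^ 2 := by
  obtain ⟨κ, K, hκ, hK, hco⟩ := coercive k hk
  obtain ⟨ε, K2, δ0, h1, h2, h3, h4, hal⟩ :=
    core_algebra k κ K (fM (kQ k)) K1 hk hκ hK (Qsq_pos k hk) hK1
  refine ⟨ε, K2, δ0, h1, h2, h3, h4, ?_⟩
  intro e f g h hort hm δ hδ hδ0 hM hE hF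
  have hη := h.sub (kQ_H1 k hk e)
  have hN := hco e _ _ hη hort
  have eM := expM k hk h
  have eE := expE k hk h
  have eA := kA_split k hk hη
  have hcs := cs_int hη.f2 (kQ_H1 k hk e).f2
  have hT := hη.cube_le ε h1.le hm
  have hm0 : 0 ≤ ∫ x, (f x - kQ k x) ^ 2 := integral_nonneg fun x => sq_nonneg _
  have hg0 : 0 ≤ ∫ x, (g x - kD k x) ^ 2 := integral_nonneg fun x => sq_nonneg _
  have hB : ∫ x, kQ k x * (f x - kQ k x) ^ 2 ≤ 6 * k ^ 2 * ∫ x, (f x - kQ k x) ^ 2 := by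
    rw [← integral_const_mul]
    refine integral_mono (Qsq_mul k hk hη.f2.integrable_sq) (hη.f2.integrable_sq.const_mul _)
      fun x => ?_
    exact mul_le_mul_of_nonneg_right (kQ_le k x) (sq_nonneg _)
  change _ ≤ (∫ x, (f x - kQ k x) ^ 2) * fM (kQ k) at hcs
  rw [mul_comm] at hcs
  refine hal _ _ _ _ _ _ _ δ hδ hδ0 hm0 (le_add_of_nonneg_right hg0) hm hT hg0 hN hcs ?_ hB ?_ ?_
  · linarith only [eM, hM]
  · linarith only [eE, hE]
  · rw [eM, eE] at hF
    rw [eA]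
    linarith only [hF]

theorem corr_deriv (k : ℝ) (hk : 0 < k) (f : ℝ → ℝ) (hf : Integrable f) (r : ℝ) :
    HasDerivAt (fun r => ∫ x, f x * kQ k (x - r)) (∫ x, -(f x * kD k (x - r))) r := by
  have hQc := kQ_cont k
  have hDc := kD_cont k
  refine (hasDerivAt_integral_of_dominated_loc_of_deriv_le (μ := volume)
    (F := fun r x => f x * kQ k (x - r)) (F' := fun r x => -(f x * kD k (x - r)))
    (bound := fun x => (2 * k * (6 * k ^ 2)) * |f x|) (Metric.ball_mem_nhds r one_pos) ?_ ?_ ?_ ?_ ?_ ?_).2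
  · refine Eventually.of_forall fun r => hf.1.mul (Continuous.aestronglyMeasurable (by fun_prop))
  · have := int_bdd_mul hf (h := fun x => kQ k (x - r)) (by fun_prop) (6 * k ^ 2) fun x => by
      rw [abs_of_pos (kQ_pos k hk _)]; exact kQ_le k _
    simpa only [mul_comm] using this
  · exact (hf.1.mul (Continuous.aestronglyMeasurable (by fun_prop))).neg
  · refine Eventually.of_forall fun x r _ => ?_
    rw [Real.norm_eq_abs, abs_neg, abs_mul, mul_comm]
    have h1 := kD_abs k hk (x - r)
    have h2 := kQ_le k (x - r)
    gcongr
    refine h1.trans ?_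
    gcongr
  · exact hf.abs.const_mul _
  · refine Eventually.of_forall fun x r _ => ?_
    have h1 : HasDerivAt (fun r => x - r) (-1) r := by
      simpa using (hasDerivAt_id r).const_sub x
    have := ((kQ_deriv k (x - r)).comp r h1).const_mul (f x)
    refine this.congr_deriv ?_
    ring

theorem abs_sub_tendsto (x : ℝ) : Tendsto (fun r : ℝ => |x - r|) (cocompact ℝ) atTop := by
  have h := tendsto_norm_cocompact_atTop (E := ℝ)
  refine tendsto_atTop_mono (fun r => ?_) (tendsto_atTop_add_const_right _ (-|x|) h)
  rw [Real.norm_eq_abs]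
  have := abs_sub_abs_le_abs_sub r x
  rw [abs_sub_comm x r]; linarith

theorem corr_tendsto (k : ℝ) (hk : 0 < k) (f : ℝ → ℝ) (hf : Integrable f) :
    Tendsto (fun r => ∫ x, f x * kQ k (x - r)) (cocompact ℝ) (nhds 0) := by
  have hQc := kQ_cont k
  haveI : (cocompact ℝ).IsCountablyGenerated := by
    rw [cocompact_eq_atBot_atTop]; infer_instance
  have : Tendsto (fun r => ∫ x, f x * kQ k (x - r)) (cocompact ℝ) (nhds (∫ x : ℝ, (0 : ℝ))) := by
    refine tendsto_integral_filter_of_dominated_convergence (fun x => |f x| * (6 * k ^ 2)) ?_ ?_ ?_ ?_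
    · refine Eventually.of_forall fun r => hf.1.mul (Continuous.aestronglyMeasurable (by fun_prop))
    · refine Eventually.of_forall fun r => Eventually.of_forall fun x => ?_
      rw [Real.norm_eq_abs, abs_mul, abs_of_pos (kQ_pos k hk _)]
      gcongr
      exact kQ_le k _
    · exact hf.abs.mul_const _
    · refine Eventually.of_forall fun x => ?_
      have := (kS_tendsto k hk (map (fun r => x - r) (cocompact ℝ)) (abs_sub_tendsto x))
      have h2 : Tendsto (fun r => kS k (x - r)) (cocompact ℝ) (nhds 0) := this
      have h3 := (h2.const_mul (6 * k ^ 2)).const_mul (f x)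
      simpa [kQ] using h3
  simpa using this

theorem corr_shift (k : ℝ) (f : ℝ → ℝ) (z : ℝ) :
    ∫ x, f x * kQ k (x - z) = ∫ x, f (x + z) * kQ k x := by
  rw [← integral_add_right_eq_self (fun x => f x * kQ k (x - z)) z]
  congr 1; funext x; rw [add_sub_cancel_right]

theorem dM_eq (k : ℝ) (hk : 0 < k) {f : ℝ → ℝ} (hf : MemLp f 2) (z : ℝ) :
    dM k f z = fM f + fM (kQ k) - 2 * ∫ x, f x * kQ k (x - z) := by
  rw [corr_shift]
  have hs : MemLp (fun x => f (x + z)) 2 := hf.comp_measurePreserving (measurePreserving_add_right volume z)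
  have hQ := (kQ_H1 k hk 0).f2
  have := lin3 1 1 (-2) hs.integrable_sq hQ.integrable_sq (memLp_mul_int hs hQ)
  have h2 : fM f = ∫ x, f (x + z) ^ 2 :=
    (integral_add_right_eq_self (fun x => f x ^ 2) z).symm
  unfold dM
  rw [h2]; unfold fM
  have h3 : ∀ a b c : ℝ, a + b - 2 * c = 1 * a + 1 * b + -2 * c := by intros; ring
  rw [h3, ← this]
  congr 1; funext x; ring

/-- the main stationary estimate -/
theorem core (k : ℝ) (hk : 0 < k) (K1 : ℝ) (hK1 : 0 < K1) :
    ∃ ε K2 δ0 : ℝ, 0 < ε ∧ 0 < K2 ∧ 0 < δ0 ∧ ∀ e f g, H1f e f g → Integrable f →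
      (∃ z, dM k f z ≤ ε ^ 2) →
      ∀ δ, 0 < δ → δ ≤ δ0 → fM f ≤ fM (kQ k) + K1 * δ → fE f g ≤ fE (kQ k) (kD k) + K1 * δ →
      fE f g + 2 * k ^ 2 * fM f ≤ fE (kQ k) (kD k) + 2 * k ^ 2 * fM (kQ k) + K1 * δ ^ 2 →
      ∃ z, dH k f g z ≤ K2 * δ ^ 2 := by
  obtain ⟨ε, K2, δ0, h1, h2, h3, h4, hcs⟩ := core_static k hk K1 hK1
  refine ⟨ε, K2, δ0, h1, h3, h4, ?_⟩
  intro e f g h hi ⟨z0, hz0⟩ δ hδ hδ0 hM hE hF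
  have hc : Continuous (fun r => ∫ x, f x * kQ k (x - r)) :=
    continuous_iff_continuousAt.2 fun r => (corr_deriv k hk f hi r).continuousAt
  have hpos : 0 < ∫ x, f x * kQ k (x - z0) := by
    have e1 := dM_eq k hk h.f2 z0
    have : 0 ≤ fM f := integral_nonneg fun x => sq_nonneg _
    linarith
  obtain ⟨z, hz⟩ := hc.exists_forall_ge' z0
    (((corr_tendsto k hk f hi).eventually_lt_const hpos).mono fun x hx => hx.le)
  have hder : ∫ x, -(f x * kD k (x - z)) = 0 := by
    have : IsLocalMax (fun r => ∫ x, f x * kQ k (x - r)) z := Eventually.of_forall hz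
    exact this.hasDerivAt_eq_zero (corr_deriv k hk f hi z)
  refine ⟨z, ?_⟩
  have hs := h.shift z
  have hMs : fM (fun x => f (x + z)) = fM f :=
    integral_add_right_eq_self (fun x => f x ^ 2) z
  have hEs : fE (fun x => f (x + z)) (fun x => g (x + z)) = fE f g :=
    integral_add_right_eq_self (fun x => 1 / 2 * g x ^ 2 - 1 / 3 * f x ^ 3) z
  refine hcs (e - z) _ _ hs ?_ ?_ δ hδ hδ0 (by rw [hMs]; exact hM) (by rw [hEs]; exact hE)
    (by rw [hMs, hEs]; exact hF)
  · have hD := (kQ_H1 k hk (e - z)).g2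
    have l := lin2 1 (-1) (memLp_mul_int hs.f2 hD) (memLp_mul_int (kQ_H1 k hk (e - z)).f2 hD)
    rw [QD_zero k hk] at l
    have e1 : ∫ x, f (x + z) * kD k x = 0 := by
      rw [integral_neg, neg_eq_zero] at hder
      rw [← hder, ← integral_add_right_eq_self (fun x => f x * kD k (x - z)) z]
      congr 1; funext x; rw [add_sub_cancel_right]
    rw [e1] at l
    rw [mul_zero, mul_zero, add_zero] at l
    rw [← l]; congr 1; funext x; ring
  · refine le_trans ?_ hz0
    have e1 := dM_eq k hk h.f2 z0
    have e2 := dM_eq k hk h.f2 z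
    have := hz z0
    show dM k f z ≤ _
    linarith

/-- Unbundled data of a half-line solution with zero boundary value. -/
structure Kd (u ux uxx uxxx ut uxt : ℝ → ℝ → ℝ) : Prop where
  c0 : Continuous (Function.uncurry u)
  c1 : Continuous (Function.uncurry ux)
  c2 : Continuous (Function.uncurry uxx)
  c3 : Continuous (Function.uncurry uxxx)
  ct : Continuous (Function.uncurry ut)
  cxt : Continuous (Function.uncurry uxt)
  d0 : ∀ x t, HasDerivAt (fun y => u y t) (ux x t) x
  d1 : ∀ x t, HasDerivAt (fun y => ux y t) (uxx x t) x
  d2 : ∀ x t, HasDerivAt (fun y => uxx y t) (uxxx x t) x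
  dt : ∀ x t, HasDerivAt (fun y => ut y t) (uxt x t) x
  t0 : ∀ x t, HasDerivAt (fun s => u x s) (ut x t) t
  t1 : ∀ x t, HasDerivAt (fun s => ux x s) (uxt x t) t
  eq : ∀ x, 0 ≤ x → ∀ t, 0 ≤ t → ut x t = -uxxx x t - 2 * (u x t * ux x t)
  bd : ∀ t, 0 ≤ t → u 0 t = 0
  bdt : ∀ t, 0 ≤ t → ut 0 t = 0
  lim0 : ∀ t, 0 ≤ t → Tendsto (fun x => u x t) atTop (nhds 0)
  dom : ∀ T : ℝ, ∃ (g : ℝ → ℝ) (B : ℝ), IntegrableOn g (Ioi 0) ∧ 0 ≤ B ∧ ∀ t, 0 ≤ t → t ≤ T →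
    ∀ x, 0 < x → |u x t| ≤ g x ∧ |ux x t| ≤ g x ∧ |uxx x t| ≤ g x ∧ |uxxx x t| ≤ g x ∧
      u x t ^ 2 ≤ g x ∧ ux x t ^ 2 ≤ g x ∧ uxx x t ^ 2 ≤ g x ∧ |u x t| ≤ B ∧ |ux x t| ≤ B

/-- partial derivative in the first variable -/
noncomputable def pX (F : ℝ × ℝ → ℝ) (p : ℝ × ℝ) : ℝ := fderiv ℝ F p (1, 0)
/-- partial derivative in the second variable -/
noncomputable def pT (F : ℝ × ℝ → ℝ) (p : ℝ × ℝ) : ℝ := fderiv ℝ F p (0, 1)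

theorem pX_smooth {F : ℝ × ℝ → ℝ} (h : ContDiff ℝ (⊤ : ℕ∞) F) : ContDiff ℝ (⊤ : ℕ∞) (pX F) :=
  (h.fderiv_right (m := (⊤ : ℕ∞)) (by norm_cast)).clm_apply contDiff_const
theorem pT_smooth {F : ℝ × ℝ → ℝ} (h : ContDiff ℝ (⊤ : ℕ∞) F) : ContDiff ℝ (⊤ : ℕ∞) (pT F) :=
  (h.fderiv_right (m := (⊤ : ℕ∞)) (by norm_cast)).clm_apply contDiff_const

theorem pX_deriv {F : ℝ × ℝ → ℝ} (h : ContDiff ℝ (⊤ : ℕ∞) F) (x t : ℝ) :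
    HasDerivAt (fun y => F (y, t)) (pX F (x, t)) x := by
  have h1 := ((h.differentiable (by simp)) (x, t)).hasFDerivAt
  have h2 : HasDerivAt (fun y : ℝ => (y, t)) ((1 : ℝ), (0 : ℝ)) x :=
    (hasDerivAt_id x).prodMk (hasDerivAt_const x t)
  exact h1.comp_hasDerivAt x h2
theorem pT_deriv {F : ℝ × ℝ → ℝ} (h : ContDiff ℝ (⊤ : ℕ∞) F) (x t : ℝ) :
    HasDerivAt (fun s => F (x, s)) (pT F (x, t)) t := by
  have h1 := ((h.differentiable (by simp)) (x, t)).hasFDerivAt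
  have h2 : HasDerivAt (fun s : ℝ => (x, s)) ((0 : ℝ), (1 : ℝ)) t :=
    (hasDerivAt_const t x).prodMk (hasDerivAt_id t)
  exact h1.comp_hasDerivAt t h2

theorem pXT {F : ℝ × ℝ → ℝ} (h : ContDiff ℝ (⊤ : ℕ∞) F) (p : ℝ × ℝ) :
    pX (pT F) p = pT (pX F) p := by
  have hs : IsSymmSndFDerivAt ℝ F p :=
    (h.contDiffAt (x := p)).isSymmSndFDerivAt (by
      simp only [minSmoothness_of_isRCLikeNormedField]
      exact WithTop.coe_le_coe.2 (show (2 : ℕ∞) ≤ ⊤ from le_top))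
  have hd : DifferentiableAt ℝ (fderiv ℝ F) p :=
    ((h.fderiv_right (m := (⊤ : ℕ∞)) (by norm_cast)).differentiable (by simp)) p
  have e1 : ∀ v w : ℝ × ℝ, fderiv ℝ (fun q => fderiv ℝ F q v) p w = fderiv ℝ (fderiv ℝ F) p w v := by
    intro v w
    rw [fderiv_clm_apply hd (differentiableAt_const v)]
    simp
  show fderiv ℝ (fun q => fderiv ℝ F q (0, 1)) p (1, 0) = fderiv ℝ (fun q => fderiv ℝ F q (1, 0)) p (0, 1)
  rw [e1, e1]
  exact hs _ _

theorem compact_dom (u : ℝ → ℝ → ℝ) (h : RightKdVSolution u (Ici 0)) (T : ℝ) :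
    ∃ g : ℝ → ℝ, IntegrableOn g (Ioi 0) ∧ ∀ t, 0 ≤ t → t ≤ T → ∀ x ∈ Ioi (0 : ℝ), ∀ n ≤ 3,
      |iteratedDeriv n (fun z => u z t) x| + (iteratedDeriv n (fun z => u z t) x) ^ 2 ≤ g x := by
  have hK : IsCompact (Icc 0 T) := isCompact_Icc
  suffices hh : ∃ g : ℝ → ℝ, IntegrableOn g (Ioi 0) ∧
    ∀ t, 0 ≤ t → t ∈ Icc 0 T → ∀ x ∈ Ioi (0 : ℝ), ∀ n ≤ 3,
      |iteratedDeriv n (fun z => u z t) x| + (iteratedDeriv n (fun z => u z t) x) ^ 2 ≤ g x by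
    obtain ⟨g, hg, hb⟩ := hh
    exact ⟨g, hg, fun t ht htT => hb t ht ⟨ht, htT⟩⟩
  refine hK.induction_on (p := fun S => ∃ g : ℝ → ℝ, IntegrableOn g (Ioi 0) ∧
    ∀ t, 0 ≤ t → t ∈ S → ∀ x ∈ Ioi (0 : ℝ), ∀ n ≤ 3,
      |iteratedDeriv n (fun z => u z t) x| + (iteratedDeriv n (fun z => u z t) x) ^ 2 ≤ g x)
    ?_ ?_ ?_ ?_
  · exact ⟨fun _ => 0, integrableOn_zero, fun t _ ht => absurd ht (notMem_empty t)⟩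
  · rintro S S' hSS ⟨g, hg, hb⟩
    exact ⟨g, hg, fun t ht hS => hb t ht (hSS hS)⟩
  · rintro S S' ⟨g, hg, hb⟩ ⟨g', hg', hb'⟩
    refine ⟨fun x => |g x| + |g' x|, hg.abs.add hg'.abs, fun t ht hS x hx n hn => ?_⟩
    rcases hS with hS | hS
    · have := hb t ht hS x hx n hn
      linarith [le_abs_self (g x), abs_nonneg (g' x)]
    · have := hb' t ht hS x hx n hn
      linarith [le_abs_self (g' x), abs_nonneg (g x)]
  · intro t ht
    obtain ⟨ε, hε, g, hg, hb⟩ := h.locUnif t ht.1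
    refine ⟨Metric.ball t ε, mem_nhdsWithin_of_mem_nhds (Metric.ball_mem_nhds t hε), g, hg, ?_⟩
    intro s hs hst x hx n hn
    exact hb s hs (by rw [← Real.dist_eq]; exact hst) x hx n hn

theorem bound_of_tail (f f' g : ℝ → ℝ) (hd : ∀ x, HasDerivAt f (f' x) x)
    (hg : IntegrableOn g (Ioi 0)) (hc : Continuous f') (hb : ∀ x, 0 < x → |f' x| ≤ g x)
    (hl : Tendsto f atTop (nhds 0)) (x : ℝ) (hx : 0 < x) : |f x| ≤ ∫ y in Ioi 0, g y := by
  have hsub : Ioi x ⊆ Ioi 0 := Ioi_subset_Ioi hx.le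
  have hi : IntegrableOn f' (Ioi x) := by
    refine (hg.mono_set hsub).mono' hc.aestronglyMeasurable ?_
    exact (ae_restrict_mem measurableSet_Ioi).mono fun y hy => hb y (hsub hy)
  have h1 := integral_Ioi_of_hasDerivAt_of_tendsto' (a := x) (fun y _ => hd y) hi hl
  have h2 : f x = -∫ y in Ioi x, f' y := by rw [h1]; ring
  rw [h2, abs_neg]
  refine (abs_integral_le_integral_abs).trans ?_
  refine (setIntegral_mono_on hi.abs (hg.mono_set hsub) measurableSet_Ioi
    fun y hy => hb y (hsub hy)).trans ?_
  refine setIntegral_mono_set hg ?_ (Eventually.of_forall hsub)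
  exact (ae_restrict_mem measurableSet_Ioi).mono fun y hy => (abs_nonneg _).trans (hb y hy)

theorem exists_Kd (u : ℝ → ℝ → ℝ) (h : RightKdVSolution u (Ici 0))
    (hb : ∀ t ≥ (0 : ℝ), u 0 t = 0) :
    ∃ ux uxx uxxx ut uxt, Kd u ux uxx uxxx ut uxt := by
  have h0 := h.smooth
  set F := Function.uncurry u with hF
  have h1 := pX_smooth h0
  have h2 := pX_smooth h1
  have h3 := pX_smooth h2
  have ht := pT_smooth h0
  have hxt := pT_smooth h1
  have i0 : ∀ x t, iteratedDeriv 0 (fun z => u z t) x = u x t := fun x t => by simp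
  have i1 : ∀ t, iteratedDeriv 1 (fun z => u z t) = fun x => pX F (x, t) := fun t => by
    rw [iteratedDeriv_one]; funext x; exact (pX_deriv h0 x t).deriv
  have i2 : ∀ t, iteratedDeriv 2 (fun z => u z t) = fun x => pX (pX F) (x, t) := fun t => by
    rw [iteratedDeriv_succ, i1]; funext x; exact (pX_deriv h1 x t).deriv
  have i3 : ∀ t, iteratedDeriv 3 (fun z => u z t) = fun x => pX (pX (pX F)) (x, t) := fun t => by
    rw [iteratedDeriv_succ, i2]; funext x; exact (pX_deriv h2 x t).deriv
  have l0 : ∀ t, 0 ≤ t → Tendsto (fun x => u x t) atTop (nhds 0) := fun t ht => by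
    simpa using h.decay t ht 0 (by norm_num)
  refine ⟨fun x t => pX F (x, t), fun x t => pX (pX F) (x, t), fun x t => pX (pX (pX F)) (x, t),
    fun x t => pT F (x, t), fun x t => pT (pX F) (x, t), h0.continuous, h1.continuous,
    h2.continuous, h3.continuous, ht.continuous, hxt.continuous, pX_deriv h0, pX_deriv h1,
    pX_deriv h2, fun x t => ?_, pT_deriv h0, pT_deriv h1, ?_, hb, ?_, l0, ?_⟩
  · rw [← pXT h0]; exact pX_deriv ht x t
  · intro x hx t ht
    have := h.eqn x hx t ht
    have e0 : deriv (fun s => u x s) t = pT F (x, t) := (pT_deriv h0 x t).deriv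
    rw [e0, i2] at this
    have e2 := (pX_deriv h2 x t).add ((pX_deriv h0 x t).pow 2)
    have e3 : deriv (fun y => pX (pX F) (y, t) + u y t ^ 2) x = pX (pX (pX F)) (x, t) +
        2 * (u x t * pX F (x, t)) := by
      refine HasDerivAt.deriv (e2.congr_deriv ?_)
      simp [hF, mul_assoc]
    rw [e3] at this
    linarith
  · intro t ht
    have e1 : HasDerivWithinAt (fun s => F (0, s)) (pT F (0, t)) (Ici 0) t :=
      (pT_deriv h0 0 t).hasDerivWithinAt
    have e2 : HasDerivWithinAt (fun s => F (0, s)) 0 (Ici 0) t :=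
      (hasDerivWithinAt_const t (Ici 0) (0 : ℝ)).congr (fun s hs => hb s hs) (hb t ht)
    exact (uniqueDiffOn_Ici (0 : ℝ) t ht).eq_deriv _ e1 e2
  · intro T
    obtain ⟨g, hg, hd⟩ := compact_dom u h T
    refine ⟨g, |∫ y in Ioi 0, g y|, hg, abs_nonneg _, ?_⟩
    · intro t ht htT x hx
      have g0 : ∀ x : ℝ, 0 < x → _ := fun x hx => hd t ht htT x hx 0 (by norm_num)
      have g1 : ∀ x : ℝ, 0 < x → _ := fun x hx => hd t ht htT x hx 1 (by norm_num)
      have g2 : ∀ x : ℝ, 0 < x → _ := fun x hx => hd t ht htT x hx 2 (by norm_num)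
      have g3 : ∀ x : ℝ, 0 < x → _ := fun x hx => hd t ht htT x hx 3 (by norm_num)
      simp only [i0, i1, i2, i3] at g0 g1 g2 g3
      have l1 := h.decay t ht 1 (by norm_num)
      rw [i1] at l1
      have hc1 : Continuous (fun y => pX F (y, t)) := h1.continuous.comp (by fun_prop)
      have hc2 : Continuous (fun y => pX (pX F) (y, t)) := h2.continuous.comp (by fun_prop)
      have b0 := bound_of_tail (fun y => u y t) _ g (fun y => pX_deriv h0 y t) hg hc1
        (fun y hy => by have := g1 y hy; have := sq_nonneg (pX F (y, t)); linarith) (l0 t ht) x hx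
      have b1 := bound_of_tail _ _ g (fun y => pX_deriv h1 y t) hg hc2
        (fun y hy => by have := g2 y hy; have := sq_nonneg (pX (pX F) (y, t)); linarith) l1 x hx
      have g0 := g0 x hx
      have g1 := g1 x hx
      have g2 := g2 x hx
      have g3 := g3 x hx
      have a0 := abs_nonneg (u x t)
      have a1 := abs_nonneg (pX F (x, t))
      have a2 := abs_nonneg (pX (pX F) (x, t))
      have s0 := sq_nonneg (u x t)
      have s1 := sq_nonneg (pX F (x, t))
      have s2 := sq_nonneg (pX (pX F) (x, t))
      have s3 := sq_nonneg (pX (pX (pX F)) (x, t))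
      exact ⟨by linarith, by linarith, by linarith, by linarith, by linarith, by linarith,
        by linarith, b0.trans (le_abs_self _), b1.trans (le_abs_self _)⟩

theorem param_deriv (e e' : ℝ → ℝ → ℝ) (hc : Continuous (Function.uncurry e))
    (hc' : Continuous (Function.uncurry e')) (hd : ∀ x t, HasDerivAt (fun s => e x s) (e' x t) t)
    (a b τ : ℝ) : HasDerivAt (fun s => ∫ x in a..b, e x s) (∫ x in a..b, e' x τ) τ := by
  obtain ⟨B, hB⟩ := ((isCompact_uIcc (a := a) (b := b)).prod
    (isCompact_Icc (a := τ - 1) (b := τ + 1))).exists_bound_of_continuousOn hc'.continuousOn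
  have hs : ∀ s, Continuous fun x => e x s := fun s =>
    hc.comp (continuous_id.prodMk continuous_const)
  have hs' : ∀ s, Continuous fun x => e' x s := fun s =>
    hc'.comp (continuous_id.prodMk continuous_const)
  refine (intervalIntegral.hasDerivAt_integral_of_dominated_loc_of_deriv_le
    (F := fun s x => e x s) (F' := fun s x => e' x s) (bound := fun _ => B)
    (s := Icc (τ - 1) (τ + 1)) (Icc_mem_nhds (by linarith) (by linarith))
    (Eventually.of_forall fun s => (hs s).aestronglyMeasurable) ((hs τ).intervalIntegrable _ _)
    (hs' τ).aestronglyMeasurable (Eventually.of_forall fun x hx s hs => ?_)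
    (_root_.intervalIntegrable_const) (Eventually.of_forall fun x _ s _ => hd x s)).2
  exact hB (x, s) ⟨uIoc_subset_uIcc hx, hs⟩

theorem gsmall (g : ℝ → ℝ) (hg : IntegrableOn g (Ioi 0)) (η : ℝ) (hη : 0 < η) :
    ∃ᶠ R in atTop, g R < η := by
  intro hcon
  obtain ⟨R0, hR0⟩ := eventually_atTop.1 hcon
  have h1 : IntegrableOn g (Ioi (max R0 0)) := hg.mono_set (Ioi_subset_Ioi (le_max_right _ _))
  have h2 : IntegrableOn (fun _ : ℝ => η) (Ioi (max R0 0)) := by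
    refine h1.mono' aestronglyMeasurable_const ?_
    refine (ae_restrict_iff' measurableSet_Ioi).2 (Eventually.of_forall fun x hx => ?_)
    have := hR0 x ((le_max_left _ _).trans (le_of_lt hx))
    rw [Real.norm_of_nonneg hη.le]; exact not_lt.1 this
  rw [integrableOn_const_iff] at h2
  simp [hη.ne'] at h2

theorem gtail (g : ℝ → ℝ) (hg : IntegrableOn g (Ioi 0)) :
    Tendsto (fun R => ∫ x in (0:ℝ)..R, g x) atTop (nhds (∫ x in Ioi 0, g x)) :=
  intervalIntegral_tendsto_integral_Ioi 0 hg tendsto_id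

theorem balance (e et J Jx S : ℝ → ℝ → ℝ) (G : ℝ → ℝ) (s t κ : ℝ) (hs0 : 0 ≤ s) (hst : s ≤ t)
    (hc : Continuous (Function.uncurry e)) (hc' : Continuous (Function.uncurry et))
    (hd : ∀ x t, HasDerivAt (fun s => e x s) (et x t) t)
    (hJ : ∀ x t, HasDerivAt (fun y => J y t) (Jx x t) x)
    (hJc : Continuous (Function.uncurry Jx)) (hSc : Continuous (Function.uncurry S))
    (heq : ∀ x, 0 ≤ x → ∀ τ, 0 ≤ τ → et x τ = -Jx x τ + S x τ)
    (hJ0 : ∀ τ, 0 ≤ τ → J 0 τ ≤ 0) (hG : IntegrableOn G (Ioi 0))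
    (hb : ∀ τ, 0 ≤ τ → τ ≤ t → ∀ x, 0 < x → |e x τ| ≤ G x ∧ |J x τ| ≤ G x ∧ |S x τ| ≤ G x)
    (hκ : ∀ τ, s ≤ τ → τ ≤ t → ∫ x in Ioi 0, S x τ ≤ κ) :
    (∫ x in Ioi 0, e x t) - (∫ x in Ioi 0, e x s) ≤ κ * (t - s) := by
  have sl : ∀ (f : ℝ → ℝ → ℝ), Continuous (Function.uncurry f) → ∀ τ, Continuous fun x => f x τ :=
    fun f hf τ => hf.comp (continuous_id.prodMk continuous_const)
  have int1 : ∀ (f : ℝ → ℝ → ℝ), Continuous (Function.uncurry f) → ∀ τ,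
      (∀ x, 0 < x → |f x τ| ≤ G x) → IntegrableOn (fun x => f x τ) (Ioi 0) := by
    intro f hf τ hh
    refine hG.mono' (sl f hf τ).aestronglyMeasurable ?_
    exact (ae_restrict_iff' measurableSet_Ioi).2 (Eventually.of_forall fun x hx => hh x hx)
  have key : ∀ R, 0 < R → (∫ x in (0:ℝ)..R, e x t) - (∫ x in (0:ℝ)..R, e x s) ≤
      (G R + ((∫ x in Ioi 0, G x) - ∫ x in (0:ℝ)..R, G x) + κ) * (t - s) := by
    intro R hR
    have hD := fun τ => param_deriv e et hc hc' hd 0 R τ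
    refine (convex_Icc s t).image_sub_le_mul_sub_of_deriv_le
      (fun τ _ => (hD τ).continuousAt.continuousWithinAt)
      (fun τ _ => (hD τ).differentiableAt.differentiableWithinAt) ?_ s ⟨le_rfl, hst⟩ t
      ⟨hst, le_rfl⟩ hst
    intro τ hτ
    have hτ := interior_subset hτ
    have hτ0 : 0 ≤ τ := hs0.trans hτ.1
    rw [(hD τ).deriv]
    have e1 : ∫ x in (0:ℝ)..R, et x τ = -(∫ x in (0:ℝ)..R, Jx x τ) + ∫ x in (0:ℝ)..R, S x τ := by
      rw [← intervalIntegral.integral_neg, ← intervalIntegral.integral_add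
        ((show Continuous fun x => -Jx x τ from (sl Jx hJc τ).neg).intervalIntegrable _ _) ((sl S hSc τ).intervalIntegrable _ _)]
      refine intervalIntegral.integral_congr fun x hx => ?_
      rw [uIcc_of_le hR.le] at hx
      exact heq x hx.1 τ hτ0
    have e2 : ∫ x in (0:ℝ)..R, Jx x τ = J R τ - J 0 τ :=
      intervalIntegral.integral_eq_sub_of_hasDerivAt (fun x _ => hJ x τ)
        ((sl Jx hJc τ).intervalIntegrable _ _)
    have iS := int1 S hSc τ fun x hx => (hb τ hτ0 hτ.2 x hx).2.2
    have e3 : (∫ x in (0:ℝ)..R, S x τ) + ∫ x in Ioi R, S x τ = ∫ x in Ioi 0, S x τ :=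
      intervalIntegral.integral_interval_add_Ioi iS (iS.mono_set (Ioi_subset_Ioi hR.le))
    have e4 : (∫ x in (0:ℝ)..R, G x) + ∫ x in Ioi R, G x = ∫ x in Ioi 0, G x :=
      intervalIntegral.integral_interval_add_Ioi hG (hG.mono_set (Ioi_subset_Ioi hR.le))
    have e5 : -(∫ x in Ioi R, S x τ) ≤ ∫ x in Ioi R, G x := by
      rw [← integral_neg]
      refine setIntegral_mono_on (iS.mono_set (Ioi_subset_Ioi hR.le)).neg
        (hG.mono_set (Ioi_subset_Ioi hR.le)) measurableSet_Ioi fun x hx => ?_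
      have hx : R < x := hx
      exact (neg_le_abs _).trans (hb τ hτ0 hτ.2 x (hR.trans hx)).2.2
    have e6 := (neg_le_abs _).trans (hb τ hτ0 hτ.2 R hR).2.1
    have e7 := hJ0 τ hτ0
    have e8 := hκ τ hτ.1 hτ.2
    rw [e1, e2]
    linarith
  have l1 := gtail _ (int1 e hc t fun x hx => (hb t (hs0.trans hst) le_rfl x hx).1)
  have l2 := gtail _ (int1 e hc s fun x hx => (hb s hs0 hst x hx).1)
  have l3 := gtail G hG
  refine le_of_forall_pos_le_add fun η hη => ?_
  set h : ℝ := t - s with hh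
  have hh0 : 0 ≤ h := by rw [hh]; linarith
  have hη' : 0 < η / (3 * (h + 1)) := by positivity
  have f1 := (l1.sub l2).eventually (lt_mem_nhds (sub_lt_self _ (show 0 < η / 3 by positivity)))
  have f2 := l3.eventually (lt_mem_nhds (sub_lt_self _ hη'))
  obtain ⟨R, hR1, hR2, hR3, hR4⟩ :=
    ((gsmall G hG _ hη').and_eventually (f1.and (f2.and (eventually_gt_atTop 0)))).exists
  have := key R hR4
  have h5 : (G R + ((∫ x in Ioi 0, G x) - ∫ x in (0:ℝ)..R, G x) + κ) * h ≤
      (2 * (η / (3 * (h + 1))) + κ) * h := by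
    apply mul_le_mul_of_nonneg_right _ hh0
    linarith
  have h6 : η / (3 * (h + 1)) * h ≤ η / 3 := by
    rw [div_mul_eq_mul_div, div_le_div_iff₀ (by positivity) (by positivity)]
    nlinarith
  have h7 : (2 * (η / (3 * (h + 1))) + κ) * h = 2 * (η / (3 * (h + 1)) * h) + κ * h := by ring
  linarith

/-- extension by zero of a time slice from the half line -/
noncomputable def hl (v : ℝ → ℝ → ℝ) (t : ℝ) : ℝ → ℝ := (Ioi (0:ℝ)).indicator (fun x => v x t)

theorem hl_pos (v : ℝ → ℝ → ℝ) (t x : ℝ) (hx : 0 < x) : hl v t x = v x t :=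
  indicator_of_mem (s := Ioi (0:ℝ)) hx _
theorem hl_neg (v : ℝ → ℝ → ℝ) (t x : ℝ) (hx : x ≤ 0) : hl v t x = 0 :=
  indicator_of_notMem (s := Ioi (0:ℝ)) (by simpa using hx) _

theorem hl_int (u v : ℝ → ℝ → ℝ) (t : ℝ) (Φ : ℝ → ℝ → ℝ → ℝ) (h0 : ∀ x, Φ x 0 0 = 0) :
    ∫ x, Φ x (hl u t x) (hl v t x) = ∫ x in Ioi 0, Φ x (u x t) (v x t) := by
  rw [← integral_indicator measurableSet_Ioi]
  congr 1; funext x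
  by_cases hx : 0 < x
  · rw [hl_pos _ _ _ hx, hl_pos _ _ _ hx, indicator_of_mem (show x ∈ Ioi (0:ℝ) from hx)]
  · rw [hl_neg _ _ _ (not_lt.1 hx), hl_neg _ _ _ (not_lt.1 hx), h0,
      indicator_of_notMem (show x ∉ Ioi (0:ℝ) from hx)]

section
variable {u ux uxx uxxx ut uxt : ℝ → ℝ → ℝ}

theorem Kd.energy (K : Kd u ux uxx uxxx ut uxt) {s t : ℝ} (hs : 0 ≤ s) (hst : s ≤ t) :
    fE (hl u t) (hl ux t) ≤ fE (hl u s) (hl ux s) := by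
  obtain ⟨g, B, hg, hB, hdom⟩ := K.dom t
  have c0 : Continuous fun p : ℝ × ℝ => u p.1 p.2 := K.c0
  have c1 : Continuous fun p : ℝ × ℝ => ux p.1 p.2 := K.c1
  have c2 : Continuous fun p : ℝ × ℝ => uxx p.1 p.2 := K.c2
  have c3 : Continuous fun p : ℝ × ℝ => uxxx p.1 p.2 := K.c3
  have ct : Continuous fun p : ℝ × ℝ => ut p.1 p.2 := K.ct
  have cxt : Continuous fun p : ℝ × ℝ => uxt p.1 p.2 := K.cxt
  have key := balance (fun x t => 1 / 2 * ux x t ^ 2 - 1 / 3 * u x t ^ 3)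
    (fun x t => ux x t * uxt x t - u x t ^ 2 * ut x t)
    (fun x t => -(ux x t * ut x t + 1 / 2 * (uxx x t + u x t ^ 2) ^ 2))
    (fun x t => -(uxx x t * ut x t + ux x t * uxt x t
      + (uxx x t + u x t ^ 2) * (uxxx x t + 2 * u x t * ux x t)))
    (fun _ _ => 0) (fun x => (2 + B + 3 * B ^ 2) * g x) s t 0 hs hst
    (show Continuous fun p : ℝ × ℝ => 1 / 2 * ux p.1 p.2 ^ 2 - 1 / 3 * u p.1 p.2 ^ 3 by fun_prop)
    (show Continuous fun p : ℝ × ℝ => ux p.1 p.2 * uxt p.1 p.2 - u p.1 p.2 ^ 2 * ut p.1 p.2 by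
      fun_prop)
    (fun x τ => by
      refine ((((K.t1 x τ).pow 2).const_mul (1 / 2)).sub
        (((K.t0 x τ).pow 3).const_mul (1 / 3))).congr_deriv ?_
      push_cast; ring)
    (fun x τ => by
      refine ((((K.d1 x τ).mul (K.dt x τ)).add
        ((((K.d2 x τ).add ((K.d0 x τ).pow 2)).pow 2).const_mul (1 / 2)))).neg.congr_deriv ?_
      simp only [Pi.add_apply, Pi.pow_apply]
      push_cast; ring)
    (show Continuous fun p : ℝ × ℝ => -(uxx p.1 p.2 * ut p.1 p.2 + ux p.1 p.2 * uxt p.1 p.2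
      + (uxx p.1 p.2 + u p.1 p.2 ^ 2) * (uxxx p.1 p.2 + 2 * u p.1 p.2 * ux p.1 p.2)) by fun_prop)
    (show Continuous fun p : ℝ × ℝ => (0 : ℝ) from continuous_const)
    (fun x hx τ hτ => by
      have := K.eq x hx τ hτ
      have h2 : uxxx x τ = -ut x τ - 2 * (u x τ * ux x τ) := by linarith
      simp only [h2]; ring)
    (fun τ hτ => by
      show -(ux 0 τ * ut 0 τ + 1 / 2 * (uxx 0 τ + u 0 τ ^ 2) ^ 2) ≤ 0
      rw [K.bdt τ hτ]
      have := sq_nonneg (uxx 0 τ + u 0 τ ^ 2)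
      linarith)
    (hg.const_mul _)
    (fun τ hτ hτt x hx => by
      obtain ⟨b1, b2, b3, b4, b5, b6, b7, b8, b9⟩ := hdom τ hτ hτt x hx
      have g0 : 0 ≤ g x := (abs_nonneg _).trans b1
      have hBB : 0 ≤ B ^ 2 := sq_nonneg B
      refine ⟨?_, ?_, ?_⟩
      · have h1 : |u x τ ^ 3| ≤ B * g x := by
          have : |u x τ ^ 3| = |u x τ| * u x τ ^ 2 := by rw [abs_pow, ← sq_abs]; ring
          rw [this]; exact mul_le_mul b8 b5 (sq_nonneg _) hB
        have h2 := abs_le.1 h1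
        have h3 := sq_nonneg (ux x τ)
        have h4 : 0 ≤ B ^ 2 * g x := by positivity
        have h5 : 0 ≤ B * g x := by positivity
        refine abs_le.2 ⟨?_, ?_⟩ <;> nlinarith [h2.1, h2.2]
      · have e1 := K.eq x hx.le τ hτ
        have h1 : |ut x τ| ≤ (1 + 2 * B) * g x := by
          have : |u x τ * ux x τ| ≤ B * g x := by
            rw [abs_mul]; exact mul_le_mul b8 b2 (abs_nonneg _) hB
          have h2 := abs_le.1 this
          have h3 := abs_le.1 b4
          rw [e1]; exact abs_le.2 ⟨by nlinarith [h2.1, h2.2, h3.1, h3.2],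
            by nlinarith [h2.1, h2.2, h3.1, h3.2]⟩
        have h2 : |ux x τ * ut x τ| ≤ B * ((1 + 2 * B) * g x) := by
          rw [abs_mul]; exact mul_le_mul b9 h1 (abs_nonneg _) hB
        have h3 : (u x τ ^ 2) ^ 2 ≤ B ^ 2 * g x := by
          have : u x τ ^ 2 ≤ B ^ 2 := by
            rw [← sq_abs]; exact pow_le_pow_left₀ (abs_nonneg _) b8 2
          rw [sq (u x τ ^ 2)]; exact mul_le_mul this b5 (sq_nonneg _) hBB
        have h4 : (uxx x τ + u x τ ^ 2) ^ 2 ≤ 2 * uxx x τ ^ 2 + 2 * (u x τ ^ 2) ^ 2 := by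
          nlinarith [sq_nonneg (uxx x τ - u x τ ^ 2)]
        have h5 := sq_nonneg (uxx x τ + u x τ ^ 2)
        have h6 := abs_le.1 h2
        have e2 : (2 + B + 3 * B ^ 2) * g x = B * ((1 + 2 * B) * g x) + B ^ 2 * g x + 2 * g x := by
          ring
        show |_| ≤ (2 + B + 3 * B ^ 2) * g x
        rw [abs_neg, e2]
        refine abs_le.2 ⟨?_, ?_⟩ <;> linarith [h6.1, h6.2]
      · simp only [abs_zero]; positivity)
    (fun τ _ _ => by simp)
  unfold fE
  rw [hl_int u ux t (fun x p q => 1 / 2 * q ^ 2 - 1 / 3 * p ^ 3) (by simp),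
    hl_int u ux s (fun x p q => 1 / 2 * q ^ 2 - 1 / 3 * p ^ 3) (by simp)]
  linarith

theorem Kd.wmass (K : Kd u ux uxx uxxx ut uxt) {s t : ℝ} (hs : 0 ≤ s) (hst : s ≤ t)
    (ω ω1 ω2 ω3 : ℝ → ℝ) (W c a κ : ℝ) (hω0 : ∀ x, 0 ≤ ω x)
    (h0 : ∀ x, HasDerivAt ω (ω1 x) x) (h1 : ∀ x, HasDerivAt ω1 (ω2 x) x)
    (h2 : ∀ x, HasDerivAt ω2 (ω3 x) x) (h3 : Continuous ω3)
    (hW : ∀ x, |ω x| ≤ W ∧ |ω1 x| ≤ W ∧ |ω2 x| ≤ W ∧ |ω3 x| ≤ W)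
    (hκ : ∀ τ, s ≤ τ → τ ≤ t → ∫ x, ((-3 * hl ux τ x ^ 2 + 4 / 3 * hl u τ x ^ 3
      - c * hl u τ x ^ 2) * ω1 (x - c * τ - a) + hl u τ x ^ 2 * ω3 (x - c * τ - a)) ≤ κ) :
    (∫ x, hl u t x ^ 2 * ω (x - c * t - a)) - (∫ x, hl u s x ^ 2 * ω (x - c * s - a))
      ≤ κ * (t - s) := by
  obtain ⟨g, B, hg, hB, hdom⟩ := K.dom t
  have c0 : Continuous fun p : ℝ × ℝ => u p.1 p.2 := K.c0
  have c1 : Continuous fun p : ℝ × ℝ => ux p.1 p.2 := K.c1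
  have c2 : Continuous fun p : ℝ × ℝ => uxx p.1 p.2 := K.c2
  have c3 : Continuous fun p : ℝ × ℝ => uxxx p.1 p.2 := K.c3
  have ct : Continuous fun p : ℝ × ℝ => ut p.1 p.2 := K.ct
  have w0 : Continuous ω := continuous_iff_continuousAt.2 fun y => (h0 y).continuousAt
  have w1 : Continuous ω1 := continuous_iff_continuousAt.2 fun y => (h1 y).continuousAt
  have w2 : Continuous ω2 := continuous_iff_continuousAt.2 fun y => (h2 y).continuousAt
  have hW0 : 0 ≤ W := (abs_nonneg _).trans (hW 0).1
  have sx : ∀ (f f' : ℝ → ℝ), (∀ x, HasDerivAt f (f' x) x) → ∀ x τ : ℝ,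
      HasDerivAt (fun y => f (y - c * τ - a)) (f' (x - c * τ - a)) x := by
    intro f f' hf x τ
    have := (hf (x - c * τ - a)).comp x (((hasDerivAt_id x).sub_const (c * τ)).sub_const a)
    refine this.congr_deriv ?_
    ring
  have st : ∀ x τ : ℝ, HasDerivAt (fun s => ω (x - c * s - a)) (-c * ω1 (x - c * τ - a)) τ := by
    intro x τ
    have := (h0 (x - c * τ - a)).comp τ
      ((((hasDerivAt_id τ).const_mul c).const_sub x).sub_const a)
    refine this.congr_deriv ?_
    ring
  have key := balance (fun x t => u x t ^ 2 * ω (x - c * t - a))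
    (fun x t => 2 * u x t * ut x t * ω (x - c * t - a) + u x t ^ 2 * (-c * ω1 (x - c * t - a)))
    (fun x t => (2 * (u x t * uxx x t) - ux x t ^ 2 + 4 / 3 * u x t ^ 3) * ω (x - c * t - a)
      - 2 * (u x t * ux x t) * ω1 (x - c * t - a) + u x t ^ 2 * ω2 (x - c * t - a))
    (fun x t => (2 * (u x t * uxxx x t) + 4 * u x t ^ 2 * ux x t) * ω (x - c * t - a)
      + (-3 * ux x t ^ 2 + 4 / 3 * u x t ^ 3) * ω1 (x - c * t - a)
      + u x t ^ 2 * ω3 (x - c * t - a))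
    (fun x t => (-3 * ux x t ^ 2 + 4 / 3 * u x t ^ 3 - c * u x t ^ 2) * ω1 (x - c * t - a)
      + u x t ^ 2 * ω3 (x - c * t - a)) (fun x => W * (10 + 10 * B + |c|) * g x) s t κ hs hst
    (show Continuous fun p : ℝ × ℝ => u p.1 p.2 ^ 2 * ω (p.1 - c * p.2 - a) by fun_prop)
    (show Continuous fun p : ℝ × ℝ => 2 * u p.1 p.2 * ut p.1 p.2 * ω (p.1 - c * p.2 - a)
      + u p.1 p.2 ^ 2 * (-c * ω1 (p.1 - c * p.2 - a)) by fun_prop)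
    (fun x τ => by
      refine (((K.t0 x τ).pow 2).mul (st x τ)).congr_deriv ?_
      simp only [Pi.pow_apply]
      push_cast; ring)
    (fun x τ => by
      refine ((((((K.d0 x τ).mul (K.d2 x τ)).const_mul 2).sub ((K.d1 x τ).pow 2)).add
        (((K.d0 x τ).pow 3).const_mul (4 / 3))).mul (sx ω ω1 h0 x τ) |>.sub
        ((((K.d0 x τ).mul (K.d1 x τ)).const_mul 2).mul (sx ω1 ω2 h1 x τ)) |>.add
        (((K.d0 x τ).pow 2).mul (sx ω2 ω3 h2 x τ))).congr_deriv ?_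
      simp only [Pi.pow_apply, Pi.add_apply, Pi.sub_apply, Pi.mul_apply]
      push_cast; ring)
    (show Continuous fun p : ℝ × ℝ => (2 * (u p.1 p.2 * uxxx p.1 p.2)
      + 4 * u p.1 p.2 ^ 2 * ux p.1 p.2) * ω (p.1 - c * p.2 - a)
      + (-3 * ux p.1 p.2 ^ 2 + 4 / 3 * u p.1 p.2 ^ 3) * ω1 (p.1 - c * p.2 - a)
      + u p.1 p.2 ^ 2 * ω3 (p.1 - c * p.2 - a) by fun_prop)
    (show Continuous fun p : ℝ × ℝ => (-3 * ux p.1 p.2 ^ 2 + 4 / 3 * u p.1 p.2 ^ 3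
      - c * u p.1 p.2 ^ 2) * ω1 (p.1 - c * p.2 - a)
      + u p.1 p.2 ^ 2 * ω3 (p.1 - c * p.2 - a) by fun_prop)
    (fun x hx τ hτ => by
      simp only [K.eq x hx τ hτ]; ring)
    (fun τ hτ => by
      simp only [K.bd τ hτ]
      have := mul_nonneg (sq_nonneg (ux 0 τ)) (hω0 (0 - c * τ - a))
      nlinarith)
    (hg.const_mul _)
    (fun τ hτ hτt x hx => by
      obtain ⟨b1, b2, b3, b4, b5, b6, b7, b8, b9⟩ := hdom τ hτ hτt x hx
      have g0 : 0 ≤ g x := (abs_nonneg _).trans b1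
      obtain ⟨v0, v1, v2, v3⟩ := hW (x - c * τ - a)
      have u3 : |u x τ ^ 3| ≤ B * g x := by
        have : |u x τ ^ 3| = |u x τ| * u x τ ^ 2 := by rw [abs_pow, ← sq_abs]; ring
        rw [this]; exact mul_le_mul b8 b5 (sq_nonneg _) hB
      have u2 : |u x τ ^ 2| ≤ g x := by rwa [abs_of_nonneg (sq_nonneg _)]
      have ux2 : |ux x τ ^ 2| ≤ g x := by rwa [abs_of_nonneg (sq_nonneg _)]
      have uux : |u x τ * ux x τ| ≤ B * g x := by
        rw [abs_mul]; exact mul_le_mul b8 b2 (abs_nonneg _) hB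
      have uuxx : |u x τ * uxx x τ| ≤ B * g x := by
        rw [abs_mul]; exact mul_le_mul b8 b3 (abs_nonneg _) hB
      have bg : 0 ≤ B * g x := by positivity
      have wg : 0 ≤ g x * W := by positivity
      have wbg : 0 ≤ B * g x * W := by positivity
      have wcg : 0 ≤ |c| * g x * W := by positivity
      have pr : ∀ {A D w : ℝ}, |A| ≤ D → |w| ≤ W → |A * w| ≤ D * W := fun hA hw => by
        rw [abs_mul]; exact mul_le_mul hA hw (abs_nonneg _) ((abs_nonneg _).trans hA)
      have cu2 : |c * u x τ ^ 2| ≤ |c| * g x := by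
        rw [abs_mul]; exact mul_le_mul_of_nonneg_left u2 (abs_nonneg _)
      refine ⟨?_, ?_, ?_⟩
      · have := pr u2 v0
        show |_| ≤ W * (10 + 10 * B + |c|) * g x
        linarith
      · have t1 : |2 * (u x τ * uxx x τ) - ux x τ ^ 2 + 4 / 3 * u x τ ^ 3| ≤
            4 * (B * g x) + g x := by
          have := abs_le.1 u3; have := abs_le.1 ux2; have := abs_le.1 uuxx
          exact abs_le.2 ⟨by linarith, by linarith⟩
        have t2 := abs_le.1 (pr t1 v0)
        have t3 := abs_le.1 (pr uux v1)
        have t4 := abs_le.1 (pr u2 v2)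
        show |_| ≤ W * (10 + 10 * B + |c|) * g x
        exact abs_le.2 ⟨by linarith, by linarith⟩
      · have t1 : |-3 * ux x τ ^ 2 + 4 / 3 * u x τ ^ 3 - c * u x τ ^ 2| ≤
            3 * g x + 4 / 3 * (B * g x) + |c| * g x := by
          have := abs_le.1 u3; have := abs_le.1 ux2; have := abs_le.1 cu2
          exact abs_le.2 ⟨by linarith, by linarith⟩
        have t2 := abs_le.1 (pr t1 v1)
        have t4 := abs_le.1 (pr u2 v3)
        show |_| ≤ W * (10 + 10 * B + |c|) * g x
        exact abs_le.2 ⟨by linarith, by linarith⟩)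
    (fun τ h5 h6 => by
      have := hκ τ h5 h6
      rwa [hl_int u ux τ (fun x p q => (-3 * q ^ 2 + 4 / 3 * p ^ 3 - c * p ^ 2) *
        ω1 (x - c * τ - a) + p ^ 2 * ω3 (x - c * τ - a)) (by simp)] at this)
  rw [hl_int u ux t (fun x p q => p ^ 2 * ω (x - c * t - a)) (by simp),
    hl_int u ux s (fun x p q => p ^ 2 * ω (x - c * s - a)) (by simp)]
  exact key

theorem Kd.mass (K : Kd u ux uxx uxxx ut uxt) {s t : ℝ} (hs : 0 ≤ s) (hst : s ≤ t) :
    fM (hl u t) ≤ fM (hl u s) := by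
  have := K.wmass hs hst (fun _ => 1) (fun _ => 0) (fun _ => 0) (fun _ => 0) 1 0 0 0
    (fun x => zero_le_one) (fun x => hasDerivAt_const _ _) (fun x => hasDerivAt_const _ _)
    (fun x => hasDerivAt_const _ _) continuous_const (fun x => by simp) (fun τ _ _ => by simp)
  simp only [mul_one, zero_mul] at this
  unfold fM
  linarith

theorem Kd.dom' (K : Kd u ux uxx uxxx ut uxt) (T : ℝ) : ∃ G : ℝ → ℝ, Integrable G ∧
    ∀ t, 0 ≤ t → t ≤ T → ∀ x, |hl u t x| ≤ G x ∧ |hl ux t x| ≤ G x ∧ hl u t x ^ 2 ≤ G x ∧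
      hl ux t x ^ 2 ≤ G x := by
  obtain ⟨g, B, hg, hB, hdom⟩ := K.dom T
  refine ⟨(Ioi (0:ℝ)).indicator g, (integrable_indicator_iff measurableSet_Ioi).2 hg, ?_⟩
  intro t ht htT x
  by_cases hx : 0 < x
  · obtain ⟨b1, b2, b3, b4, b5, b6, b7, b8, b9⟩ := hdom t ht htT x hx
    rw [indicator_of_mem (show x ∈ Ioi (0:ℝ) from hx), hl_pos _ _ _ hx, hl_pos _ _ _ hx]
    exact ⟨b1, b2, b5, b6⟩
  · rw [indicator_of_notMem (show x ∉ Ioi (0:ℝ) from hx), hl_neg _ _ _ (not_lt.1 hx),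
      hl_neg _ _ _ (not_lt.1 hx)]
    simp

theorem Kd.meas (K : Kd u ux uxx uxxx ut uxt) (t : ℝ) : AEStronglyMeasurable (hl u t) volume ∧
    AEStronglyMeasurable (hl ux t) volume := by
  have c0 : Continuous fun x : ℝ => u x t := K.c0.comp (continuous_id.prodMk continuous_const)
  have c1 : Continuous fun x : ℝ => ux x t := K.c1.comp (continuous_id.prodMk continuous_const)
  exact ⟨c0.aestronglyMeasurable.indicator measurableSet_Ioi,
    c1.aestronglyMeasurable.indicator measurableSet_Ioi⟩

theorem Kd.int (K : Kd u ux uxx uxxx ut uxt) {t : ℝ} (ht : 0 ≤ t) : Integrable (hl u t) := by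
  obtain ⟨G, hG, hd⟩ := K.dom' t
  exact hG.mono' (K.meas t).1 (Eventually.of_forall fun x => (hd t ht le_rfl x).1)

theorem Kd.H1 (K : Kd u ux uxx uxxx ut uxt) {t : ℝ} (ht : 0 ≤ t) :
    H1f 0 (hl u t) (hl ux t) := by
  obtain ⟨G, hG, hd⟩ := K.dom' t
  have c0 : Continuous fun x : ℝ => u x t := K.c0.comp (continuous_id.prodMk continuous_const)
  refine ⟨?_, ?_, ?_, ?_, ?_, ?_⟩
  · have : hl u t = fun x => u (max x 0) t := by
      funext x
      by_cases hx : 0 < x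
      · rw [hl_pos _ _ _ hx, max_eq_left hx.le]
      · rw [hl_neg _ _ _ (not_lt.1 hx), max_eq_right (not_lt.1 hx), K.bd t ht]
    rw [this]; exact c0.comp (continuous_id.max continuous_const)
  · intro x hx
    rcases lt_or_gt_of_ne hx with h | h
    · rw [hl_neg _ _ _ h.le]
      refine (hasDerivAt_const x (0:ℝ)).congr_of_eventuallyEq ?_
      filter_upwards [Iio_mem_nhds h] with y hy
      exact hl_neg _ _ _ (le_of_lt hy)
    · rw [hl_pos _ _ _ h]
      refine (K.d0 x t).congr_of_eventuallyEq ?_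
      filter_upwards [Ioi_mem_nhds h] with y hy
      exact hl_pos _ _ _ hy
  · refine (memLp_two_iff_integrable_sq (K.meas t).1).2 (hG.mono' ((K.meas t).1.pow 2)
      (Eventually.of_forall fun x => ?_))
    rw [Real.norm_of_nonneg (sq_nonneg _)]; exact (hd t ht le_rfl x).2.2.1
  · refine (memLp_two_iff_integrable_sq (K.meas t).2).2 (hG.mono' ((K.meas t).2.pow 2)
      (Eventually.of_forall fun x => ?_))
    rw [Real.norm_of_nonneg (sq_nonneg _)]; exact (hd t ht le_rfl x).2.2.2
  · refine (K.lim0 t ht).congr' ?_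
    filter_upwards [eventually_gt_atTop 0] with x hx
    exact (hl_pos _ _ _ hx).symm
  · refine tendsto_const_nhds.congr' ?_
    filter_upwards [eventually_le_atBot 0] with x hx
    exact (hl_neg _ _ _ hx).symm

/-- the time slices are continuous in `L²` at each time -/
theorem Kd.L2cont (K : Kd u ux uxx uxxx ut uxt) {t : ℝ} (ht : 0 ≤ t) :
    Tendsto (fun s => ∫ x, (hl u s x - hl u t x) ^ 2) (nhdsWithin t (Ici 0)) (nhds 0) := by
  obtain ⟨G, hG, hd⟩ := K.dom' (t + 1)
  have h00 : ∫ x : ℝ, (hl u t x - hl u t x) ^ 2 = 0 := by simp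
  rw [← congrArg nhds h00]
  refine tendsto_integral_filter_of_dominated_convergence (fun x => 4 * G x) ?_ ?_
    (hG.const_mul 4) ?_
  · exact Eventually.of_forall fun s => ((K.meas s).1.sub (K.meas t).1).pow 2
  · have h1 : ∀ᶠ s in nhdsWithin t (Ici 0), s < t + 1 :=
      eventually_nhdsWithin_of_eventually_nhds (gt_mem_nhds (by linarith))
    filter_upwards [h1, self_mem_nhdsWithin] with s hs hs0
    refine Eventually.of_forall fun x => ?_
    rw [Real.norm_of_nonneg (sq_nonneg _)]
    have e1 := (hd s hs0 hs.le x).2.2.1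
    have e2 := (hd t ht (by linarith) x).2.2.1
    nlinarith [sq_nonneg (hl u s x + hl u t x)]
  · refine Eventually.of_forall fun x => ?_
    have hc : Continuous fun s => hl u s x := by
      by_cases hx : 0 < x
      · simp only [hl_pos _ _ _ hx]
        exact K.c0.comp (continuous_const.prodMk continuous_id)
      · simp only [hl_neg _ _ _ (not_lt.1 hx)]; exact continuous_const
    exact (((hc.sub continuous_const).pow 2).tendsto t).mono_left nhdsWithin_le_nhds
end

theorem dM_tri (k : ℝ) (hk : 0 < k) {f f' : ℝ → ℝ} (hf : MemLp f 2) (hf' : MemLp f' 2) (z : ℝ) :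
    dM k f z ≤ 2 * dM k f' z + 2 * ∫ x, (f x - f' x) ^ 2 := by
  have hs : MemLp (fun x => f (x + z)) 2 :=
    hf.comp_measurePreserving (measurePreserving_add_right volume z)
  have hs' : MemLp (fun x => f' (x + z)) 2 :=
    hf'.comp_measurePreserving (measurePreserving_add_right volume z)
  have hQ := (kQ_H1 k hk 0).f2
  have e1 : ∫ x, (f x - f' x) ^ 2 = ∫ x, (f (x + z) - f' (x + z)) ^ 2 :=
    (integral_add_right_eq_self (fun x => (f x - f' x) ^ 2) z).symm
  unfold dM
  rw [e1]
  have i1 : Integrable (fun x => (f' (x + z) - kQ k x) ^ 2) := (hs'.sub hQ).integrable_sq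
  have i2 : Integrable (fun x => (f (x + z) - f' (x + z)) ^ 2) := (hs.sub hs').integrable_sq
  have i3 : Integrable (fun x => (f (x + z) - kQ k x) ^ 2) := (hs.sub hQ).integrable_sq
  rw [← lin2 2 2 i1 i2]
  refine integral_mono i3 ((i1.const_mul 2).add (i2.const_mul 2)) fun x => ?_
  show (f (x + z) - kQ k x) ^ 2 ≤
    2 * (f' (x + z) - kQ k x) ^ 2 + 2 * (f (x + z) - f' (x + z)) ^ 2
  nlinarith [sq_nonneg ((f' (x + z) - kQ k x) - (f (x + z) - f' (x + z)))]

theorem dM_le_dH (k : ℝ) (f g : ℝ → ℝ) (z : ℝ) : dM k f z ≤ dH k f g z := by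
  unfold dM dH
  have : 0 ≤ ∫ x, (g (x + z) - kD k x) ^ 2 := integral_nonneg fun x => sq_nonneg _
  linarith

section
variable {u ux uxx uxxx ut uxt : ℝ → ℝ → ℝ}

theorem Kd.boot (K : Kd u ux uxx uxxx ut uxt) (k : ℝ) (hk : 0 < k) (ε b : ℝ) (hε : 0 < ε)
    (hb : b ≤ ε ^ 2 / 4)
    (himp : ∀ t, 0 ≤ t → (∃ z, dM k (hl u t) z ≤ ε ^ 2) → ∃ z, dH k (hl u t) (hl ux t) z ≤ b)
    (h0 : ∃ z, dM k (hl u 0) z ≤ ε ^ 2) :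
    ∀ t, 0 ≤ t → ∃ z, dH k (hl u t) (hl ux t) z ≤ b := by
  have step : ∀ s t, 0 ≤ s → 0 ≤ t → (∃ z, dM k (hl u s) z ≤ ε ^ 2) →
      ∫ x, (hl u t x - hl u s x) ^ 2 < ε ^ 2 / 4 → ∃ z, dM k (hl u t) z ≤ ε ^ 2 := by
    intro s t hs ht hz hd
    obtain ⟨z, hz⟩ := himp s hs hz
    refine ⟨z, ?_⟩
    have h1 := dM_tri k hk (K.H1 ht).f2 (K.H1 hs).f2 z
    have h2 := dM_le_dH k (hl u s) (hl ux s) z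
    linarith
  have hsym : ∀ s t, ∫ x, (hl u t x - hl u s x) ^ 2 = ∫ x, (hl u s x - hl u t x) ^ 2 := by
    intro s t; congr 1; funext x; ring
  have hnear : ∀ t, 0 ≤ t → ∀ᶠ s in nhds t, s ∈ Ici (0:ℝ) →
      ∫ x, (hl u s x - hl u t x) ^ 2 < ε ^ 2 / 4 := fun t ht =>
    eventually_nhdsWithin_iff.1 ((K.L2cont ht).eventually (gt_mem_nhds (by positivity)))
  intro T hT
  apply himp T hT
  have hcl : IsClosed ({t | ∃ z, dM k (hl u t) z ≤ ε ^ 2} ∩ Icc 0 T) := by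
    refine isClosed_of_closure_subset fun t ht => ?_
    have htI : t ∈ Icc 0 T := by
      have := closure_mono inter_subset_right ht
      rwa [isClosed_Icc.closure_eq] at this
    obtain ⟨s, hs, hs'⟩ := ((mem_closure_iff_frequently.1 ht).and_eventually
      (hnear t htI.1)).exists
    refine ⟨step s t hs.2.1 htI.1 hs.1 ?_, htI⟩
    rw [hsym]; exact hs' hs.2.1
  refine hcl.Icc_subset_of_forall_exists_gt h0 ?_ (right_mem_Icc.2 hT)
  intro t ht y hy
  have hy : t < y := hy
  have h1 : ∀ᶠ s in nhdsWithin t (Ioi t), s ∈ Ioc t y ∧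
      (s ∈ Ici (0:ℝ) → ∫ x, (hl u s x - hl u t x) ^ 2 < ε ^ 2 / 4) :=
    Filter.Eventually.and (Ioc_mem_nhdsGT hy)
      ((hnear t ht.2.1).filter_mono nhdsWithin_le_nhds)
  obtain ⟨s, hs, hs'⟩ := h1.exists
  have hs0 : 0 ≤ s := ht.2.1.trans hs.1.le
  exact ⟨s, step t s ht.2.1 hs0 ht.1 (hs' hs0), hs⟩
end

theorem kQ_exp (k : ℝ) (y : ℝ) : kQ k y ≤ 24 * k ^ 2 * Real.exp (2 * k * y) := by
  unfold kQ
  rw [kS_eq]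
  have h1 : Real.exp (-(k * y)) / 2 ≤ Real.cosh (k * y) := by
    rw [Real.cosh_eq]; linarith [Real.exp_pos (k * y)]
  have h2 : (Real.exp (-(k * y)) / 2) ^ 2 ≤ Real.cosh (k * y) ^ 2 :=
    pow_le_pow_left₀ (by positivity) h1 2
  have h3 : 1 / Real.cosh (k * y) ^ 2 ≤ 4 * Real.exp (2 * k * y) := by
    rw [div_le_iff₀ (by positivity)]
    have e1 : Real.exp (2 * k * y) * Real.exp (-(k * y)) ^ 2 = 1 := by
      rw [← Real.exp_nat_mul, ← Real.exp_add]
      rw [show 2 * k * y + ((2:ℕ):ℝ) * -(k * y) = 0 by push_cast; ring, Real.exp_zero]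
    have := mul_le_mul_of_nonneg_left h2 (Real.exp_pos (2 * k * y)).le
    nlinarith
  nlinarith [sq_nonneg k]

theorem tailQ (k : ℝ) (hk : 0 < k) (L : ℝ) :
    ∫ x in Iic 0, kQ k (x - L) ^ 2 ≤ 144 * k ^ 3 * Real.exp (-(4 * k * L)) := by
  have h1 : ∀ x : ℝ, kQ k (x - L) ^ 2 ≤ (576 * k ^ 4 * Real.exp (-(4 * k * L))) * Real.exp (4 * k * x) := by
    intro x
    have h := pow_le_pow_left₀ (kQ_pos k hk (x - L)).le (kQ_exp k (x - L)) 2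
    have e1 : (24 * k ^ 2 * Real.exp (2 * k * (x - L))) ^ 2 =
        (576 * k ^ 4 * Real.exp (-(4 * k * L))) * Real.exp (4 * k * x) := by
      rw [mul_pow, ← Real.exp_nat_mul, mul_assoc (576 * k ^ 4), ← Real.exp_add]
      rw [show ((2:ℕ):ℝ) * (2 * k * (x - L)) = -(4 * k * L) + 4 * k * x by push_cast; ring]
      ring
    linarith
  have i1 : IntegrableOn (fun x : ℝ => Real.exp (4 * k * x)) (Iic 0) :=
    integrableOn_exp_mul_Iic (by positivity) 0
  have i2 : Integrable (fun x => kQ k (x - L) ^ 2) := by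
    have := ((kQ_H1 k hk 0).shift (-L)).f2.integrable_sq
    simpa only [← sub_eq_add_neg] using this
  calc ∫ x in Iic 0, kQ k (x - L) ^ 2
      ≤ ∫ x in Iic 0, (576 * k ^ 4 * Real.exp (-(4 * k * L))) * Real.exp (4 * k * x) :=
        setIntegral_mono_on i2.integrableOn (i1.const_mul _) measurableSet_Iic fun x _ => h1 x
    _ = 144 * k ^ 3 * Real.exp (-(4 * k * L)) := by
        rw [integral_const_mul, integral_exp_mul_Iic (by positivity)]
        rw [mul_zero, Real.exp_zero]
        field_simp
        ring

section
variable {u ux uxx uxxx ut uxt : ℝ → ℝ → ℝ}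

theorem Kd.dH_hl (K : Kd u ux uxx uxxx ut uxt) (k : ℝ) (hk : 0 < k) {t : ℝ} (ht : 0 ≤ t) (z : ℝ) :
    dH k (hl u t) (hl ux t) z =
      (∫ x in Iic 0, (kQ k (x - z) ^ 2 + kD k (x - z) ^ 2)) +
      ∫ x in Ioi 0, ((u x t - kQ k (x - z)) ^ 2 + (ux x t - kD k (x - z)) ^ 2) := by
  have h := K.H1 ht
  have hq : H1f 0 (fun x => kQ k (x - z)) (fun x => kD k (x - z)) := by
    have := (kQ_H1 k hk (0 + -z)).shift (-z)
    simpa only [← sub_eq_add_neg, add_sub_cancel_right, sub_self, zero_sub] using this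
  have hs := h.sub hq
  have e1 : ∫ x, (hl u t (x + z) - kQ k x) ^ 2 = ∫ x, (hl u t x - kQ k (x - z)) ^ 2 := by
    rw [← integral_add_right_eq_self (fun x => (hl u t x - kQ k (x - z)) ^ 2) z]
    simp only [add_sub_cancel_right]
  have e2 : ∫ x, (hl ux t (x + z) - kD k x) ^ 2 = ∫ x, (hl ux t x - kD k (x - z)) ^ 2 := by
    rw [← integral_add_right_eq_self (fun x => (hl ux t x - kD k (x - z)) ^ 2) z]
    simp only [add_sub_cancel_right]
  have i1 := hs.f2.integrable_sq
  have i2 := hs.g2.integrable_sq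
  have i3 : Integrable (fun x => (hl u t x - kQ k (x - z)) ^ 2 + (hl ux t x - kD k (x - z)) ^ 2) :=
    i1.add i2
  unfold dH
  rw [e1, e2, ← integral_add i1 i2,
    ← intervalIntegral.integral_Iic_add_Ioi (b := 0) i3.integrableOn i3.integrableOn]
  congr 1
  · refine setIntegral_congr_fun measurableSet_Iic fun x hx => ?_
    simp only [hl_neg _ _ x hx, zero_sub, neg_sq]
  · refine setIntegral_congr_fun measurableSet_Ioi fun x hx => ?_
    simp only [hl_pos _ _ x hx]

theorem init_dH (k : ℝ) (hk : 0 < k) : ∃ K0 : ℝ, 0 < K0 ∧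
    ∀ (u ux uxx uxxx ut uxt : ℝ → ℝ → ℝ), Kd u ux uxx uxxx ut uxt → ∀ α L : ℝ, 0 < α →
    ∫ x in Ioi 0, ((u x 0 - kQ k (x - L)) ^ 2 + (ux x 0 - kD k (x - L)) ^ 2) ≤ α ^ 2 →
    dH k (hl u 0) (hl ux 0) L ≤ K0 * (α + Real.exp (-(2 * k * L))) ^ 2 := by
  refine ⟨1 + (1 + 4 * k ^ 2) * (144 * k ^ 3), by positivity, ?_⟩
  intro u ux uxx uxxx ut uxt K α L hα h
  rw [K.dH_hl k hk le_rfl L]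
  have hq : H1f 0 (fun x => kQ k (x - L)) (fun x => kD k (x - L)) := by
    have := (kQ_H1 k hk (0 + -L)).shift (-L)
    simpa only [← sub_eq_add_neg, add_sub_cancel_right, sub_self, zero_sub] using this
  have i1 := hq.f2.integrable_sq
  have i2 := hq.g2.integrable_sq
  have h1 : ∫ x in Iic 0, (kQ k (x - L) ^ 2 + kD k (x - L) ^ 2) ≤
      ∫ x in Iic 0, (1 + 4 * k ^ 2) * kQ k (x - L) ^ 2 := by
    refine setIntegral_mono_on (i1.add i2).integrableOn (i1.const_mul _).integrableOn
      measurableSet_Iic fun x _ => ?_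
    have := pow_le_pow_left₀ (abs_nonneg _) (kD_abs k hk (x - L)) 2
    rw [sq_abs] at this
    nlinarith
  rw [integral_const_mul] at h1
  have h2 := tailQ k hk L
  have h3 : Real.exp (-(4 * k * L)) = Real.exp (-(2 * k * L)) ^ 2 := by
    rw [← Real.exp_nat_mul]; congr 1; push_cast; ring
  rw [h3] at h2
  have h4 := Real.exp_pos (-(2 * k * L))
  set E := Real.exp (-(2 * k * L))
  have h5 : (1 + 4 * k ^ 2) * (∫ x in Iic 0, kQ k (x - L) ^ 2) ≤
      (1 + 4 * k ^ 2) * (144 * k ^ 3 * E ^ 2) := mul_le_mul_of_nonneg_left h2 (by positivity)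
  have h6 : α ^ 2 ≤ (α + E) ^ 2 := pow_le_pow_left₀ hα.le (by linarith) 2
  have h7 : E ^ 2 ≤ (α + E) ^ 2 := pow_le_pow_left₀ h4.le (by linarith) 2
  have h8 : (1 + 4 * k ^ 2) * (144 * k ^ 3) * E ^ 2 ≤
      (1 + 4 * k ^ 2) * (144 * k ^ 3) * (α + E) ^ 2 := mul_le_mul_of_nonneg_left h7 (by positivity)
  linarith

end

/-- closeness gives upper bounds for the invariants -/
theorem init_inv (k : ℝ) (hk : 0 < k) (K0 : ℝ) (hK0 : 0 < K0) : ∃ K1 : ℝ, 0 < K1 ∧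
    ∀ (e : ℝ) (f g : ℝ → ℝ), H1f e f g → ∀ (z δ : ℝ), 0 < δ → δ ≤ 2 → dH k f g z ≤ K0 * δ ^ 2 →
    |fM f - fM (kQ k)| ≤ K1 * δ ∧ fE f g ≤ fE (kQ k) (kD k) + K1 * δ ∧
    fE f g + 2 * k ^ 2 * fM f ≤ fE (kQ k) (kD k) + 2 * k ^ 2 * fM (kQ k) + K1 * δ ^ 2 := by
  have hq0 : 0 < fM (kQ k) := Qsq_pos k hk
  obtain ⟨q, hq⟩ : ∃ q, q = fM (kQ k) := ⟨_, rfl⟩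
  rw [← hq] at hq0
  obtain ⟨r, hr⟩ : ∃ r, r = K0 + q := ⟨_, rfl⟩
  obtain ⟨r', hr'⟩ : ∃ r', r' = K0 + 1 := ⟨_, rfl⟩
  have hrp : 0 < r := by rw [hr]; positivity
  have hrp' : 0 < r' := by rw [hr']; positivity
  refine ⟨2 * r + 2 * K0 + 4 * k ^ 2 * r + 2 * k ^ 2 * K0 + K0 + 2 * K0 * r', by positivity, ?_⟩
  intro e f g h z δ hδ hδ2 hd
  have hs := h.shift z
  have eM : fM (fun x => f (x + z)) = fM f := by
    unfold fM; exact integral_add_right_eq_self (fun x => f x ^ 2) z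
  have eE : fE (fun x => f (x + z)) (fun x => g (x + z)) = fE f g := by
    unfold fE; exact integral_add_right_eq_self (fun x => 1 / 2 * g x ^ 2 - 1 / 3 * f x ^ 3) z
  have e1 := expM k hk hs
  have e2 := expE k hk hs
  have hη := hs.sub (kQ_H1 k hk (e - z))
  have hcs := cs_int hη.f2 (kQ_H1 k hk (e - z)).f2
  have hQ2 := Qsq_mul k hk hη.f2.integrable_sq
  have hB : 0 ≤ ∫ x, kQ k x * (f (x + z) - kQ k x) ^ 2 :=
    integral_nonneg fun x => mul_nonneg (kQ_pos k hk x).le (sq_nonneg _)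
  have hm0 : 0 ≤ ∫ x, (f (x + z) - kQ k x) ^ 2 := integral_nonneg fun x => sq_nonneg _
  have hG0 : 0 ≤ ∫ x, (g (x + z) - kD k x) ^ 2 := integral_nonneg fun x => sq_nonneg _
  have hcube := hη.cube_le (r' * δ) (by positivity) (by
    unfold dH at hd
    rw [hr']
    nlinarith [sq_nonneg δ, mul_pos hK0 (pow_pos hδ 2), mul_pos (mul_pos hK0 hK0) (pow_pos hδ 2)])
  rw [eM] at e1
  rw [eE] at e2
  have hqq : ∫ x, kQ k x ^ 2 = q := by rw [hq]; rfl
  rw [hqq] at hcs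
  rw [← hq] at *
  unfold dH at hd
  rw [e1, e2]
  clear e1 e2 eM eE hs hη hQ2
  generalize (∫ x, (f (x + z) - kQ k x) ^ 2) = m at *
  generalize (∫ x, (g (x + z) - kD k x) ^ 2) = G at *
  generalize (∫ x, (f (x + z) - kQ k x) ^ 3) = T at *
  generalize (∫ x, kQ k x * (f (x + z) - kQ k x) ^ 2) = B at *
  generalize (∫ x, (f (x + z) - kQ k x) * kQ k x) = s at *
  have hs2 : |s| ≤ r * δ := by
    apply abs_le_of_sq_le_sq _ (by positivity)
    have : m * q ≤ K0 * δ ^ 2 * q := mul_le_mul_of_nonneg_right (by linarith) hq0.le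
    have h3 : K0 * q ≤ r ^ 2 := by rw [hr]; nlinarith
    have h4 := mul_le_mul_of_nonneg_right h3 (sq_nonneg δ)
    nlinarith
  have hT : |T| ≤ r' * K0 * δ ^ 2 * 2 := by
    have h5 : r' * δ * (m + G) ≤ r' * δ * (K0 * δ ^ 2) :=
      mul_le_mul_of_nonneg_left hd (by positivity)
    have h6 : r' * δ * (K0 * δ ^ 2) ≤ r' * 2 * (K0 * δ ^ 2) := by gcongr
    linarith
  have hT := abs_le.1 hT
  have hs2 := abs_le.1 hs2
  have hδδ : δ ^ 2 ≤ 2 * δ := by nlinarith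
  have k2 : 0 ≤ k ^ 2 := sq_nonneg k
  have a1 : K0 * δ ^ 2 ≤ K0 * (2 * δ) := mul_le_mul_of_nonneg_left hδδ hK0.le
  have a2 : r' * K0 * δ ^ 2 ≤ r' * K0 * (2 * δ) := mul_le_mul_of_nonneg_left hδδ (by positivity)
  have a3 : 4 * k ^ 2 * (-s) ≤ 4 * k ^ 2 * (r * δ) :=
    mul_le_mul_of_nonneg_left (by linarith [hs2.1]) (by positivity)
  have p1 : 0 ≤ r * δ := by positivity
  have p2 : 0 ≤ K0 * δ := by positivity
  have p3 : 0 ≤ k ^ 2 * r * δ := by positivity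
  have p4 : 0 ≤ k ^ 2 * K0 * δ := by positivity
  have p5 : 0 ≤ K0 * r' * δ := by positivity
  have p6 : 0 ≤ r * δ ^ 2 := by positivity
  have p7 : 0 ≤ K0 * δ ^ 2 := by positivity
  have p8 : 0 ≤ k ^ 2 * r * δ ^ 2 := by positivity
  have p9 : 0 ≤ k ^ 2 * K0 * δ ^ 2 := by positivity
  have p10 : 0 ≤ K0 * r' * δ ^ 2 := by positivity
  refine ⟨abs_le.2 ⟨?_, ?_⟩, ?_, ?_⟩
  · linarith [hs2.1, hs2.2]
  · linarith [hs2.1, hs2.2]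
  · linarith [hs2.1, hs2.2, hT.1, hT.2]
  · have a4 : 2 * k ^ 2 * m ≤ 2 * k ^ 2 * (K0 * δ ^ 2) :=
      mul_le_mul_of_nonneg_left (by linarith) (by positivity)
    linarith [hs2.1, hs2.2, hT.1, hT.2]

/-- weight derivative -/
noncomputable def kw1 (k y : ℝ) : ℝ := k * kS k y
/-- second derivative of the weight -/
noncomputable def kw2 (k y : ℝ) : ℝ := -(2 * k ^ 2) * (kT k y * kS k y)
/-- third derivative of the weight -/
noncomputable def kw3 (k y : ℝ) : ℝ := -(2 * k ^ 3) * (kS k y ^ 2 - 2 * (kT k y ^ 2 * kS k y))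

theorem kw1_deriv (k y : ℝ) : HasDerivAt (kw1 k) (kw2 k y) y := by
  refine ((kS_deriv k y).const_mul k).congr_deriv ?_
  unfold kw2; ring
theorem kw2_deriv (k y : ℝ) : HasDerivAt (kw2 k) (kw3 k y) y := by
  refine (((kT_deriv k y).mul (kS_deriv k y)).const_mul (-(2 * k ^ 2))).congr_deriv ?_
  unfold kw3; ring
theorem kw1_cont (k : ℝ) : Continuous (kw1 k) :=
  continuous_iff_continuousAt.2 fun y => (kw1_deriv k y).continuousAt
theorem kw2_cont (k : ℝ) : Continuous (kw2 k) :=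
  continuous_iff_continuousAt.2 fun y => (kw2_deriv k y).continuousAt
theorem kw3_cont (k : ℝ) : Continuous (kw3 k) := by
  have h1 := kT_cont k
  have h2 := kS_cont k
  unfold kw3; fun_prop

/-- common bound of the weights -/
noncomputable def kWb (k : ℝ) : ℝ := 2 + k + 2 * k ^ 2 + 6 * k ^ 3

theorem kw_bound (k : ℝ) (hk : 0 < k) (y : ℝ) :
    |kT k y| ≤ 1 ∧ |kw1 k y| ≤ kWb k ∧ |kw2 k y| ≤ kWb k ∧ |kw3 k y| ≤ kWb k := by
  have h1 := (kT_abs k y).le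
  have h2 := (kS_pos k y).le
  have h3 := kS_le k y
  have p2 : 0 < k ^ 2 := by positivity
  have p3 : 0 < k ^ 3 := by positivity
  have t2 : kT k y ^ 2 ≤ 1 := by rw [← sq_abs]; exact pow_le_one₀ (abs_nonneg _) h1
  have hTS : |kT k y * kS k y| ≤ 1 := by
    rw [abs_mul, abs_of_nonneg h2]; exact mul_le_one₀ h1 h2 h3
  refine ⟨h1, ?_, ?_, ?_⟩
  · unfold kw1 kWb; rw [abs_mul, abs_of_pos hk, abs_of_nonneg h2]; nlinarith
  · unfold kw2 kWb; rw [abs_mul, abs_neg, abs_of_pos (by positivity : 0 < 2 * k ^ 2)]; nlinarith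
  · unfold kw3 kWb; rw [abs_mul, abs_neg, abs_of_pos (by positivity : 0 < 2 * k ^ 3)]
    have a1 : kS k y ^ 2 ≤ 1 := pow_le_one₀ h2 h3
    have a2 : kT k y ^ 2 * kS k y ≤ 1 := mul_le_one₀ t2 h2 h3
    have a3 : 0 ≤ kT k y ^ 2 * kS k y := mul_nonneg (sq_nonneg _) h2
    have : |kS k y ^ 2 - 2 * (kT k y ^ 2 * kS k y)| ≤ 3 :=
      abs_le.2 ⟨by nlinarith [sq_nonneg (kS k y)], by linarith⟩
    nlinarith

theorem flux_Q (k : ℝ) (hk : 0 < k) (θ : ℝ) :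
    ∫ x, ((-3 * kD k x ^ 2 + 4 / 3 * kQ k x ^ 3 - 4 * k ^ 2 * kQ k x ^ 2) * kw1 k (x + θ)
      + kQ k x ^ 2 * kw3 k (x + θ)) = 0 := by
  have sx : ∀ (f f' : ℝ → ℝ), (∀ x, HasDerivAt f (f' x) x) → ∀ x : ℝ,
      HasDerivAt (fun y => f (y + θ)) (f' (x + θ)) x := fun f f' hf x =>
    (hf (x + θ)).comp_add_const x θ
  have hQ := kQ_H1 k hk 0
  have hQc := kQ_cont k
  have hDc := kD_cont k
  have h1c := kw1_cont k
  have h2c := kw2_cont k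
  have h3c := kw3_cont k
  have hbd : ∀ (l : Filter ℝ) (f w : ℝ → ℝ), Tendsto f l (nhds 0) → (∀ x, |w x| ≤ kWb k) →
      Tendsto (fun x => f x * w x) l (nhds 0) := by
    intro l f w hf hw
    have h0 : Tendsto (fun x => |f x| * kWb k) l (nhds 0) := by
      simpa using hf.abs.mul_const (kWb k)
    refine squeeze_zero_norm (fun x => ?_) h0
    rw [Real.norm_eq_abs, abs_mul]
    exact mul_le_mul_of_nonneg_left (hw x) (abs_nonneg _)
  have lim : ∀ l : Filter ℝ, Tendsto (kQ k) l (nhds 0) → Tendsto (kD k) l (nhds 0) →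
      Tendsto (fun x => -(2 * (kQ k x * kD k x)) * kw1 k (x + θ) + kQ k x ^ 2 * kw2 k (x + θ)) l
        (nhds 0) := by
    intro l t1 t2
    have b1 : Tendsto (fun x => -(2 * (kQ k x * kD k x)) * kw1 k (x + θ)) l (nhds 0) := by
      refine hbd l _ _ ?_ (fun x => (kw_bound k hk (x + θ)).2.1)
      simpa using ((t1.mul t2).const_mul 2).neg
    have b2 : Tendsto (fun x => kQ k x ^ 2 * kw2 k (x + θ)) l (nhds 0) := by
      refine hbd l _ _ ?_ (fun x => (kw_bound k hk (x + θ)).2.2.1)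
      simpa using t1.pow 2
    simpa using b1.add b2
  refine ftc_line 0 (fun x => -(2 * (kQ k x * kD k x)) * kw1 k (x + θ)
    + kQ k x ^ 2 * kw2 k (x + θ)) _ (by fun_prop) (fun x _ => ?_) ?_ (lim _ hQ.top (kD_H1 k hk 0).top)
    (lim _ hQ.bot (kD_H1 k hk 0).bot)
  · refine (((((kQ_deriv k x).mul (kD_deriv k x)).const_mul 2).neg.mul
      (sx _ _ (kw1_deriv k) x)).add
      (((kQ_deriv k x).pow 2).mul (sx _ _ (kw2_deriv k) x))).congr_deriv ?_
    simp only [Pi.pow_apply, Pi.mul_apply, Pi.neg_apply]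
    unfold kE kD kQ kS
    push_cast; ring
  · have i1 := int_bdd_mul hQ.f2.integrable_sq (show Continuous fun x => kw3 k (x + θ) by fun_prop)
      _ (fun x => (kw_bound k hk (x + θ)).2.2.2)
    have i2 := int_bdd_mul (((hQ.g2.integrable_sq.const_mul (-3)).add (hQ.cube.const_mul (4 / 3))).sub
      (hQ.f2.integrable_sq.const_mul (4 * k ^ 2))) (show Continuous fun x => kw1 k (x + θ) by fun_prop)
      _ (fun x => (kw_bound k hk (x + θ)).2.1)
    refine (i2.add i1).congr (Eventually.of_forall fun x => ?_)
    simp only [Pi.add_apply, Pi.sub_apply]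
    ring

theorem stat_pt (k η ζ Q D ν : ℝ) (hν : 0 < ν) (hν1 : ν ≤ 1) (hη : |η| ≤ 1)
    (hQ : 0 ≤ Q) (hQb : Q ≤ 6 * k ^ 2) (w1 w3 W : ℝ) (hw1 : |w1| ≤ W) (hw3 : |w3| ≤ W) :
    |((-3 * (D + ζ) ^ 2 + 4 / 3 * (Q + η) ^ 3 - 4 * k ^ 2 * (Q + η) ^ 2) * w1
      + (Q + η) ^ 2 * w3) - ((-3 * D ^ 2 + 4 / 3 * Q ^ 3 - 4 * k ^ 2 * Q ^ 2) * w1 + Q ^ 2 * w3)|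
    ≤ (10 + 50 * k ^ 2) * W * ((η ^ 2 + ζ ^ 2) / ν + ν * (Q ^ 2 + D ^ 2)) := by
  obtain ⟨X, hX⟩ : ∃ X, X = (η ^ 2 + ζ ^ 2) / ν + ν * (Q ^ 2 + D ^ 2) := ⟨_, rfl⟩
  rw [← hX]
  have amgm : ∀ a b : ℝ, 2 * |a * b| ≤ a ^ 2 / ν + ν * b ^ 2 := by
    intro a b
    have h1 : (a ^ 2 / ν + ν * b ^ 2) * ν = a ^ 2 + (ν * b) ^ 2 := by field_simp
    have h2 : 2 * |a * b| * ν ≤ a ^ 2 + (ν * b) ^ 2 := by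
      have h3 := sq_nonneg (|a| - ν * |b|)
      rw [abs_mul, ← sq_abs a, mul_pow, ← sq_abs b]
      linarith
    rw [← h1] at h2
    exact le_of_mul_le_mul_right h2 hν
  have sqle : ∀ a : ℝ, a ^ 2 ≤ a ^ 2 / ν := by
    intro a; rw [le_div_iff₀ hν]; nlinarith [sq_nonneg a]
  have eX : X = η ^ 2 / ν + ν * Q ^ 2 + (ζ ^ 2 / ν + ν * D ^ 2) := by rw [hX]; ring
  have z1 : 0 ≤ η ^ 2 / ν := by positivity
  have z2 : 0 ≤ ζ ^ 2 / ν := by positivity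
  have z3 : 0 ≤ ν * Q ^ 2 := by positivity
  have z4 : 0 ≤ ν * D ^ 2 := by positivity
  have hX0 : 0 ≤ X := by rw [eX]; positivity
  have a1 := amgm η Q
  have a2 := amgm ζ D
  have a3 := sqle η
  have a4 := sqle ζ
  have b1 := abs_le.1 (le_refl |η * Q|)
  have b2 := abs_le.1 (le_refl |ζ * D|)
  have c1 : |ζ ^ 2 + 2 * (ζ * D)| ≤ 2 * X :=
    abs_le.2 ⟨by linarith [sq_nonneg ζ], by linarith [sq_nonneg ζ]⟩
  have c2 : |η ^ 2 + 2 * (η * Q)| ≤ 2 * X :=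
    abs_le.2 ⟨by linarith [sq_nonneg η], by linarith [sq_nonneg η]⟩
  have hη2 : η ^ 2 ≤ X := by linarith
  have k2 := sq_nonneg k
  have c3 : |η ^ 3 + 3 * (η ^ 2 * Q) + 3 * (η * Q * Q)| ≤ X + 27 * k ^ 2 * X := by
    have e1 : |η ^ 3| ≤ X := by
      have : |η ^ 3| = |η| * η ^ 2 := by rw [abs_pow, ← sq_abs]; ring
      rw [this]; nlinarith [sq_nonneg η]
    have e2 : |η ^ 2 * Q| ≤ 6 * k ^ 2 * X := by
      rw [abs_of_nonneg (by positivity), mul_comm]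
      exact mul_le_mul hQb hη2 (sq_nonneg _) (by positivity)
    have e3 : |η * Q * Q| ≤ X / 2 * (6 * k ^ 2) := by
      rw [abs_mul, abs_of_nonneg hQ]
      exact mul_le_mul (by linarith) hQb hQ (by linarith)
    have e1 := abs_le.1 e1
    have e2 := abs_le.1 e2
    have e3 := abs_le.1 e3
    exact abs_le.2 ⟨by linarith, by linarith⟩
  have c4 : |-3 * (ζ ^ 2 + 2 * (ζ * D)) + 4 / 3 * (η ^ 3 + 3 * (η ^ 2 * Q) + 3 * (η * Q * Q))
      - 4 * k ^ 2 * (η ^ 2 + 2 * (η * Q))| ≤ (8 + 44 * k ^ 2) * X := by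
    have e4 : |4 * k ^ 2 * (η ^ 2 + 2 * (η * Q))| ≤ 4 * k ^ 2 * (2 * X) := by
      rw [abs_mul, abs_of_nonneg (by positivity : 0 ≤ 4 * k ^ 2)]
      exact mul_le_mul_of_nonneg_left c2 (by positivity)
    have c1 := abs_le.1 c1
    have c3 := abs_le.1 c3
    have e4 := abs_le.1 e4
    have : 0 ≤ k ^ 2 * X := by positivity
    exact abs_le.2 ⟨by linarith, by linarith⟩
  have d1 := mul_le_mul c4 hw1 (abs_nonneg _) ((abs_nonneg _).trans c4)
  have d2 := mul_le_mul c2 hw3 (abs_nonneg _) ((abs_nonneg _).trans c2)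
  rw [← abs_mul] at d1 d2
  have d1 := abs_le.1 d1
  have d2 := abs_le.1 d2
  have hW : 0 ≤ W := (abs_nonneg _).trans hw1
  have f1 : 0 ≤ X * W := by positivity
  have f2 : 0 ≤ k ^ 2 * (X * W) := by positivity
  exact abs_le.2 ⟨by linarith, by linarith⟩

theorem hT_mvt (k : ℝ) (hk : 0 < k) : ∃ m : ℝ, 0 < m ∧ ∀ a b : ℝ, -2 ≤ a → a ≤ b → b ≤ 2 →
    m * (b - a) ≤ kT k b - kT k a := by
  refine ⟨k * kS k 2, mul_pos hk (kS_pos k 2), fun a b ha hab hb => ?_⟩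
  refine (convex_Icc (-2:ℝ) 2).mul_sub_le_image_sub_of_le_deriv (kT_cont k).continuousOn
    (fun x _ => (kT_deriv k x).differentiableAt.differentiableWithinAt) ?_ a ⟨ha, hab.trans hb⟩ b
    ⟨ha.trans hab, hb⟩ hab
  intro x hx
  have hx := interior_subset hx
  rw [(kT_deriv k x).deriv]
  refine mul_le_mul_of_nonneg_left ?_ hk.le
  rw [kS_eq, kS_eq]
  apply one_div_le_one_div_of_le (by positivity)
  apply pow_le_pow_left₀ (Real.cosh_pos _).le
  rw [Real.cosh_le_cosh, abs_mul, abs_mul]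
  exact mul_le_mul_of_nonneg_left ((abs_le.2 ⟨hx.1, hx.2⟩).trans (le_abs_self _)) (abs_nonneg _)

/-- the density of the localized mass flux -/
noncomputable def flx (k p r w1 w3 : ℝ) : ℝ :=
  (-3 * r ^ 2 + 4 / 3 * p ^ 3 - 4 * k ^ 2 * p ^ 2) * w1 + p ^ 2 * w3

theorem flx_int {e : ℝ} {f g : ℝ → ℝ} (k : ℝ) (h : H1f e f g) (w1 w3 : ℝ → ℝ) (W : ℝ)
    (c1 : Continuous w1) (c3 : Continuous w3) (b1 : ∀ x, |w1 x| ≤ W) (b3 : ∀ x, |w3 x| ≤ W) :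
    Integrable (fun x => flx k (f x) (g x) (w1 x) (w3 x)) := by
  have i1 := int_bdd_mul h.f2.integrable_sq c3 _ b3
  have i2 := int_bdd_mul (((h.g2.integrable_sq.const_mul (-3)).add (h.cube.const_mul (4 / 3))).sub
    (h.f2.integrable_sq.const_mul (4 * k ^ 2))) c1 _ b1
  refine (i2.add i1).congr (Eventually.of_forall fun x => ?_)
  simp only [Pi.add_apply, Pi.sub_apply]
  unfold flx
  ring

theorem stat (k : ℝ) (hk : 0 < k) : ∃ C : ℝ, 0 < C ∧ ∀ (e : ℝ) (f g : ℝ → ℝ), H1f e f g →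
    ∀ z ν : ℝ, 0 < ν → ν ≤ 1 → dH k f g z ≤ ν ^ 2 → ∀ (w1 w3 : ℝ → ℝ) (W : ℝ),
    Continuous w1 → Continuous w3 → (∀ x, |w1 x| ≤ W) → (∀ x, |w3 x| ≤ W) →
    |(∫ x, flx k (f x) (g x) (w1 x) (w3 x))
      - ∫ x, flx k (kQ k x) (kD k x) (w1 (x + z)) (w3 (x + z))| ≤ C * W * ν := by
  have hQ2 := Qsq_pos k hk
  have hD2 := Dsq_pos k hk
  refine ⟨(10 + 50 * k ^ 2) * (1 + ((∫ x, kQ k x ^ 2) + ∫ x, kD k x ^ 2)), by positivity, ?_⟩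
  intro e f g h z ν hν hν1 hd w1 w3 W c1 c3 b1 b3
  have hs := h.shift z
  have hQ := kQ_H1 k hk (e - z)
  have hη := hs.sub hQ
  have sc : ∀ w : ℝ → ℝ, Continuous w → Continuous fun x => w (x + z) := fun w hw =>
    hw.comp (continuous_id.add continuous_const)
  have i1 := flx_int k hs _ _ W (sc w1 c1) (sc w3 c3) (fun x => b1 (x + z)) (fun x => b3 (x + z))
  have i2 := flx_int k hQ _ _ W (sc w1 c1) (sc w3 c3) (fun x => b1 (x + z)) (fun x => b3 (x + z))
  have e1 : ∫ x, flx k (f x) (g x) (w1 x) (w3 x) =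
      ∫ x, flx k (f (x + z)) (g (x + z)) (w1 (x + z)) (w3 (x + z)) :=
    (integral_add_right_eq_self (fun x => flx k (f x) (g x) (w1 x) (w3 x)) z).symm
  have hW : 0 ≤ W := (abs_nonneg _).trans (b1 0)
  rw [e1, ← integral_sub i1 i2]
  have j1 := hη.f2.integrable_sq
  have j2 := hη.g2.integrable_sq
  have j3 := hQ.f2.integrable_sq
  have j4 := hQ.g2.integrable_sq
  have hl4 := lin4 (1 / ν) (1 / ν) ν ν j1 j2 j3 j4
  have j5 : Integrable (fun x => 1 / ν * (f (x + z) - kQ k x) ^ 2 +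
      1 / ν * (g (x + z) - kD k x) ^ 2 + ν * kQ k x ^ 2 + ν * kD k x ^ 2) :=
    (((j1.const_mul _).add (j2.const_mul _)).add (j3.const_mul _)).add (j4.const_mul _)
  have hsup : ∀ x, |f (x + z) - kQ k x| ≤ 1 := by
    intro x
    have h1 := hη.sup x
    unfold dH at hd
    have h2 : (f (x + z) - kQ k x) ^ 2 ≤ 1 ^ 2 := by
      refine h1.trans (hd.trans ?_)
      exact pow_le_pow_left₀ hν.le hν1 2
    exact abs_le_of_sq_le_sq h2 zero_le_one
  calc |∫ x, (flx k (f (x + z)) (g (x + z)) (w1 (x + z)) (w3 (x + z))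
        - flx k (kQ k x) (kD k x) (w1 (x + z)) (w3 (x + z)))|
      ≤ ∫ x, |flx k (f (x + z)) (g (x + z)) (w1 (x + z)) (w3 (x + z))
        - flx k (kQ k x) (kD k x) (w1 (x + z)) (w3 (x + z))| := abs_integral_le_integral_abs
    _ ≤ ∫ x, (10 + 50 * k ^ 2) * W * (1 / ν * (f (x + z) - kQ k x) ^ 2 +
      1 / ν * (g (x + z) - kD k x) ^ 2 + ν * kQ k x ^ 2 + ν * kD k x ^ 2) := by
        refine integral_mono (i1.sub i2).abs (j5.const_mul _) fun x => ?_
        have := stat_pt k (f (x + z) - kQ k x) (g (x + z) - kD k x) (kQ k x) (kD k x) ν hν hν1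
          (hsup x) (kQ_pos k hk x).le (kQ_le k x) (w1 (x + z)) (w3 (x + z)) W (b1 _) (b3 _)
        simp only [add_sub_cancel] at this
        unfold flx
        refine this.trans (le_of_eq ?_)
        ring
    _ = (10 + 50 * k ^ 2) * W * (1 / ν * (∫ x, (f (x + z) - kQ k x) ^ 2) +
      1 / ν * (∫ x, (g (x + z) - kD k x) ^ 2) + ν * (∫ x, kQ k x ^ 2) + ν * ∫ x, kD k x ^ 2) := by
        rw [integral_const_mul, hl4]
    _ ≤ _ := by
        unfold dH at hd
        generalize (∫ x, (f (x + z) - kQ k x) ^ 2) = m at *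
        generalize (∫ x, (g (x + z) - kD k x) ^ 2) = G at *
        generalize (∫ x, kQ k x ^ 2) = q at *
        generalize (∫ x, kD k x ^ 2) = q' at *
        have h1 : 1 / ν * m + 1 / ν * G ≤ ν := by
          rw [← mul_add, one_div, inv_mul_le_iff₀ hν]; nlinarith
        have h2 : (10 + 50 * k ^ 2) * W * (1 / ν * m + 1 / ν * G + ν * q + ν * q') ≤
            (10 + 50 * k ^ 2) * W * (ν + ν * q + ν * q') :=
          mul_le_mul_of_nonneg_left (by linarith) (by positivity)
        refine h2.trans (le_of_eq ?_)
        ring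

theorem hmono (k : ℝ) (hk : 0 < k) : ∃ m : ℝ, 0 < m ∧ ∀ d : ℝ, m * min |d| 1 ≤
    |(∫ x, kQ k x ^ 2 * kT k (x + d)) - ∫ x, kQ k x ^ 2 * kT k x| := by
  obtain ⟨m, hm, hmv⟩ := hT_mvt k hk
  have hQ2 := (kQ_H1 k hk 0).f2.integrable_sq
  have hI : 0 < ∫ x in Icc (-1:ℝ) 1, kQ k x ^ 2 := by
    rw [setIntegral_pos_iff_support_of_nonneg_ae
      (Eventually.of_forall fun x => sq_nonneg _) hQ2.integrableOn]
    have : Function.support (fun x => kQ k x ^ 2) = univ := by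
      ext x; simp [(kQ_pos k hk x).ne']
    rw [this, univ_inter, Real.volume_Icc]; norm_num
  have hTi : ∀ d, Integrable (fun x => kQ k x ^ 2 * kT k (x + d)) := by
    intro d
    refine (int_bdd_mul hQ2 ((kT_cont k).comp (continuous_id.add continuous_const)) 1
      (fun x => (kT_abs k (x + d)).le)).congr (Eventually.of_forall fun x => ?_)
    exact mul_comm _ _
  refine ⟨(∫ x in Icc (-1:ℝ) 1, kQ k x ^ 2) * m, by positivity, fun d => ?_⟩
  have h0 : (∫ x, kQ k x ^ 2 * kT k x) = ∫ x, kQ k x ^ 2 * kT k (x + 0) := by simp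
  rw [h0]
  obtain ⟨r, hr⟩ : ∃ r, r = min |d| 1 := ⟨_, rfl⟩
  rw [← hr]
  have hr0 : 0 ≤ r := by rw [hr]; exact le_min (abs_nonneg _) zero_le_one
  have hr1 : r ≤ 1 := by rw [hr]; exact min_le_right _ _
  have hrd : r ≤ |d| := by rw [hr]; exact min_le_left _ _
  have gen : ∀ a b : ℝ, (∀ x : ℝ, kT k (x + a) ≤ kT k (x + b)) →
      (∀ x : ℝ, -1 ≤ x → x ≤ 1 → m * r ≤ kT k (x + b) - kT k (x + a)) →
      (∫ x in Icc (-1:ℝ) 1, kQ k x ^ 2) * m * r ≤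
        (∫ x, kQ k x ^ 2 * kT k (x + b)) - ∫ x, kQ k x ^ 2 * kT k (x + a) := by
    intro a b h1 h2
    rw [← integral_sub (hTi b) (hTi a)]
    have i := (hTi b).sub (hTi a)
    calc (∫ x in Icc (-1:ℝ) 1, kQ k x ^ 2) * m * r
        = ∫ x in Icc (-1:ℝ) 1, kQ k x ^ 2 * (m * r) := by rw [integral_mul_const]; ring
      _ ≤ ∫ x in Icc (-1:ℝ) 1, (kQ k x ^ 2 * kT k (x + b) - kQ k x ^ 2 * kT k (x + a)) := by
          refine setIntegral_mono_on (hQ2.mul_const _).integrableOn i.integrableOn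
            measurableSet_Icc fun x hx => ?_
          rw [← mul_sub]
          exact mul_le_mul_of_nonneg_left (h2 x hx.1 hx.2) (sq_nonneg _)
      _ ≤ _ := by
          refine setIntegral_le_integral i (Eventually.of_forall fun x => ?_)
          show 0 ≤ kQ k x ^ 2 * kT k (x + b) - kQ k x ^ 2 * kT k (x + a)
          rw [← mul_sub]
          exact mul_nonneg (sq_nonneg _) (sub_nonneg.2 (h1 x))
  have mono := (kT_mono k hk).monotone
  rcases le_total 0 d with hd | hd
  · rw [abs_of_nonneg hd] at hrd
    refine (gen 0 d (fun x => mono (by linarith)) fun x hx hx' => ?_).trans (le_abs_self _)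
    have h1 := hmv x (x + r) (by linarith) (by linarith) (by linarith)
    have h2 : kT k (x + r) ≤ kT k (x + d) := mono (by linarith)
    rw [add_zero]
    have h3 : m * (x + r - x) = m * r := by ring
    linarith
  · rw [abs_of_nonpos hd] at hrd
    refine (gen d 0 (fun x => mono (by linarith)) fun x hx hx' => ?_).trans ?_
    · have h1 := hmv (x - r) x (by linarith) (by linarith) (by linarith)
      have h2 : kT k (x + d) ≤ kT k (x - r) := mono (by linarith)
      rw [add_zero]
      have h3 : m * (x - (x - r)) = m * r := by ring
      linarith
    · rw [abs_sub_comm]; exact le_abs_self _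

theorem incr (k : ℝ) (hk : 0 < k) (K2 : ℝ) (hK2 : 0 < K2) : ∃ Ki δ1 : ℝ, 0 < Ki ∧ 0 < δ1 ∧
    ∀ (u ux uxx uxxx ut uxt : ℝ → ℝ → ℝ), Kd u ux uxx uxxx ut uxt → ∀ δ : ℝ, 0 < δ → δ ≤ δ1 →
    (∀ τ, 0 ≤ τ → ∃ z, dH k (hl u τ) (hl ux τ) z ≤ K2 * δ ^ 2) →
    ∀ s t zs zt : ℝ, 0 ≤ s → s ≤ t → t ≤ s + 1 → dH k (hl u s) (hl ux s) zs ≤ K2 * δ ^ 2 →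
    dH k (hl u t) (hl ux t) zt ≤ K2 * δ ^ 2 → |zt - zs - 4 * k ^ 2 * (t - s)| ≤ Ki * δ := by
  obtain ⟨C, hC, hstat⟩ := stat k hk
  obtain ⟨K1, hK1, hinv⟩ := init_inv k hk K2 hK2
  obtain ⟨m, hm, hmon⟩ := hmono k hk
  obtain ⟨κ, hκ⟩ : ∃ κ, κ = K2 + 1 := ⟨_, rfl⟩
  have hκ0 : 0 < κ := by rw [hκ]; positivity
  obtain ⟨W, hW⟩ : ∃ W, W = kWb k := ⟨_, rfl⟩
  have hW2 : 2 ≤ W := by rw [hW]; unfold kWb; nlinarith [pow_pos hk 2, pow_pos hk 3]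
  obtain ⟨A, hA⟩ : ∃ A, A = 3 * (C * W * κ) + 2 * K1 := ⟨_, rfl⟩
  have hA0 : 0 < A := by rw [hA]; positivity
  refine ⟨A / m, min (1 / κ) (min 2 (m / (2 * A))), by positivity, by positivity, ?_⟩
  intro u ux uxx uxxx ut uxt K δ hδ hδ1 hall s t zs zt hs hst ht1 hzs hzt
  have d1 : δ ≤ 1 / κ := hδ1.trans (min_le_left _ _)
  have d2 : δ ≤ 2 := hδ1.trans ((min_le_right _ _).trans (min_le_left _ _))
  have d3 : δ ≤ m / (2 * A) := hδ1.trans ((min_le_right _ _).trans (min_le_right _ _))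
  obtain ⟨ν, hν⟩ : ∃ ν, ν = κ * δ := ⟨_, rfl⟩
  have hν0 : 0 < ν := by rw [hν]; positivity
  have hν1 : ν ≤ 1 := by
    rw [hν]; rw [le_div_iff₀ hκ0] at d1; linarith
  have hνν : K2 * δ ^ 2 ≤ ν ^ 2 := by
    rw [hν, hκ]; nlinarith [mul_pos hK2 (pow_pos hδ 2), mul_pos (mul_pos hK2 hK2) (pow_pos hδ 2),
      pow_pos hδ 2]
  have ht : 0 ≤ t := hs.trans hst
  obtain ⟨a, ha⟩ : ∃ a, a = zs - 4 * k ^ 2 * s := ⟨_, rfl⟩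
  have shc : ∀ (w : ℝ → ℝ) (τ : ℝ), Continuous w → Continuous fun x => w (x - 4 * k ^ 2 * τ - a) :=
    fun w τ hw => hw.comp ((continuous_id.sub continuous_const).sub continuous_const)
  have flux : ∀ τ, 0 ≤ τ → |∫ x, flx k (hl u τ x) (hl ux τ x) (kw1 k (x - 4 * k ^ 2 * τ - a))
      (kw3 k (x - 4 * k ^ 2 * τ - a))| ≤ C * W * ν := by
    intro τ hτ
    obtain ⟨z, hz⟩ := hall τ hτ
    have h1 := hstat 0 _ _ (K.H1 hτ) z ν hν0 hν1 (hz.trans hνν)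
      (fun x => kw1 k (x - 4 * k ^ 2 * τ - a)) (fun x => kw3 k (x - 4 * k ^ 2 * τ - a)) W
      (shc _ _ (kw1_cont k)) (shc _ _ (kw3_cont k)) (fun x => hW ▸ (kw_bound k hk _).2.1)
      (fun x => hW ▸ (kw_bound k hk _).2.2.2)
    have h2 : ∫ x, flx k (kQ k x) (kD k x) (kw1 k (x + z - 4 * k ^ 2 * τ - a))
        (kw3 k (x + z - 4 * k ^ 2 * τ - a)) = 0 := by
      rw [← flux_Q k hk (z - 4 * k ^ 2 * τ - a)]
      congr 1; funext x
      rw [show x + z - 4 * k ^ 2 * τ - a = x + (z - 4 * k ^ 2 * τ - a) by ring]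
      rfl
    rw [h2, sub_zero] at h1
    exact h1
  have hT1 : ∀ y, |kT k y| ≤ W := fun y => (kw_bound k hk y).1.trans (by linarith)
  have wm : ∀ τ z : ℝ, 0 ≤ τ → dH k (hl u τ) (hl ux τ) z ≤ K2 * δ ^ 2 →
      |(∫ x, hl u τ x ^ 2 * kT k (x - 4 * k ^ 2 * τ - a))
        - ∫ x, kQ k x ^ 2 * kT k (x + (z - 4 * k ^ 2 * τ - a))| ≤ C * W * ν := by
    intro τ z hτ hz
    have h1 := hstat 0 _ _ (K.H1 hτ) z ν hν0 hν1 (hz.trans hνν)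
      (fun x => 0) (fun x => kT k (x - 4 * k ^ 2 * τ - a)) W
      continuous_const (shc _ _ (kT_cont k)) (fun x => by simp only [abs_zero]; linarith)
      (fun x => hT1 _)
    have e1 : ∀ x : ℝ, x + z - 4 * k ^ 2 * τ - a = x + (z - 4 * k ^ 2 * τ - a) := fun x => by ring
    simp only [flx, mul_zero, zero_add, e1] at h1
    exact h1
  have ei : ∀ τ, 0 ≤ τ → Integrable (fun x => hl u τ x ^ 2 * kT k (x - 4 * k ^ 2 * τ - a)) := by
    intro τ hτ
    refine (int_bdd_mul (K.H1 hτ).f2.integrable_sq (shc _ τ (kT_cont k)) W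
      (fun x => hT1 _)).congr (Eventually.of_forall fun x => ?_)
    exact mul_comm _ _
  have wp : ∀ τ, 0 ≤ τ → ∫ x, hl u τ x ^ 2 * (1 + kT k (x - 4 * k ^ 2 * τ - a)) =
      fM (hl u τ) + ∫ x, hl u τ x ^ 2 * kT k (x - 4 * k ^ 2 * τ - a) := by
    intro τ hτ
    simp only [mul_add, mul_one]
    exact integral_add (K.H1 hτ).f2.integrable_sq (ei τ hτ)
  have wn : ∀ τ, 0 ≤ τ → ∫ x, hl u τ x ^ 2 * (1 - kT k (x - 4 * k ^ 2 * τ - a)) =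
      fM (hl u τ) - ∫ x, hl u τ x ^ 2 * kT k (x - 4 * k ^ 2 * τ - a) := by
    intro τ hτ
    simp only [mul_sub, mul_one]
    exact integral_sub (K.H1 hτ).f2.integrable_sq (ei τ hτ)
  have g1 := K.wmass hs hst (fun y => 1 + kT k y) (kw1 k) (kw2 k) (kw3 k) W (4 * k ^ 2) a
    (C * W * ν) (fun y => by linarith [kT_gt k y]) (fun y => (kT_deriv k y).const_add 1)
    (kw1_deriv k) (kw2_deriv k) (kw3_cont k) (fun y => by
      obtain ⟨b0, b1, b2, b3⟩ := kw_bound k hk y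
      rw [← hW] at b1 b2 b3
      refine ⟨?_, b1, b2, b3⟩
      have := abs_le.1 b0
      exact abs_le.2 ⟨by linarith, by linarith⟩)
    (fun τ h1 h2 => (le_abs_self _).trans (flux τ (hs.trans h1)))
  have g2 := K.wmass hs hst (fun y => 1 - kT k y) (fun y => -kw1 k y) (fun y => -kw2 k y)
    (fun y => -kw3 k y) W (4 * k ^ 2) a
    (C * W * ν) (fun y => by linarith [kT_lt k y]) (fun y => (kT_deriv k y).const_sub 1)
    (fun y => (kw1_deriv k y).neg) (fun y => (kw2_deriv k y).neg) (kw3_cont k).neg (fun y => by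
      obtain ⟨b0, b1, b2, b3⟩ := kw_bound k hk y
      rw [← hW] at b1 b2 b3
      rw [abs_neg, abs_neg, abs_neg]
      refine ⟨?_, b1, b2, b3⟩
      have := abs_le.1 b0
      exact abs_le.2 ⟨by linarith, by linarith⟩)
    (fun τ h1 h2 => by
      refine le_trans (le_of_eq ?_) ((neg_le_abs _).trans (flux τ (hs.trans h1)))
      rw [← integral_neg]
      congr 1; funext x
      unfold flx; ring)
  rw [wp t ht, wp s hs] at g1
  rw [wn t ht, wn s hs] at g2
  have m1 := (hinv 0 _ _ (K.H1 hs) zs δ hδ d2 hzs).1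
  have m2 := (hinv 0 _ _ (K.H1 ht) zt δ hδ d2 hzt).1
  have n1 := wm s zs hs hzs
  have n2 := wm t zt ht hzt
  have hd0 : zs - 4 * k ^ 2 * s - a = 0 := by rw [ha]; ring
  have hd : zt - 4 * k ^ 2 * t - a = zt - zs - 4 * k ^ 2 * (t - s) := by rw [ha]; ring
  rw [hd0] at n1
  rw [hd] at n2
  simp only [add_zero] at n1
  have h5 := hmon (zt - zs - 4 * k ^ 2 * (t - s))
  generalize zt - zs - 4 * k ^ 2 * (t - s) = d at *
  have h6 : |(∫ x, kQ k x ^ 2 * kT k (x + d)) - ∫ x, kQ k x ^ 2 * kT k x| ≤ A * δ := by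
    have e1 : A * δ = 3 * (C * W * ν) + 2 * (K1 * δ) := by rw [hA, hν]; ring
    have hP : 0 ≤ C * W * ν := by positivity
    have e2 : C * W * ν * (t - s) ≤ C * W * ν := by
      have := mul_le_mul_of_nonneg_left (show t - s ≤ 1 by linarith) hP
      linarith
    have m1 := abs_le.1 m1
    have m2 := abs_le.1 m2
    have n1 := abs_le.1 n1
    have n2 := abs_le.1 n2
    rw [e1]
    exact abs_le.2 ⟨by linarith only [m1.1, m1.2, m2.1, m2.2, n1.1, n1.2, n2.1, n2.2, e2, g1, g2],
      by linarith only [m1.1, m1.2, m2.1, m2.2, n1.1, n1.2, n2.1, n2.2, e2, g1, g2]⟩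
  have h7 : m * min |d| 1 ≤ A * δ := h5.trans h6
  have h8 : A * δ ≤ m / 2 := by
    rw [le_div_iff₀ (by positivity)] at d3; linarith
  have h9 : min |d| 1 = |d| := by
    rcases le_total |d| 1 with h | h
    · exact min_eq_left h
    · rw [min_eq_right h] at h7; linarith
  rw [h9] at h7
  rw [div_mul_eq_mul_div, le_div_iff₀ hm]
  linarith

/-! ### Shifts of the profile and the modulation path -/

theorem kQ_shift_le (k : ℝ) (hk : 0 < k) (x y : ℝ) (h : |y - x| ≤ 1) :
    kQ k y ≤ Real.exp (2 * k) * kQ k x := by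
  have hc : Real.cosh (k * x) ≤ Real.exp k * Real.cosh (k * y) := by
    have h1 := abs_le.1 h
    rw [Real.cosh_eq, Real.cosh_eq]
    have e1 : Real.exp (k * x) ≤ Real.exp k * Real.exp (k * y) := by
      rw [← Real.exp_add]; apply Real.exp_le_exp.2; nlinarith
    have e2 : Real.exp (-(k * x)) ≤ Real.exp k * Real.exp (-(k * y)) := by
      rw [← Real.exp_add]; apply Real.exp_le_exp.2; nlinarith
    linarith
  have h0 := Real.cosh_pos (k * x)
  have h1 := Real.cosh_pos (k * y)
  have h2 := pow_le_pow_left₀ h0.le hc 2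
  have e3 : Real.exp k ^ 2 = Real.exp (2 * k) := by
    rw [← Real.exp_nat_mul]; norm_num
  rw [mul_pow, e3] at h2
  have h3 : kS k y ≤ Real.exp (2 * k) * kS k x := by
    rw [kS_eq, kS_eq, mul_one_div, div_le_div_iff₀ (by positivity) (by positivity)]
    linarith
  unfold kQ
  have : 0 < 6 * k ^ 2 := by positivity
  nlinarith

theorem mvt_shift (k : ℝ) (hk : 0 < k) (F F' : ℝ → ℝ) (A : ℝ) (hA : 0 ≤ A)
    (hF : ∀ x : ℝ, HasDerivAt F (F' x) x) (hb : ∀ x : ℝ, |F' x| ≤ A * kQ k x)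
    (x a : ℝ) (ha : |a| ≤ 1) :
    (F x - F (x + a)) ^ 2 ≤ (A * Real.exp (2 * k)) ^ 2 * a ^ 2 * kQ k x ^ 2 := by
  have h := Convex.norm_image_sub_le_of_norm_hasDerivWithin_le (f := F) (f' := F')
    (s := Icc (x - 1) (x + 1)) (C := A * (Real.exp (2 * k) * kQ k x)) (x := x + a) (y := x)
    (fun y _ => (hF y).hasDerivWithinAt)
    (fun y hy => by
      rw [Real.norm_eq_abs]
      refine (hb y).trans (mul_le_mul_of_nonneg_left (kQ_shift_le k hk x y ?_) hA)
      rw [abs_le]; constructor <;> linarith [hy.1, hy.2])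
    (convex_Icc _ _)
    (by have := abs_le.1 ha; constructor <;> linarith) (by constructor <;> linarith)
  rw [Real.norm_eq_abs, Real.norm_eq_abs] at h
  have h2 := pow_le_pow_left₀ (abs_nonneg _) h 2
  rw [sq_abs, mul_pow, sq_abs] at h2
  refine h2.trans (le_of_eq ?_)
  ring

theorem sq_shift (k : ℝ) (hk : 0 < k) (F F' f : ℝ → ℝ) (A : ℝ) (hA : 0 ≤ A)
    (hF : ∀ x : ℝ, HasDerivAt F (F' x) x) (hb : ∀ x : ℝ, |F' x| ≤ A * kQ k x)
    (hF2 : MemLp F 2) (hf : MemLp f 2) (z z' : ℝ) (ha : |z - z'| ≤ 1) :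
    ∫ x, (f (x + z') - F x) ^ 2 ≤ 2 * (∫ x, (f (x + z) - F x) ^ 2) +
      2 * (((A * Real.exp (2 * k)) ^ 2 * ∫ x, kQ k x ^ 2) * (z' - z) ^ 2) := by
  have hs : ∀ w : ℝ, MemLp (fun x => f (x + w)) 2 := fun w =>
    hf.comp_measurePreserving (measurePreserving_add_right volume w)
  have hs' : ∀ w : ℝ, MemLp (fun x => F (x + w)) 2 := fun w =>
    hF2.comp_measurePreserving (measurePreserving_add_right volume w)
  have e1 : ∫ x, (f (x + z') - F x) ^ 2 = ∫ x, (f (x + z) - F (x + (z - z'))) ^ 2 := by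
    rw [← integral_add_right_eq_self (fun x => (f (x + z') - F x) ^ 2) (z - z')]
    refine integral_congr_ae (Eventually.of_forall fun x => ?_)
    simp only
    rw [show x + (z - z') + z' = x + z by ring]
  rw [e1]
  have i1 : Integrable (fun x => (f (x + z) - F x) ^ 2) := ((hs z).sub hF2).integrable_sq
  have i2 : Integrable (fun x => kQ k x ^ 2) := (kQ_H1 k hk 0).f2.integrable_sq
  have i3 : Integrable (fun x => (f (x + z) - F (x + (z - z'))) ^ 2) :=
    ((hs z).sub (hs' (z - z'))).integrable_sq
  rw [show 2 * (∫ x, (f (x + z) - F x) ^ 2) +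
      2 * (((A * Real.exp (2 * k)) ^ 2 * ∫ x, kQ k x ^ 2) * (z' - z) ^ 2) =
      2 * (∫ x, (f (x + z) - F x) ^ 2) +
      (2 * ((A * Real.exp (2 * k)) ^ 2 * (z - z') ^ 2)) * ∫ x, kQ k x ^ 2 by ring,
    ← integral_const_mul, ← integral_const_mul,
    ← integral_add (i1.const_mul _) (i2.const_mul _)]
  refine integral_mono i3 ((i1.const_mul _).add (i2.const_mul _)) fun x => ?_
  have h := mvt_shift k hk F F' A hA hF hb x (z - z') ha
  simp only
  nlinarith [sq_nonneg ((f (x + z) - F x) - (F x - F (x + (z - z'))))]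

theorem dH_shift (k : ℝ) (hk : 0 < k) : ∃ Ks, 0 < Ks ∧ ∀ e f g, H1f e f g →
    ∀ z z' : ℝ, |z - z'| ≤ 1 → dH k f g z' ≤ 2 * dH k f g z + Ks * (z' - z) ^ 2 := by
  refine ⟨2 * ((2 * k * Real.exp (2 * k)) ^ 2 * ∫ x, kQ k x ^ 2) +
    2 * ((4 * k ^ 2 * Real.exp (2 * k)) ^ 2 * ∫ x, kQ k x ^ 2), ?_, ?_⟩
  · have := Qsq_pos k hk
    positivity
  · intro e f g h z z' ha
    have h1 := sq_shift k hk (kQ k) (kD k) f (2 * k) (by positivity) (kQ_deriv k)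
      (kD_abs k hk) (kQ_H1 k hk 0).f2 h.f2 z z' ha
    have h2 := sq_shift k hk (kD k) (kE k) g (4 * k ^ 2) (by positivity) (kD_deriv k)
      (kE_abs k hk) (kD_H1 k hk 0).f2 h.g2 z z' ha
    unfold dH
    generalize (∫ x, kQ k x ^ 2) = q at *
    linarith

theorem sT_deriv_zero (y : ℝ) (h : y ≤ 0 ∨ 1 ≤ y) : deriv Real.smoothTransition y = 0 := by
  rcases h with h | h
  · apply IsLocalMin.deriv_eq_zero
    refine Eventually.of_forall fun x => ?_
    rw [Real.smoothTransition.zero_of_nonpos h]; exact Real.smoothTransition.nonneg x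
  · apply IsLocalMax.deriv_eq_zero
    refine Eventually.of_forall fun x => ?_
    rw [Real.smoothTransition.one_of_one_le h]; exact Real.smoothTransition.le_one x

theorem sT_bound : ∃ B, 0 < B ∧ ∀ y : ℝ, |deriv Real.smoothTransition y| ≤ B := by
  have hc : Continuous (deriv Real.smoothTransition) :=
    (Real.smoothTransition.contDiff (n := 1)).continuous_deriv (by norm_num)
  obtain ⟨B, hB⟩ := isCompact_Icc.exists_bound_of_continuousOn (s := Icc (0:ℝ) 1) hc.continuousOn
  refine ⟨|B| + 1, by positivity, fun y => ?_⟩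
  by_cases hy : y ∈ Icc (0:ℝ) 1
  · have := hB y hy
    rw [Real.norm_eq_abs] at this
    linarith [le_abs_self B]
  · rw [sT_deriv_zero y]
    · simp; positivity
    · by_contra hh; push Not at hh; exact hy ⟨hh.1.le, hh.2.le⟩

theorem path : ∃ B, 0 < B ∧ ∀ (c η : ℝ) (z : ℝ → ℝ),
    (∀ s t : ℝ, 0 ≤ s → s ≤ t → t ≤ s + 1 → |z t - z s - c * (t - s)| ≤ η) →
    ∃ R : ℝ → ℝ, ContDiff ℝ 1 R ∧ (∀ t, 0 ≤ t → |R t - z t| ≤ 2 * η) ∧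
      ∀ t, 0 ≤ t → |deriv R t - c| ≤ B * η := by
  obtain ⟨B, hB, hBd⟩ := sT_bound
  refine ⟨B, hB, fun c η z hz => ?_⟩
  set w : ℕ → ℝ := fun n => z n - c * n with hw
  set RN : ℕ → ℝ → ℝ := fun N t => c * t + w 0 +
    ∑ n ∈ Finset.range N, (w (n + 1) - w n) * Real.smoothTransition (t - n) with hRN
  set R : ℝ → ℝ := fun t => RN ⌈t⌉₊ t with hR
  have hagree : ∀ N : ℕ, ∀ t : ℝ, t ≤ N → R t = RN N t := by
    intro N t ht
    have hle : ⌈t⌉₊ ≤ N := Nat.ceil_le.2 ht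
    simp only [hR, hRN]
    congr 1
    refine Finset.sum_subset (Finset.range_subset_range.2 hle) fun n _ hn => ?_
    rw [Finset.mem_range, not_lt] at hn
    have : t - n ≤ 0 := by linarith [Nat.ceil_le.1 hn]
    rw [Real.smoothTransition.zero_of_nonpos this, mul_zero]
  have hev : ∀ N : ℕ, ∀ t : ℝ, t < N → R =ᶠ[nhds t] RN N := by
    intro N t ht
    filter_upwards [Iio_mem_nhds ht] with s hs
    exact hagree N s (le_of_lt hs)
  have hcd : ∀ N : ℕ, ContDiff ℝ 1 (RN N) := by
    intro N
    simp only [hRN]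
    refine ((contDiff_const.mul contDiff_id).add contDiff_const).add (ContDiff.sum fun n _ => ?_)
    exact contDiff_const.mul
      ((Real.smoothTransition.contDiff (n := 1)).comp (contDiff_id.sub contDiff_const))
  have hinc : ∀ n : ℕ, |w (n + 1) - w n| ≤ η := by
    intro n
    have := hz n (n + 1) (by positivity) (by linarith) le_rfl
    simp only [hw]
    push_cast
    rwa [show z (n + 1) - c * ((n:ℝ) + 1) - (z n - c * n) =
      z (n + 1) - z n - c * ((n:ℝ) + 1 - n) by ring]
  refine ⟨R, ?_, ?_, ?_⟩
  · rw [contDiff_iff_contDiffAt]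
    intro t
    obtain ⟨N, hN⟩ := exists_nat_gt t
    exact (hcd N).contDiffAt.congr_of_eventuallyEq (hev N t hN)
  · intro t ht
    set n := ⌊t⌋₊ with hn
    have h1 : (n:ℝ) ≤ t := Nat.floor_le ht
    have h2 : t < n + 1 := Nat.lt_floor_add_one t
    have e : R t = c * t + w n + (w (n + 1) - w n) * Real.smoothTransition (t - n) := by
      rw [hagree (n + 1) t (by push_cast; exact h2.le)]
      simp only [hRN]
      rw [Finset.sum_range_succ]
      have : ∑ j ∈ Finset.range n, (w (j + 1) - w j) * Real.smoothTransition (t - j) =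
          ∑ j ∈ Finset.range n, (w (j + 1) - w j) := by
        refine Finset.sum_congr rfl fun j hj => ?_
        have hj' : (j:ℝ) + 1 ≤ n := by exact_mod_cast Finset.mem_range.1 hj
        rw [Real.smoothTransition.one_of_one_le (by linarith), mul_one]
      rw [this, Finset.sum_range_sub]
      ring
    have h3 := hz n t (by positivity) h1 h2.le
    have e2 : R t - z t = -(z t - z n - c * (t - n)) +
        (w (n + 1) - w n) * Real.smoothTransition (t - n) := by
      rw [e]; simp only [hw]; ring
    rw [e2]
    have h4 := hinc n
    have h5 : |(w (n + 1) - w n) * Real.smoothTransition (t - n)| ≤ η := by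
      rw [abs_mul, abs_of_nonneg (Real.smoothTransition.nonneg _)]
      have := mul_le_mul_of_nonneg_left (Real.smoothTransition.le_one (t - n))
        (abs_nonneg (w (n + 1) - w n))
      linarith
    refine (abs_add_le _ _).trans ?_
    rw [abs_neg]
    linarith
  · intro t ht
    set n := ⌊t⌋₊ with hn
    have h1 : (n:ℝ) ≤ t := Nat.floor_le ht
    have h2 : t < n + 1 := Nat.lt_floor_add_one t
    have hd : HasDerivAt (RN (n + 1)) (c + ∑ j ∈ Finset.range (n + 1),
        (w (j + 1) - w j) * deriv Real.smoothTransition (t - j)) t := by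
      simp only [hRN]
      have ha : HasDerivAt (fun t : ℝ => c * t + w 0) c t := by
        simpa using ((hasDerivAt_id t).const_mul c).add_const (w 0)
      refine ha.add (HasDerivAt.fun_sum fun j _ => ?_)
      have hS : HasDerivAt Real.smoothTransition (deriv Real.smoothTransition (t - j)) (t - j) :=
        ((Real.smoothTransition.contDiff (n := 1)).differentiable (by norm_num) _).hasDerivAt
      exact (hS.comp_sub_const t (j:ℝ)).const_mul _
    have e : deriv R t = c + (w (n + 1) - w n) * deriv Real.smoothTransition (t - n) := by
      rw [(hev (n + 1) t (by push_cast; exact h2)).deriv_eq, hd.deriv, Finset.sum_range_succ]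
      rw [Finset.sum_eq_zero, zero_add]
      intro j hj
      have hj' : (j:ℝ) + 1 ≤ n := by exact_mod_cast Finset.mem_range.1 hj
      rw [sT_deriv_zero _ (Or.inr (by linarith)), mul_zero]
    rw [e, add_sub_cancel_left, abs_mul, mul_comm B]
    exact mul_le_mul (hinc n) (hBd _) (abs_nonneg _) ((abs_nonneg _).trans (hinc n))

/-! ### Assembly -/

theorem main_k (k : ℝ) (hk : 0 < k) : ∃ δs C0 C1, 0 < δs ∧ 0 < C0 ∧ 0 < C1 ∧
    ∀ u ux uxx uxxx ut uxt, Kd u ux uxx uxxx ut uxt → ∀ α L : ℝ, 0 < α →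
      α + Real.exp (-(2 * k * L)) ≤ δs →
      ∫ x in Ioi 0, ((u x 0 - kQ k (x - L)) ^ 2 + (ux x 0 - kD k (x - L)) ^ 2) ≤ α ^ 2 →
      ∃ R : ℝ → ℝ, ContDiff ℝ 1 R ∧
        (∀ t : ℝ, 0 ≤ t →
          ∫ x in Ioi 0, ((u x t - kQ k (x - R t)) ^ 2 + (ux x t - kD k (x - R t)) ^ 2) ≤
            C0 * (α + Real.exp (-(2 * k * L))) ^ 2) ∧
        ∀ t : ℝ, 0 ≤ t → |deriv R t - 4 * k ^ 2| ≤ C1 * (α + Real.exp (-(2 * k * L))) := by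
  obtain ⟨K0, hK0, hstart⟩ := init_dH k hk
  obtain ⟨K1, hK1, hinv⟩ := init_inv k hk K0 hK0
  obtain ⟨ε, K2, δ0, hε, hK2, hδ0, hcore⟩ := core k hk K1 hK1
  obtain ⟨Ki, δ1, hKi, hδ1, hincr⟩ := incr k hk K2 hK2
  obtain ⟨Ks, hKs, hshift⟩ := dH_shift k hk
  obtain ⟨B, hB, hpath⟩ := path
  refine ⟨min (min (min δ0 δ1) 2) (min (ε / (2 * (K0 + K2 + 1))) (1 / (2 * Ki))),
    2 * K2 + Ks * (2 * Ki) ^ 2, B * Ki, by positivity, by positivity, by positivity, ?_⟩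
  intro u ux uxx uxxx ut uxt K α L hα hδs h0
  have hδ : 0 < α + Real.exp (-(2 * k * L)) := by positivity
  have hstart := hstart u ux uxx uxxx ut uxt K α L hα h0
  generalize α + Real.exp (-(2 * k * L)) = δ at *
  have l0 : δ ≤ δ0 := hδs.trans ((min_le_left _ _).trans ((min_le_left _ _).trans (min_le_left _ _)))
  have l1 : δ ≤ δ1 := hδs.trans ((min_le_left _ _).trans ((min_le_left _ _).trans (min_le_right _ _)))
  have l2 : δ ≤ 2 := hδs.trans ((min_le_left _ _).trans (min_le_right _ _))
  have l3 : δ ≤ ε / (2 * (K0 + K2 + 1)) := hδs.trans ((min_le_right _ _).trans (min_le_left _ _))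
  have l4 : δ ≤ 1 / (2 * Ki) := hδs.trans ((min_le_right _ _).trans (min_le_right _ _))
  rw [le_div_iff₀ (by positivity)] at l3 l4
  have l5 : (K0 + K2 + 1) * δ ^ 2 ≤ ε ^ 2 / 4 := by
    have := pow_le_pow_left₀ (by positivity) l3 2
    have m1 : (K0 + K2 + 1) * δ ^ 2 ≤ (K0 + K2 + 1) * ((K0 + K2 + 1) * δ ^ 2) := by
      have : 0 ≤ (K0 + K2 + 1) * δ ^ 2 := by positivity
      nlinarith
    nlinarith
  have l6 : K0 * δ ^ 2 ≤ ε ^ 2 := by nlinarith [sq_nonneg δ, sq_nonneg ε]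
  have l7 : K2 * δ ^ 2 ≤ ε ^ 2 / 4 := by nlinarith [sq_nonneg δ, sq_nonneg ε]
  obtain ⟨v1, v2, v3⟩ := hinv 0 _ _ (K.H1 le_rfl) L δ hδ l2 hstart
  have v1 := (abs_le.1 v1).2
  have hall : ∀ t : ℝ, 0 ≤ t → ∃ z, dH k (hl u t) (hl ux t) z ≤ K2 * δ ^ 2 := by
    refine K.boot k hk ε (K2 * δ ^ 2) hε l7 ?_ ⟨L, (dM_le_dH k _ (hl ux 0) L).trans (hstart.trans l6)⟩
    intro t ht hz
    have m := K.mass le_rfl ht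
    have en := K.energy le_rfl ht
    have m' : 2 * k ^ 2 * fM (hl u t) ≤ 2 * k ^ 2 * fM (hl u 0) :=
      mul_le_mul_of_nonneg_left m (by positivity)
    exact hcore 0 _ _ (K.H1 ht) (K.int ht) hz δ hδ l0 (by linarith only [m, v1])
      (by linarith only [en, v2]) (by linarith only [en, m', v3])
  have hex : ∀ t : ℝ, ∃ z, 0 ≤ t → dH k (hl u t) (hl ux t) z ≤ K2 * δ ^ 2 := by
    intro t
    by_cases ht : 0 ≤ t
    · obtain ⟨z, hz⟩ := hall t ht
      exact ⟨z, fun _ => hz⟩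
    · exact ⟨0, fun h => absurd h ht⟩
  choose z hz using hex
  obtain ⟨R, hR, hR1, hR2⟩ := hpath (4 * k ^ 2) (Ki * δ) z (fun s t hs hst ht =>
    hincr u ux uxx uxxx ut uxt K δ hδ l1 hall s t (z s) (z t) hs hst ht (hz s hs)
      (hz t (hs.trans hst)))
  refine ⟨R, hR, fun t ht => ?_, fun t ht => ?_⟩
  · have a1 := hR1 t ht
    have a2 := hshift 0 _ _ (K.H1 ht) (z t) (R t) (by rw [abs_sub_comm]; linarith)
    have a3 := hz t ht
    have a4 : (R t - z t) ^ 2 ≤ (2 * (Ki * δ)) ^ 2 := by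
      rw [← sq_abs]; exact pow_le_pow_left₀ (abs_nonneg _) a1 2
    have a5 := mul_le_mul_of_nonneg_left a4 hKs.le
    have a6 := K.dH_hl k hk ht (R t)
    have a7 : 0 ≤ ∫ (x : ℝ) in Set.Iic 0, kQ k (x - R t) ^ 2 + kD k (x - R t) ^ 2 :=
      integral_nonneg fun x => by positivity
    nlinarith only [a2, a3, a5, a6, a7]
  · have := hR2 t ht
    linarith

theorem soliton_stability_right_halfline (c : ℝ) (hc : 0 < c) :
    ∃ α₀ C₀ L₀ C : ℝ, 0 < α₀ ∧ 0 < C₀ ∧ 0 < L₀ ∧ 0 < C ∧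
      ∀ α : ℝ, 0 < α → α < α₀ → ∀ L : ℝ, L > L₀ →
        ∀ u : ℝ → ℝ → ℝ, RightKdVSolution u (Ici 0) →
          (∀ t ≥ (0 : ℝ), u 0 t = 0) →
          Real.sqrt (∫ x in Ioi (0 : ℝ),
              ((u x 0 - Qsol c (x - L)) ^ 2
                + (deriv (fun y => u y 0) x - deriv (Qsol c) (x - L)) ^ 2)) < α →
          ∃ ρ : ℝ → ℝ, ContDiff ℝ 1 ρ ∧
            (∀ t ≥ (0 : ℝ),
              Real.sqrt (∫ x in Ioi (0 : ℝ),
                  ((u x t - Qsol c (x - ρ t - L)) ^ 2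
                    + (deriv (fun y => u y t) x - deriv (Qsol c) (x - ρ t - L)) ^ 2))
                < C₀ * (α + Real.exp (-Real.sqrt c * L))) ∧
            (∀ t ≥ (0 : ℝ),
              |deriv ρ t - c| < C * C₀ * (α + Real.exp (-Real.sqrt c * L))) := by
  have hs : 0 < Real.sqrt c := Real.sqrt_pos.2 hc
  have hss : Real.sqrt c ^ 2 = c := Real.sq_sqrt hc.le
  obtain ⟨δs, A0, A1, hδs, hA0, hA1, hmain⟩ := main_k (Real.sqrt c / 2) (by positivity)
  refine ⟨δs / 2, A0 + 1, |Real.log (δs / 2)| / Real.sqrt c + 1, A1 + 1, by positivity,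
    by positivity, by positivity, by positivity, ?_⟩
  intro α hα hα0 L hL u hu hbd h0
  obtain ⟨ux, uxx, uxxx, ut, uxt, K⟩ := exists_Kd u hu hbd
  have hQ := Qsol_eq c hc
  have hQd : ∀ y : ℝ, deriv (Qsol c) y = kD (Real.sqrt c / 2) y := fun y => by
    rw [hQ]; exact (kQ_deriv _ y).deriv
  have hud : ∀ x t : ℝ, deriv (fun y => u y t) x = ux x t := fun x t => (K.d0 x t).deriv
  have hexp : Real.exp (-Real.sqrt c * L) = Real.exp (-(2 * (Real.sqrt c / 2) * L)) := by
    congr 1; ring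
  have hsm : Real.exp (-Real.sqrt c * L) ≤ δs / 2 := by
    rw [← Real.le_log_iff_exp_le (by positivity)]
    have h1 : |Real.log (δs / 2)| ≤ Real.sqrt c * L := by
      have : |Real.log (δs / 2)| / Real.sqrt c ≤ L := by linarith
      rw [div_le_iff₀ hs] at this
      linarith
    linarith [neg_abs_le (Real.log (δs / 2))]
  simp only [hQd, hud] at h0 ⊢
  rw [hQ] at h0 ⊢
  rw [Real.sqrt_lt' hα] at h0
  rw [hexp] at hsm ⊢
  obtain ⟨R, hR, hR1, hR2⟩ := hmain u ux uxx uxxx ut uxt K α L hα (by linarith) h0.le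
  have hδ : 0 < α + Real.exp (-(2 * (Real.sqrt c / 2) * L)) := by positivity
  generalize α + Real.exp (-(2 * (Real.sqrt c / 2) * L)) = δ at *
  refine ⟨fun t => R t - L, hR.sub contDiff_const, fun t ht => ?_, fun t ht => ?_⟩
  · have h1 := hR1 t ht
    have e : ∀ x : ℝ, x - (R t - L) - L = x - R t := fun x => by ring
    simp only [e]
    rw [Real.sqrt_lt' (by positivity)]
    refine h1.trans_lt ?_
    rw [mul_pow]
    exact mul_lt_mul_of_pos_right (by nlinarith) (by positivity)
  · have h1 := hR2 t ht
    rw [deriv_sub_const]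
    have e : 4 * (Real.sqrt c / 2) ^ 2 = c := by rw [div_pow, hss]; ring
    rw [e] at h1
    refine h1.trans_lt ?_
    exact mul_lt_mul_of_pos_right (by nlinarith) hδ
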